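/- arXiv:0711.2413 — 11 statements merged into one kernel-verified Lean document; each statement's English description precedes it below -/
import Mathlib

section
/- Let n ≥ 2 and m be natural numbers, and let Φ : S_n → S_m be a map preserving adjacency (i.e., whenever A, B ∈ S_n satisfy rank(A − B) = 1, then rank(Φ(A) − Φ(B)) = 1) with Φ(0) = 0. Then either: (i) there exist a rank-one matrix B ∈ S_m and a function f : S_n → ℝ such that Φ(A) = f(A)·B for all A ∈ S_n (Φ is degenerate); or (ii) there exist c ∈ {−1, 1} and an invertible matrix R ∈ M_m(ℝ) such that Φ(A) = c·R·[[A,0],[0,0]]·Rᵀ for all A ∈ S_n, where [[A,0],[0,0]] denotes the m×m block matrix with A in the upper-left n×n corner and zeros elsewhere (Φ is standard; in this case necessarily m ≥ n). -/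
open Matrix

/-- The `m × m` block matrix `[[A, 0], [0, 0]]` with `A` in the upper-left
`n × n` corner and zeros elsewhere. -/
def embedBlock (n m : ℕ) (A : Matrix (Fin n) (Fin n) ℝ) : Matrix (Fin m) (Fin m) ℝ :=
  Matrix.of fun i j =>
    if hi : (i : ℕ) < n then if hj : (j : ℕ) < n then A ⟨i, hi⟩ ⟨j, hj⟩ else 0 else 0


theorem pexider (H K : ℝ → ℝ)
    (h : ∀ a b a' b', a ≠ 0 → b ≠ 0 → a' ≠ 0 → b' ≠ 0 → a + b = a' + b' →
      H a + K b = H a' + K b') :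
    ∃ (Δ : ℝ → ℝ) (β γ : ℝ), (∀ x y, Δ (x + y) = Δ x + Δ y) ∧
      (∀ x, x ≠ 0 → H x = Δ x + β) ∧ (∀ x, x ≠ 0 → K x = Δ x + γ) := by
  -- difference depends only on step
  have key : ∀ x x' y : ℝ, x ≠ 0 → x + y ≠ 0 → x' ≠ 0 → x' + y ≠ 0 →
      H (x + y) - H x = K (x' + y) - K x' := by
    intro x x' y h1 h2 h3 h4
    have := h (x + y) x' x (x' + y) h2 h3 h1 h4 (by ring)
    linarith
  have keyH : ∀ x x' y : ℝ, x ≠ 0 → x + y ≠ 0 → x' ≠ 0 → x' + y ≠ 0 →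
      H (x + y) - H x = H (x' + y) - H x' := by
    intro x x' y h1 h2 h3 h4
    rw [key x x' y h1 h2 h3 h4, key x' x' y h3 h4 h3 h4]
  let Δ : ℝ → ℝ := fun y => H ((|y| + 1) + y) - H (|y| + 1)
  have hpos : ∀ y : ℝ, (|y| + 1) ≠ 0 ∧ (|y| + 1) + y ≠ 0 := by
    intro y
    have := neg_abs_le y
    have := abs_nonneg y
    constructor <;> intro h0 <;> linarith
  have hΔ : ∀ x y, x ≠ 0 → x + y ≠ 0 → H (x + y) - H x = Δ y := fun x y h1 h2 =>
    keyH x _ y h1 h2 (hpos y).1 (hpos y).2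
  have hΔK : ∀ x y, x ≠ 0 → x + y ≠ 0 → K (x + y) - K x = Δ y := fun x y h1 h2 =>
    (key _ x y (hpos y).1 (hpos y).2 h1 h2).symm
  have hadd : ∀ x y, Δ (x + y) = Δ x + Δ y := by
    intro x y
    obtain ⟨h1, h2, h3⟩ : (|x| + |y| + 1) ≠ 0 ∧ (|x| + |y| + 1) + x ≠ 0 ∧
        (|x| + |y| + 1) + x + y ≠ 0 := by
      have := neg_abs_le x
      have := abs_nonneg x
      have := neg_abs_le y
      have := abs_nonneg y
      refine ⟨?_, ?_, ?_⟩ <;> intro h0 <;> linarith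
    have e1 := hΔ _ x h1 h2
    have e2 := hΔ _ y h2 h3
    have e3 := hΔ _ (x + y) h1 (by rw [← add_assoc]; exact h3)
    rw [← add_assoc] at e3
    linarith
  refine ⟨Δ, H 1 - Δ 1, K 1 - Δ 1, hadd, ?_, ?_⟩
  · intro x hx
    have := hΔ 1 (x - 1) one_ne_zero (by simpa using hx)
    have e := hadd 1 (x - 1)
    simp only [add_sub_cancel] at this e
    linarith
  · intro x hx
    have := hΔK 1 (x - 1) one_ne_zero (by simpa using hx)
    have e := hadd 1 (x - 1)
    simp only [add_sub_cancel] at this e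
    linarith

theorem ev_sq (s k : ℝ) : ∀ᶠ C : ℝ in Filter.atTop, (C - s) ^ 2 ≠ k := by
  filter_upwards [Filter.eventually_gt_atTop (s + |k| + 1)] with C hC
  have := le_abs_self k
  have := abs_nonneg k
  intro h
  nlinarith

theorem ring_like (Δ : ℝ → ℝ) (hadd : ∀ x y, Δ (x + y) = Δ x + Δ y) (h1 : Δ 1 ≠ 0)
    (hm : ∀ l : ℝ, l ≠ 0 → ∃ c, ∀ s, Δ (l * s) = c * Δ s) : ∀ x, Δ x = Δ 1 * x := by
  have h0 : Δ 0 = 0 := by have := hadd 0 0; simp at this; exact this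
  let φ : ℝ →+* ℝ :=
    { toFun := fun x => Δ x / Δ 1
      map_one' := div_self h1
      map_zero' := by simp [h0]
      map_add' := by intro x y; simp only [hadd]; ring
      map_mul' := by
        intro x y
        by_cases hx : x = 0
        · subst hx; simp [h0]
        obtain ⟨c, hc⟩ := hm x hx
        have e1 := hc 1
        rw [mul_one] at e1
        simp only [hc y, e1]
        field_simp }
  intro x
  have : φ x = x := by
    have : φ = RingHom.id ℝ := Subsingleton.elim _ _
    rw [this]; rfl
  have h2 : Δ x / Δ 1 = x := this
  rw [div_eq_iff h1] at h2
  rw [h2]; ring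

theorem FE (h : ℝ → ℝ → ℝ) (h0 k μ : ℝ → ℝ) (C' : ℝ → ℝ → ℝ → ℝ)
    (hh0 : ∀ s, s ≠ 0 → h0 s ≠ 0) (hk : ∀ s, s ≠ 0 → k s ≠ 0)
    (hh1 : ∀ s, s ≠ 0 → h 1 s ≠ 0) (hμ : ∀ l, l ≠ 0 → μ l ≠ 0) (hμ1 : μ 1 ≠ μ (-1))
    (hinj : h0 1 ≠ h0 2)
    (heq : ∀ A B C l, A ≠ 0 → B ≠ 0 → A * B - C ^ 2 ≠ 0 → l ≠ 0 → A + 2 * l * C + l ^ 2 * B ≠ 0 →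
      h l (A + 2 * l * C + l ^ 2 * B) = h0 A + 2 * μ l * C' A B C + μ l ^ 2 * k B) :
    ∃ α m : ℝ, α ≠ 0 ∧ m ≠ 0 ∧ (∀ A, A ≠ 0 → h0 A = α * A) ∧
      (∀ B, B ≠ 0 → k B = α / m ^ 2 * B) ∧
      ∀ A B C, A ≠ 0 → B ≠ 0 → A * B - C ^ 2 ≠ 0 → A + 2 * C + B ≠ 0 →
        C' A B C = α / m * C := by
  have hm1 : μ 1 ≠ 0 := hμ 1 one_ne_zero
  have hm2 : μ (-1) ≠ 0 := hμ (-1) (by norm_num)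
  set m1 := μ 1 with hm1d
  set m2 := μ (-1) with hm2d
  have he : m2 - m1 ≠ 0 := sub_ne_zero.mpr (Ne.symm hμ1)
  have E1 : ∀ A B C, A ≠ 0 → B ≠ 0 → A * B - C ^ 2 ≠ 0 → A + B + 2 * C ≠ 0 →
      h 1 (A + B + 2 * C) = h0 A + 2 * m1 * C' A B C + m1 ^ 2 * k B := by
    intro A B C hA hB hD hp
    have := heq A B C 1 hA hB hD one_ne_zero (by convert hp using 1; ring)
    rw [← hm1d] at this
    rw [← this]; congr 1; ring
  have E2 : ∀ A B C, A ≠ 0 → B ≠ 0 → A * B - C ^ 2 ≠ 0 → A + B - 2 * C ≠ 0 →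
      h (-1) (A + B - 2 * C) = h0 A + 2 * m2 * C' A B C + m2 ^ 2 * k B := by
    intro A B C hA hB hD hp
    have := heq A B C (-1) hA hB hD (by norm_num) (by convert hp using 1; ring)
    rw [← hm2d] at this
    rw [← this]; congr 1; ring
  have E : ∀ A B C, A ≠ 0 → B ≠ 0 → A * B - C ^ 2 ≠ 0 → A + B + 2 * C ≠ 0 → A + B - 2 * C ≠ 0 →
      m2 * h 1 (A + B + 2 * C) - m1 * h (-1) (A + B - 2 * C) =
        (m2 - m1) * h0 A + m1 * m2 * (m1 - m2) * k B := by
    intro A B C hA hB hD hp hq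
    rw [E1 A B C hA hB hD hp, E2 A B C hA hB hD hq]; ring
  obtain ⟨Δ, β, γ, hadd, hH, hK⟩ := pexider (fun x => (m2 - m1) * h0 x)
    (fun x => m1 * m2 * (m1 - m2) * k x) (by
      intro a b a' b' ha hb ha' hb' hs
      obtain ⟨C, c1, c2, c3, c4⟩ := ((ev_sq 0 (a * b)).and ((ev_sq 0 (a' * b')).and
        ((Filter.eventually_ne_atTop ((a + b) / 2)).and
          (Filter.eventually_ne_atTop (-(a + b) / 2))))).exists
      have p1 : a + b + 2 * C ≠ 0 := fun h => c4 (by linarith)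
      have p2 : a + b - 2 * C ≠ 0 := fun h => c3 (by linarith)
      have x1 := E a b C ha hb (fun h => c1 (by linarith)) p1 p2
      have x2 := E a' b' C ha' hb' (fun h => c2 (by linarith)) (by rwa [← hs]) (by rwa [← hs])
      rw [← hs] at x2
      linarith)
  have h0' : Δ 0 = 0 := by have := hadd 0 0; simp at this; exact this
  have hneg : ∀ x, Δ (-x) = - Δ x := by
    intro x; have := hadd x (-x); rw [add_neg_cancel, h0'] at this; linarith
  have hsub : ∀ x y, Δ (x - y) = Δ x - Δ y := by
    intro x y; rw [sub_eq_add_neg, hadd, hneg]; ring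
  have htwo : ∀ x, Δ (2 * x) = 2 * Δ x := by
    intro x; rw [two_mul, hadd]; ring
  have hhalf : ∀ x, Δ (x / 2) = Δ x / 2 := by
    intro x; have := htwo (x / 2); rw [mul_div_cancel₀ _ (two_ne_zero)] at this; linarith
  have hΔ1 : Δ 1 ≠ 0 := by
    intro h1
    have a := hH 1 one_ne_zero
    have b := hH 2 two_ne_zero
    have c := htwo 1
    rw [mul_one] at c
    rw [c, h1] at b
    rw [h1] at a
    apply hinj
    apply mul_left_cancel₀ he
    linarith
  obtain ⟨π, hP⟩ : ∃ π, ∀ p, p ≠ 0 → m2 * h 1 p = Δ p / 2 + π := by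
    refine ⟨Δ (1 / 2) + β + γ + m1 * h (-1) 1, ?_⟩
    intro p hp
    obtain ⟨A, a1, a2, a3⟩ := ((Filter.eventually_ne_atTop 0).and
      ((Filter.eventually_ne_atTop ((p + 1) / 2)).and
        (ev_sq ((p + 1) / 4) (((p + 1) / 4) ^ 2 - ((p - 1) / 4) ^ 2)))).exists
    have hB : (p + 1) / 2 - A ≠ 0 := fun h => a2 (by linarith)
    have x := E A ((p + 1) / 2 - A) ((p - 1) / 4) a1 hB
      (fun h => a3 (by linarith)) (fun h => hp (by linarith)) (fun h => by linarith)
    rw [show A + ((p + 1) / 2 - A) + 2 * ((p - 1) / 4) = p by ring,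
      show A + ((p + 1) / 2 - A) - 2 * ((p - 1) / 4) = 1 by ring, hH A a1, hK _ hB] at x
    rw [hsub, show (p + 1) / 2 = p / 2 + 1 / 2 by ring, hadd, hhalf p] at x
    linarith
  have f0 : ∀ A, A ≠ 0 → h0 A = (Δ A + β) / (m2 - m1) := by
    intro A hA; rw [← hH A hA]; field_simp
  have fk : ∀ B, B ≠ 0 → k B = (Δ B + γ) / (m1 * m2 * (m1 - m2)) := by
    intro B hB; rw [← hK B hB]
    have : m1 - m2 ≠ 0 := sub_ne_zero.mpr hμ1
    field_simp
  have f1 : ∀ p, p ≠ 0 → h 1 p = (Δ p / 2 + π) / m2 := by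
    intro p hp; rw [← hP p hp]; field_simp
  -- general l
  have G : ∀ A B C A2 B2 C2 l, l ≠ 0 → A ≠ 0 → B ≠ 0 → A * B - C ^ 2 ≠ 0 → A + B + 2 * C ≠ 0 →
      A2 ≠ 0 → B2 ≠ 0 → A2 * B2 - C2 ^ 2 ≠ 0 → A2 + B2 + 2 * C2 ≠ 0 →
      A + 2 * l * C + l ^ 2 * B ≠ 0 →
      A + 2 * l * C + l ^ 2 * B = A2 + 2 * l * C2 + l ^ 2 * B2 →
      (1 - μ l / m1) * h0 A + (μ l ^ 2 - μ l * m1) * k B + μ l / m1 * h 1 (A + B + 2 * C) =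
      (1 - μ l / m1) * h0 A2 + (μ l ^ 2 - μ l * m1) * k B2 +
        μ l / m1 * h 1 (A2 + B2 + 2 * C2) := by
    intro A B C A2 B2 C2 l hl a1 a2 a3 a4 b1 b2 b3 b4 hne hs
    have x1 := heq A B C l a1 a2 a3 hl hne
    have x2 := heq A2 B2 C2 l b1 b2 b3 hl (by rwa [← hs])
    rw [E1 A B C a1 a2 a3 a4, E1 A2 B2 C2 b1 b2 b3 b4]
    rw [hs, x2] at x1
    field_simp
    linear_combination -m1 * x1
  have hlin : ∀ x, Δ x = Δ 1 * x := by
    apply ring_like Δ hadd hΔ1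
    intro l hl
    have shift : ∀ s, (1 / (m2 - m1) + μ l / m1 * (1 / (2 * m2) - 1 / (m2 - m1))) * Δ (2 * (l * s)) =
        (μ l / m1 / m2) * Δ s := by
      intro s
      have hA1 : |2 * (l * s)| + 1 ≠ 0 := by positivity
      have hA2 : |2 * (l * s)| + 1 + 2 * (l * s) ≠ 0 := by
        have := neg_abs_le (2 * (l * s))
        intro h; linarith
      set A := |2 * (l * s)| + 1
      obtain ⟨C, c1, c2, c3, c4, c5⟩ := ((ev_sq 0 A).and
        ((ev_sq s (A + 2 * (l * s))).and ((Filter.eventually_ne_atTop (-(A + 1) / 2)).and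
        ((Filter.eventually_ne_atTop (-(A + 1 + 2 * (l * s) - 2 * s) / 2)).and
          (Filter.eventually_ne_atTop (-(A + l ^ 2) / (2 * l))))))).exists
      have x := G A 1 C (A + 2 * (l * s)) 1 (C - s) l hl hA1 one_ne_zero
        (fun h => c1 (by linarith)) (fun h => c3 (by linarith)) hA2 one_ne_zero
        (fun h => c2 (by linarith)) (fun h => c4 (by linarith))
        (fun h => c5 (by field_simp; linarith)) (by ring)
      rw [f0 _ hA1, f0 _ hA2, f1 _ (fun h => c3 (by linarith)),
        f1 _ (fun h => c4 (by linarith))] at x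
      simp only [hadd, hsub, htwo] at x ⊢
      field_simp at x ⊢
      linarith
    have hc : μ l / m1 / m2 ≠ 0 := by
      have := hμ l hl
      positivity
    have ha : (1 / (m2 - m1) + μ l / m1 * (1 / (2 * m2) - 1 / (m2 - m1))) ≠ 0 := by
      intro h
      have := shift 1
      rw [h, zero_mul] at this
      exact (mul_ne_zero hc hΔ1) this.symm
    refine ⟨(μ l / m1 / m2) / (2 * (1 / (m2 - m1) + μ l / m1 * (1 / (2 * m2) - 1 / (m2 - m1)))), ?_⟩
    intro s
    have := shift s
    rw [htwo] at this
    rw [div_mul_eq_mul_div, ← this, eq_div_iff (by simpa using ha)]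
    ring
  set δ := Δ 1
  have nz : ∀ c b : ℝ, c ≠ 0 → (∀ x, x ≠ 0 → c * x + b ≠ 0) → b = 0 := by
    intro c b hc hx
    by_contra hb
    refine hx (-b / c) (by simp [hb, hc]) (by field_simp; ring)
  have hβ : β = 0 := nz δ β hΔ1 (by
    intro x hx h
    apply hh0 x hx
    rw [f0 x hx, hlin, h, zero_div])
  have hγ : γ = 0 := nz δ γ hΔ1 (by
    intro x hx h
    apply hk x hx
    rw [fk x hx, hlin, h, zero_div])
  have hπ : π = 0 := nz (δ / 2) π (by simpa using hΔ1) (by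
    intro x hx h
    apply hh1 x hx
    rw [f1 x hx, hlin, show δ * x / 2 + π = δ / 2 * x + π by ring, h, zero_div])
  subst hβ hγ hπ
  simp only [hlin, add_zero] at f0 fk f1
  have g1 := G 1 1 5 5 1 4 2 (by norm_num) (by norm_num) (by norm_num) (by norm_num) (by norm_num)
    (by norm_num) (by norm_num) (by norm_num) (by norm_num) (by norm_num) (by norm_num)
  have g2 := G 1 1 5 1 2 4 2 (by norm_num) (by norm_num) (by norm_num) (by norm_num) (by norm_num)
    (by norm_num) (by norm_num) (by norm_num) (by norm_num) (by norm_num) (by norm_num)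
  have he' : m1 - m2 ≠ 0 := sub_ne_zero.mpr hμ1
  rw [f0 _ (by norm_num), f0 _ (by norm_num), fk _ (by norm_num), f1 _ (by norm_num),
    f1 _ (by norm_num)] at g1
  rw [f0 _ (by norm_num), fk _ (by norm_num), fk _ (by norm_num), f1 _ (by norm_num),
    f1 _ (by norm_num)] at g2
  have hl := hμ 2 two_ne_zero
  have hmm : m2 = - m1 := by
    obtain ⟨y, hy⟩ : ∃ y, μ 2 = y * m1 := ⟨μ 2 / m1, by field_simp⟩
    obtain ⟨k', hk'⟩ : ∃ k', m2 = - k' * m1 := ⟨-m2 / m1, by field_simp⟩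
    rw [hy] at g1 g2 hl
    rw [hk'] at g1 g2 he he' hm2
    have hk0 : k' ≠ 0 := by rintro rfl; simp at hm2
    have hk1 : k' + 1 ≠ 0 := by
      intro h; apply he; linear_combination -m1 * h
    have hy0 : y ≠ 0 := by rintro rfl; simp at hl
    rw [show -k' * m1 - m1 = -((k' + 1) * m1) by ring,
      show m1 - -k' * m1 = (k' + 1) * m1 by ring] at g1 g2
    have q1 : y * (3 * k' - 1) = 4 * k' := by
      field_simp at g1
      ring_nf at g1
      linarith
    have q2 : 2 * y = k' + 3 := by
      field_simp at g2
      ring_nf at g2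
      exact mul_left_cancel₀ hy0 (by linarith)
    have : (k' - 1) * (k' + 1) = 0 := by
      linear_combination (2 * q1 - (3 * k' - 1) * q2) / 3
    have : k' = 1 := by
      rcases mul_eq_zero.mp this with h | h
      · linarith
      · exact absurd h hk1
    rw [hk', this]; ring
  refine ⟨-δ / (2 * m1), m1, by
    simp only [ne_eq, div_eq_zero_iff, neg_eq_zero, mul_eq_zero, hΔ1, hm1]; norm_num, hm1, ?_, ?_, ?_⟩
  · intro A hA
    rw [f0 A hA, hmm]
    field_simp
    ring
  · intro B hB
    rw [fk B hB, hmm]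
    field_simp
    ring
  · intro A B C hA hB hD hp
    have hp' : A + B + 2 * C ≠ 0 := fun h => hp (by linarith)
    have x := E1 A B C hA hB hD hp'
    rw [f0 A hA, fk B hB, f1 _ hp', hmm] at x
    rw [hmm] at he he'
    field_simp at x ⊢
    ring_nf at x ⊢
    linarith


def Sq {m : ℕ} (u : Fin m → ℝ) : Matrix (Fin m) (Fin m) ℝ := vecMulVec u u
def Sp {m : ℕ} (u v : Fin m → ℝ) : Matrix (Fin m) (Fin m) ℝ := vecMulVec u v + vecMulVec v u
def S3 {m : ℕ} (u v : Fin m → ℝ) (a b c : ℝ) : Matrix (Fin m) (Fin m) ℝ :=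
  a • Sq u + b • Sq v + c • Sp u v
def R1 {m : ℕ} (M : Matrix (Fin m) (Fin m) ℝ) : Prop :=
  ∃ (t : ℝ) (u : Fin m → ℝ), t ≠ 0 ∧ u ≠ 0 ∧ M = t • Sq u
def Ind {m : ℕ} (u v : Fin m → ℝ) : Prop :=
  ∃ p q : Fin m → ℝ, u ⬝ᵥ p = 1 ∧ v ⬝ᵥ p = 0 ∧ u ⬝ᵥ q = 0 ∧ v ⬝ᵥ q = 1

section
variable {m : ℕ}

theorem Sq_mulVec (u p : Fin m → ℝ) : Sq u *ᵥ p = (u ⬝ᵥ p) • u := by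
  ext i; simp [Sq, vecMulVec_mulVec, mul_comm]

theorem Sp_mulVec (u v p : Fin m → ℝ) : Sp u v *ᵥ p = (v ⬝ᵥ p) • u + (u ⬝ᵥ p) • v := by
  ext i; simp [Sp, vecMulVec_mulVec, add_mulVec]

theorem S3_mulVec (u v p : Fin m → ℝ) (a b c : ℝ) : S3 u v a b c *ᵥ p =
    (a * (u ⬝ᵥ p) + c * (v ⬝ᵥ p)) • u + (b * (v ⬝ᵥ p) + c * (u ⬝ᵥ p)) • v := by
  simp only [S3, add_mulVec, smul_mulVec, Sq_mulVec, Sp_mulVec]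
  ext i; simp; ring

theorem Sq_symm (u : Fin m → ℝ) : (Sq u).IsSymm := by
  ext i j; simp [Sq, vecMulVec_apply, mul_comm]

theorem Sp_symm (u v : Fin m → ℝ) : (Sp u v).IsSymm := by
  ext i j; simp [Sp, vecMulVec_apply]; ring

theorem S3_symm (u v : Fin m → ℝ) (a b c : ℝ) : (S3 u v a b c).IsSymm :=
  (((Sq_symm u).smul a).add ((Sq_symm v).smul b)).add ((Sp_symm u v).smul c)

theorem Sq_smul (c : ℝ) (u : Fin m → ℝ) : Sq (c • u) = (c ^ 2) • Sq u := by
  ext i j; simp [Sq, vecMulVec_apply]; ring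

theorem Sq_comb (u v : Fin m → ℝ) (a b : ℝ) : Sq (a • u + b • v) = S3 u v (a ^ 2) (b ^ 2) (a * b) := by
  ext i j; simp [Sq, S3, Sp, vecMulVec_apply]; ring

theorem Ind.symm {u v : Fin m → ℝ} (h : Ind u v) : Ind v u := by
  obtain ⟨p, q, h1, h2, h3, h4⟩ := h
  exact ⟨q, p, h4, h3, h2, h1⟩

theorem Ind.left {u v : Fin m → ℝ} (h : Ind u v) : u ≠ 0 := by
  rintro rfl
  obtain ⟨p, q, h1, h2, h3, h4⟩ := h
  simp at h1

theorem Ind.right {u v : Fin m → ℝ} (h : Ind u v) : v ≠ 0 := h.symm.left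

theorem Ind.not_smul {u v : Fin m → ℝ} (h : Ind u v) (c : ℝ) : v ≠ c • u := by
  rintro rfl
  obtain ⟨p, q, h1, h2, h3, h4⟩ := h
  simp only [smul_dotProduct, h3] at h4
  simp at h4

theorem Ind.coef {u v : Fin m → ℝ} (h : Ind u v) {a b : ℝ} (e : a • u + b • v = 0) :
    a = 0 ∧ b = 0 := by
  obtain ⟨p, q, h1, h2, h3, h4⟩ := h
  constructor
  · have := congrArg (· ⬝ᵥ p) e
    simpa [add_dotProduct, smul_dotProduct, h1, h2] using this
  · have := congrArg (· ⬝ᵥ q) e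
    simpa [add_dotProduct, smul_dotProduct, h3, h4] using this

theorem ind_or {u : Fin m → ℝ} (hu : u ≠ 0) (v : Fin m → ℝ) : (∃ c : ℝ, v = c • u) ∨ Ind u v := by
  by_cases h : ∃ c : ℝ, v = c • u
  · exact Or.inl h
  right
  have huu : u ⬝ᵥ u ≠ 0 := by simpa [dotProduct_self_eq_zero] using hu
  -- w = v minus projection
  set w := v - ((u ⬝ᵥ v) / (u ⬝ᵥ u)) • u with hw
  have hw0 : w ≠ 0 := by
    intro h0
    exact h ⟨_, sub_eq_zero.mp h0⟩
  have hww : w ⬝ᵥ w ≠ 0 := by simpa [dotProduct_self_eq_zero] using hw0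
  have huw : u ⬝ᵥ w = 0 := by
    rw [hw, dotProduct_sub, dotProduct_smul, smul_eq_mul]; field_simp; ring
  have hvw : v ⬝ᵥ w = w ⬝ᵥ w := by
    conv_rhs => rw [hw, sub_dotProduct, smul_dotProduct, ← hw, huw]
    simp
  refine ⟨(1 / (u ⬝ᵥ u)) • u - ((v ⬝ᵥ u) / (u ⬝ᵥ u) / (w ⬝ᵥ w)) • w, (1 / (w ⬝ᵥ w)) • w, ?_, ?_, ?_, ?_⟩
  · rw [dotProduct_sub, dotProduct_smul, dotProduct_smul, huw]
    simp; field_simp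
  · rw [dotProduct_sub, dotProduct_smul, dotProduct_smul, hvw]
    simp; field_simp; ring
  · rw [dotProduct_smul, huw]; simp
  · rw [dotProduct_smul, hvw]; simp; field_simp

theorem Sq_ne_zero {u : Fin m → ℝ} (hu : u ≠ 0) : Sq u ≠ 0 := by
  simpa [Sq] using hu

theorem R1.ne_zero {M : Matrix (Fin m) (Fin m) ℝ} (h : R1 M) : M ≠ 0 := by
  obtain ⟨t, u, ht, hu, rfl⟩ := h
  exact smul_ne_zero ht (Sq_ne_zero hu)

theorem R1.neg {M : Matrix (Fin m) (Fin m) ℝ} (h : R1 M) : R1 (-M) := by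
  obtain ⟨t, u, ht, hu, rfl⟩ := h
  exact ⟨-t, u, neg_ne_zero.mpr ht, hu, by simp⟩

theorem R1.swap {M N : Matrix (Fin m) (Fin m) ℝ} (h : R1 (M - N)) : R1 (N - M) := by
  simpa using h.neg

theorem rank_R1 {M : Matrix (Fin m) (Fin m) ℝ} (h : R1 M) : M.rank = 1 := by
  have h0 := h.ne_zero
  obtain ⟨t, u, ht, hu, rfl⟩ := h
  have h1 : (t • Sq u).rank ≤ 1 := by
    have : t • Sq u = vecMulVec (t • u) u := by
      ext i j; simp [Sq, vecMulVec_apply, mul_assoc]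
    rw [this]; exact rank_vecMulVec_le _ _
  have h2 : (t • Sq u).rank ≠ 0 := by
    intro hr
    have h3 : LinearMap.range (t • Sq u).mulVecLin = ⊥ := Submodule.finrank_eq_zero.mp hr
    rw [LinearMap.range_eq_bot] at h3
    apply h0
    ext i j
    have := congrFun (LinearMap.congr_fun h3 (Pi.single j 1)) i
    simpa using this
  omega

theorem R1_of_rank {M : Matrix (Fin m) (Fin m) ℝ} (hs : M.IsSymm) (h : M.rank = 1) : R1 M := by
  have hsym : ∀ i j, M i j = M j i := fun i j => by rw [hs.apply]
  have h1 : Module.finrank ℝ (LinearMap.range M.mulVecLin) = 1 := h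
  rw [finrank_eq_one_iff'] at h1
  obtain ⟨⟨v, hv⟩, hv0, hspan⟩ := h1
  have hv0' : v ≠ 0 := by simpa [Subtype.ext_iff] using hv0
  have hcol : ∀ j, ∃ c : ℝ, ∀ i, M i j = c * v i := by
    intro j
    obtain ⟨c, hc⟩ := hspan ⟨M.mulVecLin (Pi.single j 1), LinearMap.mem_range_self _ _⟩
    refine ⟨c, fun i => ?_⟩
    have := congrFun (congrArg Subtype.val hc) i
    simp at this
    exact this.symm
  choose c hc using hcol
  obtain ⟨k, hk⟩ : ∃ k, v k ≠ 0 := by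
    by_contra hcon; push Not at hcon; exact hv0' (funext hcon)
  -- c j * v i = c i * v j
  have hcv : ∀ j, c j = c k / v k * v j := by
    intro j
    have e := hsym k j
    rw [hc, hc] at e
    field_simp; linarith
  have hM : M = (c k / v k) • Sq v := by
    ext i j
    rw [hc, hcv]; simp [Sq, vecMulVec_apply]; ring
  refine ⟨c k / v k, v, ?_, hv0', hM⟩
  intro h0
  rw [h0, zero_smul] at hM
  rw [hM] at h
  simp at h

theorem Sq_par {u v : Fin m → ℝ} {a b : ℝ} (ha : a ≠ 0) (hu : u ≠ 0) (hv : v ≠ 0)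
    (h : a • Sq u = b • Sq v) : ∃ c : ℝ, c ≠ 0 ∧ v = c • u := by
  rcases ind_or hu v with ⟨c, rfl⟩ | ⟨p, q, h1, h2, h3, h4⟩
  · refine ⟨c, ?_, rfl⟩
    rintro rfl; simp at hv
  · have := congrArg (· *ᵥ p) h
    simp [smul_mulVec, Sq_mulVec, h1, h2, ha, hu] at this

theorem clique {u : Fin m → ℝ} (hu : u ≠ 0) {a b : ℝ} (hab : a ≠ b)
    {M : Matrix (Fin m) (Fin m) ℝ} (h1 : R1 (M - a • Sq u)) (h2 : R1 (M - b • Sq u)) :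
    ∃ s : ℝ, M = s • Sq u := by
  obtain ⟨t, w, ht, hw, e1⟩ := h1
  obtain ⟨r, z, hr, hz, e2⟩ := h2
  have e1' : M = a • Sq u + t • Sq w := by rw [← e1]; abel
  have e2' : M = b • Sq u + r • Sq z := by rw [← e2]; abel
  rcases ind_or hu w with ⟨c, rfl⟩ | ⟨p, q, h1, h2, h3, h4⟩
  · exact ⟨a + t * c ^ 2, by rw [e1', Sq_smul, smul_smul, add_smul]⟩
  · have := congrArg (· *ᵥ p) (e1'.symm.trans e2')
    simp only [add_mulVec, smul_mulVec, Sq_mulVec, h1, h2, one_smul, zero_smul, smul_zero,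
      add_zero] at this
    have e3 : (a - b) • u = (r * (z ⬝ᵥ p)) • z := by
      rw [sub_smul, this, mul_smul]; abel
    have hz' : (r * (z ⬝ᵥ p)) ≠ 0 := by
      intro h0; rw [h0, zero_smul] at e3
      exact smul_ne_zero (sub_ne_zero.mpr hab) hu e3
    have e4 : z = ((r * (z ⬝ᵥ p))⁻¹ * (a - b)) • u := by
      rw [mul_smul, e3, smul_smul, inv_mul_cancel₀ hz', one_smul]
    refine ⟨b + r * ((r * (z ⬝ᵥ p))⁻¹ * (a - b)) ^ 2, ?_⟩
    rw [e2', add_smul, mul_smul, ← Sq_smul, ← e4]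

theorem line_map (g : ℝ → Matrix (Fin m) (Fin m) ℝ) (hg : ∀ s t, s ≠ t → R1 (g s - g t)) :
    ∃ (u : Fin m → ℝ) (f : ℝ → ℝ), u ≠ 0 ∧ f.Injective ∧ f 0 = 0 ∧
      ∀ t, g t - g 0 = f t • Sq u := by
  obtain ⟨τ, u, hτ, hu, e⟩ := hg 1 0 one_ne_zero
  have : ∀ t, ∃ s : ℝ, g t - g 0 = s • Sq u := by
    intro t
    by_cases h0 : t = 0
    · exact ⟨0, by simp [h0]⟩
    by_cases h1 : t = 1
    · exact ⟨τ, by rw [h1, e]⟩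
    apply clique hu hτ.symm
    · simpa using hg t 0 h0
    · rw [← e]; simpa using hg t 1 h1
  choose f hf using this
  refine ⟨u, f, hu, ?_, ?_, hf⟩
  · intro s t hst
    by_contra hne
    apply (hg s t hne).ne_zero
    have := (hf s).trans ((congrArg (· • Sq u) hst).trans (hf t).symm)
    rw [sub_eq_zero]; simpa using this
  · have := hf 0
    rw [sub_self] at this
    by_contra h
    exact smul_ne_zero h (Sq_ne_zero hu) this.symm

theorem S3_eval {u v p q : Fin m → ℝ} (h1 : u ⬝ᵥ p = 1) (h2 : v ⬝ᵥ p = 0) (h3 : u ⬝ᵥ q = 0)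
    (h4 : v ⬝ᵥ q = 1) (a b c t : ℝ) (w : Fin m → ℝ) (h : S3 u v a b c = t • Sq w) :
    a = t * (w ⬝ᵥ p) ^ 2 ∧ b = t * (w ⬝ᵥ q) ^ 2 ∧ c = t * (w ⬝ᵥ p) * (w ⬝ᵥ q) := by
  have e1 := congrArg (fun M => (M *ᵥ p) ⬝ᵥ p) h
  have e2 := congrArg (fun M => (M *ᵥ q) ⬝ᵥ q) h
  have e3 := congrArg (fun M => (M *ᵥ p) ⬝ᵥ q) h
  simp only [S3_mulVec, smul_mulVec, Sq_mulVec, h1, h2, h3, h4, add_dotProduct, smul_dotProduct,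
    smul_eq_mul] at e1 e2 e3
  refine ⟨?_, ?_, ?_⟩ <;> linarith

theorem det_R1 {u v : Fin m → ℝ} (h : Ind u v) {a b c : ℝ} (hR : R1 (S3 u v a b c)) :
    a * b = c ^ 2 := by
  obtain ⟨p, q, h1, h2, h3, h4⟩ := h
  obtain ⟨t, w, ht, hw, e⟩ := hR
  obtain ⟨ea, eb, ec⟩ := S3_eval h1 h2 h3 h4 a b c t w e
  rw [ea, eb, ec]; ring

theorem R1_S3 {u v : Fin m → ℝ} (h : Ind u v) {a b c : ℝ} (hd : a * b = c ^ 2)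
    (hne : ¬ (a = 0 ∧ b = 0)) : R1 (S3 u v a b c) := by
  by_cases ha : a = 0
  · have hc : c = 0 := by rw [ha] at hd; simpa using hd.symm
    have hb : b ≠ 0 := fun hb => hne ⟨ha, hb⟩
    exact ⟨b, v, hb, h.right, by simp [S3, ha, hc]⟩
  · refine ⟨1 / a, a • u + c • v, by simpa using ha, ?_, ?_⟩
    · intro h0; exact ha (h.coef h0).1
    · rw [Sq_comb]
      have hb : b = c ^ 2 / a := by field_simp; linarith
      simp only [S3, smul_add, smul_smul]
      rw [hb]
      congr 2
      · congr 1; congr 1; field_simp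
      · congr 1; ring
      · field_simp

theorem two_nbr {u v : Fin m → ℝ} (h : Ind u v) {f g : ℝ} (hf : f ≠ 0) (hg : g ≠ 0)
    {M : Matrix (Fin m) (Fin m) ℝ} (h1 : R1 (M - f • Sq u)) (h2 : R1 (M - g • Sq v)) :
    ∃ a b c : ℝ, M = S3 u v a b c ∧ (a - f) * b = c ^ 2 ∧ a * (b - g) = c ^ 2 := by
  have h2' := h2
  obtain ⟨α, w, hα, hw, e1⟩ := h1
  obtain ⟨β, z, hβ, hz, e2⟩ := h2
  have e1' : M = f • Sq u + α • Sq w := by rw [← e1]; abel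
  have e2' : M = g • Sq v + β • Sq z := by rw [← e2]; abel
  have e := e1'.symm.trans e2'
  obtain ⟨w1, w2, hww⟩ : ∃ w1 w2 : ℝ, w = w1 • u + w2 • v := by
    rcases ind_or hw z with ⟨c, rfl⟩ | ⟨p, q, h1, h2, h3, h4⟩
    · exfalso
      have h' := h
      obtain ⟨p, q, h1, h2, h3, h4⟩ := h
      have ep := congrArg (· *ᵥ p) e
      have eq := congrArg (· *ᵥ q) e
      simp only [add_mulVec, smul_mulVec, Sq_smul, Sq_mulVec, h1, h2, h3, h4, one_smul, zero_smul,
        smul_zero, add_zero, zero_add] at ep eq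
      have ep' : f • u = ((β * c ^ 2 - α) * (w ⬝ᵥ p)) • w := by
        rw [sub_mul, sub_smul, mul_smul, mul_smul, mul_smul, ← ep]; abel
      have eq' : g • v = ((α - β * c ^ 2) * (w ⬝ᵥ q)) • w := by
        rw [sub_mul, sub_smul, mul_smul, mul_smul, mul_smul, eq]; abel
      have := congrArg (fun x => ((α - β * c ^ 2) * (w ⬝ᵥ q)) • x) ep'
      rw [smul_comm _ _ w, ← eq'] at this
      have h5 : ((α - β * c ^ 2) * (w ⬝ᵥ q) * f) • u +
          (-((β * c ^ 2 - α) * (w ⬝ᵥ p) * g)) • v = 0 := by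
        rw [mul_smul, this, neg_smul, mul_smul _ g v, add_neg_cancel]
      have h6 := (h'.coef h5).1
      have h7 : (α - β * c ^ 2) * (w ⬝ᵥ q) = 0 := by simpa [hf] using h6
      rw [h7, zero_smul] at eq'
      exact smul_ne_zero hg h'.right eq'
    · have ep := congrArg (· *ᵥ p) e
      simp only [add_mulVec, smul_mulVec, Sq_mulVec, h1, h2, one_smul, zero_smul,
        smul_zero, add_zero] at ep
      refine ⟨-α⁻¹ * f * (u ⬝ᵥ p), α⁻¹ * g * (v ⬝ᵥ p), ?_⟩
      ext i
      have := congrFun ep i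
      simp at this ⊢
      field_simp
      linarith
  refine ⟨f + α * w1 ^ 2, α * w2 ^ 2, α * (w1 * w2), ?_, by ring, ?_⟩
  · rw [e1', hww, Sq_comb]
    simp only [S3, smul_add, smul_smul, add_smul, add_assoc]
  · have hM : M - g • Sq v = S3 u v (f + α * w1 ^ 2) (α * w2 ^ 2 - g) (α * (w1 * w2)) := by
      rw [e1', hww, Sq_comb]
      simp only [S3, smul_add, smul_smul, add_smul, sub_smul]
      abel
    rw [hM] at h2'
    exact det_R1 h h2'

theorem in_span {u v : Fin m → ℝ} (h : Ind u v) {a b c : ℝ} (hd : a * b ≠ c ^ 2)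
    {τ : ℝ} {w : Fin m → ℝ} (hτ : τ ≠ 0) (hw : w ≠ 0) (hR : R1 (S3 u v a b c - τ • Sq w)) :
    ∃ α β : ℝ, w = α • u + β • v := by
  obtain ⟨σ, z, hσ, hz, e⟩ := hR
  have e' : S3 u v a b c = τ • Sq w + σ • Sq z := by rw [← e]; abel
  rcases ind_or hw z with ⟨k, rfl⟩ | ⟨p, q, h1, h2, h3, h4⟩
  · exfalso
    rw [Sq_smul, smul_smul, ← add_smul] at e'
    obtain ⟨p, q, h1, h2, h3, h4⟩ := h
    obtain ⟨ea, eb, ec⟩ := S3_eval h1 h2 h3 h4 a b c _ w e'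
    exact hd (by rw [ea, eb, ec]; ring)
  · have ep := congrArg (· *ᵥ p) e'
    simp only [S3_mulVec, add_mulVec, smul_mulVec, Sq_mulVec, h1, h2, one_smul, zero_smul,
        smul_zero, add_zero] at ep
    refine ⟨τ⁻¹ * (a * u ⬝ᵥ p + c * v ⬝ᵥ p), τ⁻¹ * (b * v ⬝ᵥ p + c * u ⬝ᵥ p), ?_⟩
    rw [mul_smul, mul_smul, ← smul_add, ep, smul_smul, inv_mul_cancel₀ hτ, one_smul]

end


section
variable {m : ℕ}

def H2 (Ψ : ℝ → ℝ → ℝ → Matrix (Fin m) (Fin m) ℝ) : Prop :=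
  ∀ a b c a' b' c', (a - a') * (b - b') = (c - c') ^ 2 → ¬ (a = a' ∧ b = b') →
    R1 (Ψ a b c - Ψ a' b' c')

theorem clique' {u : Fin m → ℝ} (hu : u ≠ 0) {M M1 M2 : Matrix (Fin m) (Fin m) ℝ}
    (h1 : ∃ s : ℝ, M1 = s • Sq u) (h2 : ∃ s : ℝ, M2 = s • Sq u) (hne : M1 ≠ M2)
    (r1 : R1 (M - M1)) (r2 : R1 (M - M2)) : ∃ s : ℝ, M = s • Sq u := by
  obtain ⟨s1, rfl⟩ := h1
  obtain ⟨s2, rfl⟩ := h2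
  exact clique hu (fun h => hne (by rw [h])) r1 r2

theorem collapse (Ψ : ℝ → ℝ → ℝ → Matrix (Fin m) (Fin m) ℝ) (hΨ : H2 Ψ)
    {u : Fin m → ℝ} (hu : u ≠ 0) (hx : ∀ a, ∃ s : ℝ, Ψ a 0 0 = s • Sq u)
    (hy : ∀ b, ∃ s : ℝ, Ψ 0 b 0 = s • Sq u) : ∀ a b c, ∃ s : ℝ, Ψ a b c = s • Sq u := by
  have ne_of : ∀ a b c a' b' c', (a - a') * (b - b') = (c - c') ^ 2 → ¬ (a = a' ∧ b = b') →
      Ψ a b c ≠ Ψ a' b' c' := by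
    intro a b c a' b' c' h1 h2 h
    exact (hΨ a b c a' b' c' h1 h2).ne_zero (sub_eq_zero.mpr h)
  have grid1 : ∀ a b, a ≠ 0 → b ≠ 0 → Ψ a 0 0 ≠ Ψ 0 b 0 → ∃ s : ℝ, Ψ a b 0 = s • Sq u := by
    intro a b ha hb hne
    exact clique' hu (hx a) (hy b) hne (hΨ _ _ _ _ _ _ (by ring) (by simp [hb]))
      (hΨ _ _ _ _ _ _ (by ring) (by simp [ha]))
  have grid : ∀ a b, ∃ s : ℝ, Ψ a b 0 = s • Sq u := by
    intro a b
    by_cases ha : a = 0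
    · rw [ha]; exact hy b
    by_cases hb : b = 0
    · rw [hb]; exact hx a
    by_cases hne : Ψ a 0 0 = Ψ 0 b 0
    · have h2 : Ψ (2 * a) 0 0 ≠ Ψ 0 b 0 := by
        rw [← hne]
        exact ne_of _ _ _ _ _ _ (by ring) (by
          rintro ⟨h, -⟩; apply ha; linarith)
      have h3 := grid1 (2 * a) b (by simpa using ha) hb h2
      refine clique' hu h3 (hy b) (ne_of _ _ _ _ _ _ (by ring) (by simp [ha])) ?_ ?_
      · exact hΨ _ _ _ _ _ _ (by ring) (by rintro ⟨h, -⟩; apply ha; linarith)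
      · exact hΨ _ _ _ _ _ _ (by ring) (by simp [ha])
    · exact grid1 a b ha hb hne
  intro a b c
  by_cases hc : c = 0
  · rw [hc]; exact grid a b
  by_contra hQ
  -- hyperbola of a point off the line is constant
  have hyp : ∀ a b c, (¬ ∃ s : ℝ, Ψ a b c = s • Sq u) → ∀ x y x' y', (a - x) * (b - y) = c ^ 2 →
      (a - x') * (b - y') = c ^ 2 → c ≠ 0 → Ψ x y 0 = Ψ x' y' 0 := by
    intro a b c hQ x y x' y' h1 h2 hc
    by_contra hne
    have hc2 : c ^ 2 ≠ 0 := pow_ne_zero 2 hc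
    apply hQ
    refine clique' hu (grid x y) (grid x' y') hne (hΨ _ _ _ _ _ _ (by rw [h1]; ring) ?_)
      (hΨ _ _ _ _ _ _ (by rw [h2]; ring) ?_)
    · rintro ⟨rfl, -⟩; apply hc2; rw [← h1]; ring
    · rintro ⟨rfl, -⟩; apply hc2; rw [← h2]; ring
  have hQ' : ¬ ∃ s : ℝ, Ψ (a + 2 * c) (b + 2 * c) (-c) = s • Sq u := by
    intro h
    apply hQ
    refine clique' hu h (grid (a + c) (b + c)) (ne_of _ _ _ _ _ _ (by ring) ?_)
      (hΨ _ _ _ _ _ _ (by ring) ?_) (hΨ _ _ _ _ _ _ (by ring) ?_)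
    all_goals
      rintro ⟨h, -⟩
      apply hc; linarith
  have e1 := hyp _ _ _ hQ (a + c) (b + c) (a + c / 3) (b + 3 * c) (by ring) (by ring) hc
  have e2 := hyp _ _ _ hQ' (a + c) (b + c) (a + 3 * c) (b + 3 * c) (by ring) (by ring)
    (by simpa using hc)
  refine ne_of (a + c / 3) (b + 3 * c) 0 (a + 3 * c) (b + 3 * c) 0 (by ring) ?_ (e1.symm.trans e2)
  rintro ⟨h, -⟩
  apply hc; linarith

theorem collapse_gen (Ψ : ℝ → ℝ → ℝ → Matrix (Fin m) (Fin m) ℝ) (hΨ : H2 Ψ)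
    {u : Fin m → ℝ} (hu : u ≠ 0) (a0 b0 c0 p q p' q' : ℝ) (hd : p * q' - p' * q ≠ 0)
    (hx : ∀ t, ∃ s : ℝ, Ψ (a0 + t * p ^ 2) (b0 + t * q ^ 2) (c0 + t * (p * q)) - Ψ a0 b0 c0 = s • Sq u)
    (hy : ∀ t, ∃ s : ℝ, Ψ (a0 + t * p' ^ 2) (b0 + t * q' ^ 2) (c0 + t * (p' * q')) - Ψ a0 b0 c0
      = s • Sq u) : ∀ a b c, ∃ s : ℝ, Ψ a b c - Ψ a0 b0 c0 = s • Sq u := by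
  have key := collapse (fun x y z => Ψ (a0 + (x * p ^ 2 + y * p' ^ 2 + 2 * z * p * p'))
      (b0 + (x * q ^ 2 + y * q' ^ 2 + 2 * z * q * q'))
      (c0 + (x * (p * q) + y * (p' * q') + z * (p * q' + p' * q))) - Ψ a0 b0 c0) (by
    intro x y z x' y' z' h1 h2
    have hd2 : (p * q' - p' * q) ^ 2 ≠ 0 := pow_ne_zero 2 hd
    rw [sub_sub_sub_cancel_right]
    apply hΨ
    · linear_combination (p * q' - p' * q) ^ 2 * h1
    · rintro ⟨h3, h4⟩
      have h5 : c0 + (x * (p * q) + y * (p' * q') + z * (p * q' + p' * q)) =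
          c0 + (x' * (p * q) + y' * (p' * q') + z' * (p * q' + p' * q)) := by
        have : (c0 + (x * (p * q) + y * (p' * q') + z * (p * q' + p' * q)) -
          (c0 + (x' * (p * q) + y' * (p' * q') + z' * (p * q' + p' * q)))) ^ 2 = 0 := by
          have h6 := congrArg (fun s => (p * q' - p' * q) ^ 2 * s) h1
          linear_combination (x * q ^ 2 + y * q' ^ 2 + 2 * z * q * q' - (x' * q ^ 2 + y' * q' ^ 2 + 2 * z' * q * q')) * h3 - h6
        have := pow_eq_zero_iff (two_ne_zero) |>.mp this
        linarith
      apply h2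
      constructor
      · have : (p * q' - p' * q) ^ 2 * (x - x') = 0 := by
          linear_combination q' ^ 2 * h3 + p' ^ 2 * h4 - 2 * p' * q' * h5
        have := (mul_eq_zero.mp this).resolve_left hd2
        linarith
      · have : (p * q' - p' * q) ^ 2 * (y - y') = 0 := by
          linear_combination q ^ 2 * h3 + p ^ 2 * h4 - 2 * p * q * h5
        have := (mul_eq_zero.mp this).resolve_left hd2
        linarith) hu
    (by
      intro t
      obtain ⟨s, hs⟩ := hx t
      refine ⟨s, ?_⟩
      rw [← hs]
      simp) (by
      intro t
      obtain ⟨s, hs⟩ := hy t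
      refine ⟨s, ?_⟩
      rw [← hs]
      simp)
  intro a b c
  obtain ⟨s, hs⟩ := key
    ((q' ^ 2 * (a - a0) + p' ^ 2 * (b - b0) - 2 * p' * q' * (c - c0)) / (p * q' - p' * q) ^ 2)
    ((q ^ 2 * (a - a0) + p ^ 2 * (b - b0) - 2 * p * q * (c - c0)) / (p * q' - p' * q) ^ 2)
    ((-q * q' * (a - a0) - p * p' * (b - b0) + (p * q' + p' * q) * (c - c0)) / (p * q' - p' * q) ^ 2)
  refine ⟨s, ?_⟩
  rw [← hs]
  generalize hD : p * q' - p' * q = D at hd ⊢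
  congr 2
  · field_simp; rw [← hD]; ring
  · field_simp; rw [← hD]; ring
  · field_simp; rw [← hD]; ring

def NC (Ψ : ℝ → ℝ → ℝ → Matrix (Fin m) (Fin m) ℝ) : Prop :=
  ∀ (u : Fin m → ℝ) (a0 b0 c0 p q p' q' : ℝ), u ≠ 0 → p * q' - p' * q ≠ 0 →
    (∀ t, ∃ s : ℝ, Ψ (a0 + t * p ^ 2) (b0 + t * q ^ 2) (c0 + t * (p * q)) - Ψ a0 b0 c0 = s • Sq u) →
    (∀ t, ∃ s : ℝ, Ψ (a0 + t * p' ^ 2) (b0 + t * q' ^ 2) (c0 + t * (p' * q')) - Ψ a0 b0 c0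
      = s • Sq u) → False

theorem ext_generic (Ψ : ℝ → ℝ → ℝ → Matrix (Fin m) (Fin m) ℝ) (hΨ : H2 Ψ) (h0 : Ψ 0 0 0 = 0)
    {u v : Fin m → ℝ} (huv : Ind u v) {κ : ℝ} (hκ : κ ≠ 0)
    (hgen : ∀ a b c, a ≠ 0 → b ≠ 0 → a * b - c ^ 2 ≠ 0 → a + b - 2 * c ≠ 0 →
      Ψ a b c = κ • S3 u v a b c) : ∀ a b c, Ψ a b c = κ • S3 u v a b c := by
  intro a b c
  by_cases hr : a = 0 ∧ b = 0 ∧ c = 0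
  · obtain ⟨rfl, rfl, rfl⟩ := hr
    simp [h0, S3]
  have ln : ∀ q, q ≠ 0 → q ≠ 1 → b + a * q ^ 2 - 2 * c * q ≠ 0 →
      ∃ s : ℝ, Ψ a b c - κ • S3 u v a b c = s • Sq (u + q • v) := by
    intro q hq0 hq1 hs
    have ev : ∀ᶠ t : ℝ in Filter.atTop, t ≠ 0 ∧ a + t ≠ 0 ∧ b + t * q ^ 2 ≠ 0 ∧
        (a + t) * (b + t * q ^ 2) - (c + t * q) ^ 2 ≠ 0 ∧
        (a + t) + (b + t * q ^ 2) - 2 * (c + t * q) ≠ 0 := by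
      have hq1' : q - 1 ≠ 0 := sub_ne_zero.mpr hq1
      filter_upwards [Filter.eventually_ne_atTop 0, Filter.eventually_ne_atTop (-a),
        Filter.eventually_ne_atTop (-b / q ^ 2),
        Filter.eventually_ne_atTop (-(a * b - c ^ 2) / (b + a * q ^ 2 - 2 * c * q)),
        Filter.eventually_ne_atTop (-(a + b - 2 * c) / (q - 1) ^ 2)] with t t1 t2 t3 t4 t5
      refine ⟨t1, fun h => t2 (by linarith), fun h => t3 ?_, fun h => t4 ?_, fun h => t5 ?_⟩
      · rw [eq_div_iff (by positivity)]; linarith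
      · rw [eq_div_iff hs]; linarith
      · rw [eq_div_iff (by positivity)]; linarith
    have step : ∀ t, t ≠ 0 ∧ a + t ≠ 0 ∧ b + t * q ^ 2 ≠ 0 ∧
        (a + t) * (b + t * q ^ 2) - (c + t * q) ^ 2 ≠ 0 ∧
        (a + t) + (b + t * q ^ 2) - 2 * (c + t * q) ≠ 0 →
        R1 (Ψ a b c - κ • S3 u v a b c - (κ * t) • Sq (u + q • v)) := by
      rintro t ⟨t1, t2, t3, t4, t5⟩
      have h1 := hΨ a b c (a + t) (b + t * q ^ 2) (c + t * q) (by ring) (by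
        rintro ⟨h, -⟩; apply t1; linarith)
      rw [hgen _ _ _ t2 t3 t4 t5] at h1
      convert h1 using 1
      rw [sub_sub]
      congr 1
      have := Sq_comb u v 1 q
      rw [one_smul] at this
      rw [this]
      ext i j; simp [S3]; ring
    obtain ⟨t1, ht1⟩ := ev.exists
    obtain ⟨t2, ht2, hne⟩ := (ev.and (Filter.eventually_ne_atTop t1)).exists
    have hw : u + q • v ≠ 0 := by
      intro h
      have := (huv.coef (a := 1) (b := q) (by rw [one_smul]; exact h)).1
      exact one_ne_zero this
    exact clique hw (fun h => hne (mul_left_cancel₀ hκ h).symm) (step t1 ht1) (step t2 ht2)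
  have evq : ∀ᶠ q : ℝ in Filter.atTop, q ≠ 0 ∧ q ≠ 1 ∧ b + a * q ^ 2 - 2 * c * q ≠ 0 := by
    have : ∀ᶠ q : ℝ in Filter.atTop, b + a * q ^ 2 - 2 * c * q ≠ 0 := by
      by_cases ha : a = 0
      · by_cases hc : c = 0
        · refine Filter.Eventually.of_forall fun q => ?_
          rw [ha, hc]
          intro hb
          exact hr ⟨ha, by linarith, hc⟩
        · filter_upwards [Filter.eventually_ne_atTop (b / (2 * c))] with q hq h
          apply hq
          rw [eq_div_iff (by simpa using hc)]
          rw [ha] at h; linarith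
      · filter_upwards [ev_sq (c / a) ((c / a) ^ 2 - b / a)] with q hq h
        apply hq
        field_simp
        linear_combination a * h
    filter_upwards [this, Filter.eventually_ne_atTop 0, Filter.eventually_ne_atTop 1] with q h1 h2 h3
    exact ⟨h2, h3, h1⟩
  obtain ⟨q1, a1, a2, a3⟩ := evq.exists
  obtain ⟨q2, ⟨b1, b2, b3⟩, hne⟩ := (evq.and (Filter.eventually_ne_atTop q1)).exists
  obtain ⟨s1, e1⟩ := ln q1 a1 a2 a3
  obtain ⟨s2, e2⟩ := ln q2 b1 b2 b3
  have hw : ∀ q : ℝ, u + q • v ≠ 0 := by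
    intro q h
    have := (huv.coef (a := 1) (b := q) (by rw [one_smul]; exact h)).1
    exact one_ne_zero this
  have hs1 : s1 = 0 := by
    by_contra hs
    obtain ⟨k, hk, e⟩ := Sq_par hs (hw q1) (hw q2) (e1.symm.trans e2)
    have : (1 - k) • u + (q2 - k * q1) • v = 0 := by
      have : u + q2 • v - k • (u + q1 • v) = 0 := by rw [e, sub_self]
      rw [← this, smul_add, sub_smul, sub_smul, one_smul, mul_smul]; abel
    obtain ⟨h1, h2⟩ := huv.coef this
    have hk1 : k = 1 := by linarith
    rw [hk1] at h2
    apply hne; linarith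
  rw [hs1, zero_smul, sub_eq_zero] at e1
  exact e1

end


section
variable {m : ℕ}

theorem Ind.smul_right {u v : Fin m → ℝ} (h : Ind u v) {c : ℝ} (hc : c ≠ 0) : Ind u (c • v) := by
  obtain ⟨p, q, h1, h2, h3, h4⟩ := h
  refine ⟨p, c⁻¹ • q, h1, ?_, ?_, ?_⟩
  · simp [h2]
  · simp [h3]
  · simp [h4, hc]

theorem alg1 {A B C d : ℝ} (hA : A ≠ 0) (hd : d ≠ 0) (h : A * B - C ^ 2 = d) :
    (B / d - 1 / A) * (A / d - 0) = (-C / d - 0) ^ 2 := by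
  field_simp; linear_combination A * h

theorem alg2 {A B C d : ℝ} (hA : B ≠ 0) (hd : d ≠ 0) (h : A * B - C ^ 2 = d) :
    (B / d - 0) * (A / d - 1 / B) = (-C / d - 0) ^ 2 := by
  field_simp; linear_combination B * h

theorem alg3 {A B C d l s : ℝ} (hd : d ≠ 0) (hs : s ≠ 0) (h : A * B - C ^ 2 = d)
    (h' : A + 2 * l * C + l ^ 2 * B = s) :
    (B / d - 1 / s) * (A / d - 1 / s * l ^ 2) = (-C / d - 1 / s * l) ^ 2 := by
  field_simp; linear_combination (s ^ 2) * h - s * d * h'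

theorem core (Ψ : ℝ → ℝ → ℝ → Matrix (Fin m) (Fin m) ℝ) (hΨ : H2 Ψ) (h0 : Ψ 0 0 0 = 0)
    (hNC : NC Ψ) : ∃ (κ : ℝ) (u v : Fin m → ℝ), κ ≠ 0 ∧ Ind u v ∧
      ∀ a b c, Ψ a b c = κ • S3 u v a b c := by
  have hl : ∀ l : ℝ, ∃ (u : Fin m → ℝ) (f : ℝ → ℝ), u ≠ 0 ∧ f.Injective ∧ f 0 = 0 ∧
      ∀ t, Ψ t (t * l ^ 2) (t * l) = f t • Sq u := by
    intro l
    obtain ⟨u, f, hu, hf, hf0, e⟩ := line_map (fun t => Ψ t (t * l ^ 2) (t * l))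
      (fun s t hst => hΨ _ _ _ _ _ _ (by ring) (fun h => hst h.1))
    refine ⟨u, f, hu, hf, hf0, fun t => ?_⟩
    have := e t
    simpa [h0] using this
  choose U F hU hFi hF0 hFe using hl
  obtain ⟨v, G, hv, hGi, hG0, hGe⟩ : ∃ (u : Fin m → ℝ) (f : ℝ → ℝ), u ≠ 0 ∧ f.Injective ∧ f 0 = 0 ∧
      ∀ t, Ψ 0 t 0 = f t • Sq u := by
    obtain ⟨u, f, hu, hf, hf0, e⟩ := line_map (fun t => Ψ 0 t 0)
      (fun s t hst => hΨ _ _ _ _ _ _ (by ring) (fun h => hst h.2))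
    refine ⟨u, f, hu, hf, hf0, fun t => ?_⟩
    have := e t
    simpa [h0] using this
  have indU : ∀ l l', l ≠ l' → Ind (U l) (U l') := by
    intro l l' hll
    rcases ind_or (hU l) (U l') with ⟨c, hc⟩ | h
    · exfalso
      refine hNC (U l) 0 0 0 1 l 1 l' (hU l) ?_ (fun t => ⟨F l t, ?_⟩) (fun t => ⟨F l' t * c ^ 2, ?_⟩)
      · intro h; apply hll; linarith
      · rw [← hFe]; simp [h0]
      · rw [mul_smul, ← Sq_smul, ← hc, ← hFe]; simp [h0]
    · exact h
  have indV : ∀ l, Ind (U l) v := by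
    intro l
    rcases ind_or (hU l) v with ⟨c, hc⟩ | h
    · exfalso
      refine hNC (U l) 0 0 0 1 l 0 1 (hU l) (by simp) (fun t => ⟨F l t, ?_⟩) (fun t => ⟨G t * c ^ 2, ?_⟩)
      · rw [← hFe]; simp [h0]
      · rw [mul_smul, ← Sq_smul, ← hc, ← hGe]; simp [h0]
    · exact h
  have hFne : ∀ l s, s ≠ 0 → F l s ≠ 0 := fun l s hs h => hs (hFi l (by rw [h, hF0]))
  have hGne : ∀ s, s ≠ 0 → G s ≠ 0 := fun s hs h => hs (hGi (by rw [h, hG0]))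
  have main : ∀ A B C : ℝ, ∃ D C' : ℝ, A ≠ 0 → B ≠ 0 → A * B - C ^ 2 ≠ 0 → D ≠ 0 ∧
      Ψ (B / (A * B - C ^ 2)) (A / (A * B - C ^ 2)) (-C / (A * B - C ^ 2)) =
        S3 (U 0) v (D * (1 / G (1 / B))) (D * (1 / F 0 (1 / A))) (-(D * C')) ∧
      D * (1 / F 0 (1 / A) * (1 / G (1 / B)) - C' ^ 2) = 1 := by
    intro A B C
    by_cases hh : A ≠ 0 ∧ B ≠ 0 ∧ A * B - C ^ 2 ≠ 0
    swap
    · exact ⟨0, 0, fun h1 h2 h3 => (hh ⟨h1, h2, h3⟩).elim⟩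
    obtain ⟨hA, hB, hΔ⟩ := hh
    have hf : F 0 (1 / A) ≠ 0 := hFne _ _ (by simpa using hA)
    have hg : G (1 / B) ≠ 0 := hGne _ (by simpa using hB)
    have r1 := hΨ (B / (A * B - C ^ 2)) (A / (A * B - C ^ 2)) (-C / (A * B - C ^ 2)) (1 / A) 0 0
      (alg1 hA hΔ rfl) (by rintro ⟨-, h⟩; exact (div_ne_zero hA hΔ) h)
    have r2 := hΨ (B / (A * B - C ^ 2)) (A / (A * B - C ^ 2)) (-C / (A * B - C ^ 2)) 0 (1 / B) 0
      (alg2 hB hΔ rfl) (by rintro ⟨h, -⟩; exact (div_ne_zero hB hΔ) h)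
    have eP : Ψ (1 / A) 0 0 = F 0 (1 / A) • Sq (U 0) := by rw [← hFe]; simp
    have r1' := r1
    rw [eP] at r1
    rw [hGe] at r2
    obtain ⟨a, b, c, e, e1, e2⟩ := two_nbr (indV 0) hf hg r1 r2
    have hD : a * b - c ^ 2 ≠ 0 := by
      intro hD
      have hb : b = 0 := by
        have : F 0 (1 / A) * b = 0 := by linarith
        exact (mul_eq_zero.mp this).resolve_left hf
      have ha : a = 0 := by
        have : G (1 / B) * a = 0 := by linarith
        exact (mul_eq_zero.mp this).resolve_left hg
      have hc : c = 0 := by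
        rw [ha, hb] at hD
        have : c ^ 2 = 0 := by linarith
        exact pow_eq_zero_iff two_ne_zero |>.mp this
      have hz : Ψ (B / (A * B - C ^ 2)) (A / (A * B - C ^ 2)) (-C / (A * B - C ^ 2)) = 0 := by
        rw [e, ha, hb, hc]; simp [S3]
      generalize hy : A / (A * B - C ^ 2) = y at *
      generalize hz' : -C / (A * B - C ^ 2) = z at *
      have hy0 : y ≠ 0 := by rw [← hy]; exact div_ne_zero hA hΔ
      have hx : B / (A * B - C ^ 2) = 1 / A + 1 / y * z ^ 2 := by
        rw [← hy, ← hz']; generalize hd : A * B - C ^ 2 = d at *; field_simp; linear_combination hd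
      obtain ⟨w, φ, hw, hφ, -, hφe⟩ := line_map (fun t => Ψ (1 / A + t * z ^ 2) (0 + t * y ^ 2) (0 + t * (z * y)))
        (fun s t hst => hΨ _ _ _ _ _ _ (by ring) (by
          rintro ⟨-, h⟩
          apply hst
          have : y ^ 2 * (s - t) = 0 := by linarith
          have := (mul_eq_zero.mp this).resolve_left (pow_ne_zero 2 hy0)
          linarith))
      have e3 := hφe (1 / y)
      have e4 : Ψ (1 / A + 1 / y * z ^ 2) (0 + 1 / y * y ^ 2) (0 + 1 / y * (z * y)) = 0 := by
        rw [← hz, hx]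
        congr 1
        · field_simp; ring
        · field_simp; ring
      rw [e4] at e3
      simp only [zero_mul, add_zero, zero_sub] at e3
      rw [eP, ← neg_smul] at e3
      obtain ⟨k, hk, rfl⟩ := Sq_par (neg_ne_zero.mpr hf) (hU 0) hw e3
      refine hNC (U 0) (1 / A) 0 0 1 0 z y (hU 0) (by simpa using hy0)
        (fun t => ⟨F 0 (1 / A + t) - F 0 (1 / A), ?_⟩) (fun t => ⟨φ t * k ^ 2, ?_⟩)
      · rw [sub_smul, ← hFe, ← hFe]; simp
      · rw [mul_smul, ← Sq_smul, ← hφe]; simp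
    refine ⟨a * b - c ^ 2, -c / (a * b - c ^ 2), fun _ _ _ => ⟨hD, ?_, ?_⟩⟩
    · rw [e]
      congr 1
      · field_simp; linarith
      · field_simp; linarith
      · field_simp
    · have h1 : 1 / F 0 (1 / A) = b / (a * b - c ^ 2) := by rw [div_eq_div_iff hf hD]; linarith
      have h2 : 1 / G (1 / B) = a / (a * b - c ^ 2) := by rw [div_eq_div_iff hg hD]; linarith
      rw [h1, h2]
      generalize hd : a * b - c ^ 2 = d at *
      field_simp
      linarith
  choose D C' hmain using main
  have adj : ∀ A B C l, A ≠ 0 → B ≠ 0 → A * B - C ^ 2 ≠ 0 → A + 2 * l * C + l ^ 2 * B ≠ 0 →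
      R1 (S3 (U 0) v (D A B C * (1 / G (1 / B))) (D A B C * (1 / F 0 (1 / A))) (-(D A B C * C' A B C)) -
        F l (1 / (A + 2 * l * C + l ^ 2 * B)) • Sq (U l)) := by
    intro A B C l hA hB hΔ hs
    rw [← (hmain A B C hA hB hΔ).2.1, ← hFe]
    apply hΨ
    · exact alg3 hΔ hs rfl rfl
    · rintro ⟨h1, h2⟩
      have h3 := alg3 hΔ hs rfl rfl
      have h4 : (B / (A * B - C ^ 2)) * (A / (A * B - C ^ 2)) - (-C / (A * B - C ^ 2)) ^ 2 =
          1 / (A * B - C ^ 2) := by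
        generalize hd : A * B - C ^ 2 = d at *; field_simp; linear_combination hd
      rw [h1, h2, sub_self, zero_mul] at h3
      have h5 := pow_eq_zero_iff two_ne_zero |>.mp h3.symm
      have h6 : 1 / (A * B - C ^ 2) = 0 := by
        rw [← h4, h1, h2, sub_eq_zero.mp h5]; ring
      exact one_div_ne_zero hΔ h6
  have span : ∀ l, ∃ α β : ℝ, l ≠ 0 → α ≠ 0 ∧ β ≠ 0 ∧ U l = α • U 0 + β • v := by
    intro l
    by_cases hl : l = 0
    · exact ⟨0, 0, fun h => (h hl).elim⟩
    have ev : ∀ᶠ C : ℝ in Filter.atTop, (C - 0) ^ 2 ≠ 1 ∧ C ≠ -(1 + l ^ 2) / (2 * l) :=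
      (ev_sq 0 1).and (Filter.eventually_ne_atTop _)
    obtain ⟨C, hC1, hC2⟩ := ev.exists
    have hΔ : (1 : ℝ) * 1 - C ^ 2 ≠ 0 := by
      intro h; apply hC1; linarith
    have hs : 1 + 2 * l * C + l ^ 2 * 1 ≠ 0 := by
      intro h; apply hC2; field_simp; linarith
    obtain ⟨hD, -, hDe⟩ := hmain 1 1 C one_ne_zero one_ne_zero hΔ
    obtain ⟨α, β, e⟩ := in_span (indV 0) (by
      intro h
      apply hD
      linear_combination h - D 1 1 C * hDe) (hFne l _ (one_div_ne_zero hs)) (hU l)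
      (adj 1 1 C l one_ne_zero one_ne_zero hΔ hs)
    refine ⟨α, β, fun _ => ⟨?_, ?_, e⟩⟩
    · rintro rfl
      rw [zero_smul, zero_add] at e
      exact (indV l).symm.not_smul _ e
    · rintro rfl
      rw [zero_smul, add_zero] at e
      exact (indU 0 l (Ne.symm hl)).not_smul _ e
  choose α β hαβ using span
  obtain ⟨γ, k, hγ, hk, e1, e2, e3⟩ := FE (fun l s => 1 / ((α l) ^ 2 * F l (1 / s)))
    (fun s => 1 / F 0 (1 / s)) (fun s => 1 / G (1 / s)) (fun l => β l / α l) C'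
    (fun s hs => one_div_ne_zero (hFne _ _ (one_div_ne_zero hs)))
    (fun s hs => one_div_ne_zero (hGne _ (one_div_ne_zero hs)))
    (fun s hs => one_div_ne_zero (mul_ne_zero (pow_ne_zero 2 (hαβ 1 one_ne_zero).1)
      (hFne _ _ (one_div_ne_zero hs))))
    (fun l hl => div_ne_zero (hαβ l hl).2.1 (hαβ l hl).1)
    (by
      intro h
      obtain ⟨h1, h2, h3⟩ := hαβ 1 one_ne_zero
      obtain ⟨h4, h5, h6⟩ := hαβ (-1) (by norm_num)
      refine (indU 1 (-1) (by norm_num)).not_smul (α (-1) / α 1) ?_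
      rw [h3, h6, smul_add, smul_smul, smul_smul, div_mul_cancel₀ _ h1]
      congr 2
      field_simp at h
      field_simp
      linarith)
    (by
      intro h
      have h' : F 0 (1 / 1) = F 0 (1 / 2) := by
        rw [one_div, one_div (F 0 (1 / 2))] at h
        exact inv_injective h
      have := hFi 0 h'
      norm_num at this)
    (by
      intro A B C l hA hB hΔ hl hs
      obtain ⟨h1, h2, h3⟩ := hαβ l hl
      have h4 := adj A B C l hA hB hΔ hs
      obtain ⟨hD, -, hDe⟩ := hmain A B C hA hB hΔ
      have hτ := hFne l _ (one_div_ne_zero hs)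
      generalize F l (1 / (A + 2 * l * C + l ^ 2 * B)) = τ at *
      generalize 1 / F 0 (1 / A) = x at *
      generalize 1 / G (1 / B) = y at *
      generalize C' A B C = z at *
      generalize D A B C = d at *
      generalize α l = p at *
      generalize β l = q at *
      have h5 : S3 (U 0) v (d * y) (d * x) (-(d * z)) - τ • Sq (U l) =
          S3 (U 0) v (d * y - τ * p ^ 2) (d * x - τ * q ^ 2) (-(d * z) - τ * (p * q)) := by
        rw [h3, Sq_comb]
        ext i j; simp [S3]; ring
      rw [h5] at h4
      have h6 := det_R1 (indV 0) h4
      have h7 : τ * (x * p ^ 2 + 2 * p * q * z + q ^ 2 * y) = 1 := by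
        apply mul_left_cancel₀ hD
        linear_combination d * hDe - h6
      field_simp
      linear_combination -h7)
  refine ⟨1 / γ, U 0, k • v, one_div_ne_zero hγ, (indV 0).smul_right hk, ?_⟩
  refine ext_generic Ψ hΨ h0 ((indV 0).smul_right hk) (one_div_ne_zero hγ) ?_
  intro a b c ha hb hd hs
  have q1 : b / (a * b - c ^ 2) ≠ 0 := div_ne_zero hb hd
  have q2 : a / (a * b - c ^ 2) ≠ 0 := div_ne_zero ha hd
  have q3 : b / (a * b - c ^ 2) * (a / (a * b - c ^ 2)) - (-c / (a * b - c ^ 2)) ^ 2 =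
      1 / (a * b - c ^ 2) := by
    generalize hd' : a * b - c ^ 2 = d at *; field_simp; linear_combination hd'
  have q4 : b / (a * b - c ^ 2) + 2 * (-c / (a * b - c ^ 2)) + a / (a * b - c ^ 2) =
      (a + b - 2 * c) / (a * b - c ^ 2) := by ring
  have q5 := e3 _ _ _ q1 q2 (by rw [q3]; exact one_div_ne_zero hd)
    (by rw [q4]; exact div_ne_zero hs hd)
  obtain ⟨hD, hDe, hD1⟩ := hmain _ _ _ q1 q2 (by rw [q3]; exact one_div_ne_zero hd)
  have q6 := e1 _ q1
  have q7 := e2 _ q2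
  beta_reduce at q6 q7
  rw [q6, q7, q5] at hD1
  rw [q6, q7, q5, q3] at hDe
  generalize D _ _ _ = d at *
  generalize hδ : a * b - c ^ 2 = δ at *
  have hd' : d = k ^ 2 * δ / γ ^ 2 := by
    have : d * (γ ^ 2 / k ^ 2 * (b / δ * (a / δ) - (-c / δ) ^ 2)) = 1 := by
      rw [← hD1]; field_simp
    rw [q3] at this
    field_simp at this
    field_simp
    linarith
  rw [hd'] at hDe
  have g1 : a / δ / (1 / δ) = a := by field_simp
  have g2 : b / δ / (1 / δ) = b := by field_simp
  have g3 : -(-c / δ) / (1 / δ) = c := by field_simp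
  rw [g1, g2, g3] at hDe
  rw [hDe]
  have g4 : k ^ 2 * δ / γ ^ 2 * (γ / k ^ 2 * (a / δ)) = a / γ := by field_simp
  have g5 : k ^ 2 * δ / γ ^ 2 * (γ * (b / δ)) = k ^ 2 * b / γ := by field_simp
  have g6 : -(k ^ 2 * δ / γ ^ 2 * (γ / k * (-c / δ))) = k * c / γ := by field_simp
  rw [g4, g5, g6]
  ext i j
  simp [S3, Sq, Sp, vecMulVec_apply]
  field_simp
end


section
variable {n m : ℕ}

theorem dich (Ψ : ℝ → ℝ → ℝ → Matrix (Fin m) (Fin m) ℝ) (hΨ : H2 Ψ) (h0 : Ψ 0 0 0 = 0) :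
    (∃ u : Fin m → ℝ, u ≠ 0 ∧ ∀ a b c, ∃ s : ℝ, Ψ a b c = s • Sq u) ∨
    ∃ (κ : ℝ) (u v : Fin m → ℝ), κ ≠ 0 ∧ Ind u v ∧ ∀ a b c, Ψ a b c = κ • S3 u v a b c := by
  by_cases h : NC Ψ
  · exact Or.inr (core Ψ hΨ h0 h)
  · left
    unfold NC at h
    push Not at h
    obtain ⟨u, a0, b0, c0, p, q, p', q', hu, hd, hx, hy, -⟩ := h
    have key := collapse_gen Ψ hΨ hu a0 b0 c0 p q p' q' hd hx hy
    refine ⟨u, hu, fun a b c => ?_⟩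
    obtain ⟨s, hs⟩ := key a b c
    obtain ⟨s0, hs0⟩ := key 0 0 0
    refine ⟨s - s0, ?_⟩
    rw [sub_smul, ← hs, ← hs0, h0]; abel

def Coll (Φ : Matrix (Fin n) (Fin n) ℝ → Matrix (Fin m) (Fin m) ℝ) (A : Matrix (Fin n) (Fin n) ℝ)
    (x y : Fin n → ℝ) (u : Fin m → ℝ) : Prop :=
  u ≠ 0 ∧ ∀ a b c, ∃ s : ℝ, Φ (A + S3 x y a b c) - Φ A = s • Sq u

def Std (Φ : Matrix (Fin n) (Fin n) ℝ → Matrix (Fin m) (Fin m) ℝ) (A : Matrix (Fin n) (Fin n) ℝ)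
    (x y : Fin n → ℝ) (κ : ℝ) (u v : Fin m → ℝ) : Prop :=
  κ ≠ 0 ∧ Ind u v ∧ ∀ a b c, Φ (A + S3 x y a b c) - Φ A = κ • S3 u v a b c

def Adj (Φ : Matrix (Fin n) (Fin n) ℝ → Matrix (Fin m) (Fin m) ℝ) : Prop :=
  ∀ A B, A.IsSymm → B.IsSymm → R1 (A - B) → R1 (Φ A - Φ B)

theorem S3_10 (x y : Fin n → ℝ) (t : ℝ) : S3 x y t 0 0 = t • Sq x := by simp [S3]
theorem S3_01 (x y : Fin n → ℝ) (t : ℝ) : S3 x y 0 t 0 = t • Sq y := by simp [S3]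
theorem S3_comb (x y : Fin n → ℝ) (t α β : ℝ) :
    t • Sq (α • x + β • y) = S3 x y (t * α ^ 2) (t * β ^ 2) (t * (α * β)) := by
  rw [Sq_comb]; simp [S3, smul_smul]

theorem S3_sub (x y : Fin n → ℝ) (a b c a' b' c' : ℝ) :
    S3 x y a b c - S3 x y a' b' c' = S3 x y (a - a') (b - b') (c - c') := by
  simp only [S3, sub_smul]; abel

theorem S3_add (x y : Fin n → ℝ) (a b c a' b' c' : ℝ) :
    S3 x y a b c + S3 x y a' b' c' = S3 x y (a + a') (b + b') (c + c') := by
  simp only [S3, add_smul]; abel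

theorem S3_swap (x y : Fin n → ℝ) (a b c : ℝ) : S3 x y a b c = S3 y x b a c := by
  simp only [S3, Sp, smul_add]; abel

theorem dichA {Φ : Matrix (Fin n) (Fin n) ℝ → Matrix (Fin m) (Fin m) ℝ} (hΦ : Adj Φ)
    {A : Matrix (Fin n) (Fin n) ℝ} (hA : A.IsSymm) {x y : Fin n → ℝ} (hxy : Ind x y) :
    (∃ u, Coll Φ A x y u) ∨ ∃ κ u v, Std Φ A x y κ u v := by
  apply dich (fun a b c => Φ (A + S3 x y a b c) - Φ A)
  · intro a b c a' b' c' h1 h2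
    rw [sub_sub_sub_cancel_right]
    apply hΦ _ _ (hA.add (S3_symm _ _ _ _ _)) (hA.add (S3_symm _ _ _ _ _))
    rw [add_sub_add_left_eq_sub, S3_sub]
    apply R1_S3 hxy h1
    rintro ⟨h3, h4⟩
    exact h2 ⟨sub_eq_zero.mp h3, sub_eq_zero.mp h4⟩
  · simp [S3]

theorem Std.swap {Φ : Matrix (Fin n) (Fin n) ℝ → Matrix (Fin m) (Fin m) ℝ}
    {A : Matrix (Fin n) (Fin n) ℝ} {x y : Fin n → ℝ} {κ : ℝ} {u v : Fin m → ℝ}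
    (h : Std Φ A x y κ u v) : Std Φ A y x κ v u :=
  ⟨h.1, h.2.1.symm, fun a b c => by rw [S3_swap y x, S3_swap v u]; exact h.2.2 _ _ _⟩

theorem Std.renorm {Φ : Matrix (Fin n) (Fin n) ℝ → Matrix (Fin m) (Fin m) ℝ}
    {A : Matrix (Fin n) (Fin n) ℝ} {x y : Fin n → ℝ} {κ κ' : ℝ} {u v u' : Fin m → ℝ}
    (h : Std Φ A x y κ u v) (hκ : κ' ≠ 0) (hu : u' ≠ 0) (e : κ' • Sq u' = κ • Sq u) :
    ∃ v', Std Φ A x y κ' u' v' := by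
  obtain ⟨h1, h2, h3⟩ := h
  obtain ⟨c, hc, rfl⟩ := Sq_par hκ hu h2.left e
  have e' : κ' = κ * c ^ 2 := by
    rw [Sq_smul, smul_smul] at e
    exact smul_left_injective ℝ (Sq_ne_zero hu) e
  refine ⟨c⁻¹ • v, hκ, ?_, fun a b d => ?_⟩
  · have := (h2.symm.smul_right (inv_ne_zero hc)).symm.smul_right (inv_ne_zero hc)
    rwa [smul_smul, inv_mul_cancel₀ hc, one_smul] at this
  · rw [h3, e']
    ext i j
    simp [S3, Sq, Sp, vecMulVec_apply]
    field_simp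

theorem meet {M : Matrix (Fin m) (Fin m) ℝ} (hM : M ≠ 0) {u u' : Fin m → ℝ} (hu : u ≠ 0) (hu' : u' ≠ 0)
    (h : ∃ s : ℝ, M = s • Sq u) (h' : ∃ s : ℝ, M = s • Sq u') : ∃ c : ℝ, c ≠ 0 ∧ u' = c • u := by
  obtain ⟨s, rfl⟩ := h
  obtain ⟨s', h'⟩ := h'
  exact Sq_par (fun h => hM (by rw [h, zero_smul])) hu hu' h'

theorem mem_smul {M : Matrix (Fin m) (Fin m) ℝ} {u : Fin m → ℝ} {c : ℝ}
    (h : ∃ s : ℝ, M = s • Sq (c • u)) : ∃ s : ℝ, M = s • Sq u := by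
  obtain ⟨s, rfl⟩ := h
  exact ⟨s * c ^ 2, by rw [Sq_smul, smul_smul]⟩

theorem Adj.nz {Φ : Matrix (Fin n) (Fin n) ℝ → Matrix (Fin m) (Fin m) ℝ} (hΦ : Adj Φ)
    {A : Matrix (Fin n) (Fin n) ℝ} (hA : A.IsSymm) {x : Fin n → ℝ} (hx : x ≠ 0) {t : ℝ} (ht : t ≠ 0) :
    R1 (Φ (A + t • Sq x) - Φ A) := by
  apply hΦ _ _ (hA.add ((Sq_symm x).smul t)) hA
  rw [add_sub_cancel_left]
  exact ⟨t, x, ht, hx, rfl⟩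

theorem Coll.lineX {Φ : Matrix (Fin n) (Fin n) ℝ → Matrix (Fin m) (Fin m) ℝ}
    {A : Matrix (Fin n) (Fin n) ℝ} {x y : Fin n → ℝ} {u : Fin m → ℝ} (h : Coll Φ A x y u) (t α β : ℝ) :
    ∃ s : ℝ, Φ (A + t • Sq (α • x + β • y)) - Φ A = s • Sq u := by
  rw [S3_comb]; exact h.2 _ _ _

theorem Std.lineX {Φ : Matrix (Fin n) (Fin n) ℝ → Matrix (Fin m) (Fin m) ℝ}
    {A : Matrix (Fin n) (Fin n) ℝ} {x y : Fin n → ℝ} {κ : ℝ} {u v : Fin m → ℝ} (h : Std Φ A x y κ u v)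
    (t α β : ℝ) :
    Φ (A + t • Sq (α • x + β • y)) - Φ A = κ • t • Sq (α • u + β • v) := by
  rw [S3_comb, S3_comb]; exact h.2.2 _ _ _

theorem Coll.all {Φ : Matrix (Fin n) (Fin n) ℝ → Matrix (Fin m) (Fin m) ℝ} (hΦ : Adj Φ)
    {A : Matrix (Fin n) (Fin n) ℝ} (hA : A.IsSymm) {x y : Fin n → ℝ} (hxy : Ind x y)
    {u : Fin m → ℝ} (h : Coll Φ A x y u) (z : Fin n → ℝ) (t : ℝ) :
    ∃ s : ℝ, Φ (A + t • Sq z) - Φ A = s • Sq u := by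
  by_cases hz : ∃ α β : ℝ, z = α • x + β • y
  · obtain ⟨α, β, rfl⟩ := hz
    exact h.lineX t α β
  have hx : ∀ t, ∃ s : ℝ, Φ (A + t • Sq x) - Φ A = s • Sq u := fun t => by
    simpa using h.lineX t 1 0
  have hy : ∀ t, ∃ s : ℝ, Φ (A + t • Sq y) - Φ A = s • Sq u := fun t => by
    simpa using h.lineX t 0 1
  have ixz : Ind x z := by
    rcases ind_or hxy.left z with ⟨c, hc⟩ | h
    · exact (hz ⟨c, 0, by simp [hc]⟩).elim
    · exact h
  have iyz : Ind y z := by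
    rcases ind_or hxy.right z with ⟨c, hc⟩ | h
    · exact (hz ⟨0, c, by simp [hc]⟩).elim
    · exact h
  rcases dichA hΦ hA ixz with ⟨u1, h1⟩ | ⟨κ, u1, v, h1⟩
  · obtain ⟨c, hc, rfl⟩ := meet (hΦ.nz hA hxy.left one_ne_zero).ne_zero h.1 h1.1 (hx 1)
      (by simpa using h1.lineX 1 1 0)
    exact mem_smul (by simpa using h1.lineX t 0 1)
  rcases dichA hΦ hA iyz with ⟨u2, h2⟩ | ⟨κ2, u2, v2, h2⟩
  · obtain ⟨c, hc, rfl⟩ := meet (hΦ.nz hA hxy.right one_ne_zero).ne_zero h.1 h2.1 (hy 1)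
      (by simpa using h2.lineX 1 1 0)
    exact mem_smul (by simpa using h2.lineX t 0 1)
  exfalso
  obtain ⟨s, hs⟩ := hx 1
  have e1 := h1.lineX 1 1 0
  simp only [one_smul, zero_smul, add_zero] at e1 hs
  have hs0 : s ≠ 0 := by
    rintro rfl
    have := hΦ.nz hA hxy.left one_ne_zero
    rw [one_smul, hs, zero_smul] at this
    exact this.ne_zero rfl
  obtain ⟨v', h1'⟩ := h1.renorm hs0 h.1 (hs.symm.trans e1)
  have e2 := h1'.lineX 1 0 1
  have e3 := h2.lineX 1 0 1
  simp only [one_smul, zero_smul, zero_add] at e2 e3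
  obtain ⟨w, h2'⟩ := h2.swap.renorm hs0 h1'.2.1.right (e2.symm.trans e3)
  have h2s := h2'.swap
  obtain ⟨l, hl, rfl⟩ := meet (hΦ.nz hA hxy.right one_ne_zero).ne_zero h.1 h2s.2.1.left (hy 1)
      ⟨s, by simpa using h2s.lineX 1 1 0⟩
  have f1 := h1'.lineX 1 1 1
  have f2 := h2s.lineX 1 l⁻¹ 1
  rw [inv_smul_smul₀ hl, ← one_smul ℝ u] at f2
  have hne1 : x + z ≠ 0 := by
    intro h
    exact hz ⟨-1, 0, by rw [eq_neg_of_add_eq_zero_right h]; simp⟩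
  have ind : Ind ((1 : ℝ) • x + (1 : ℝ) • z) (l⁻¹ • y + (1 : ℝ) • z) := by
    rw [one_smul, one_smul]
    rcases ind_or hne1 (l⁻¹ • y + z) with ⟨c, hc⟩ | h
    · exfalso
      by_cases hc1 : c = 1
      · rw [hc1, one_smul] at hc
        exact hxy.symm.not_smul l⁻¹ (add_right_cancel hc).symm
      · have hc1' : 1 - c ≠ 0 := sub_ne_zero.mpr (Ne.symm hc1)
        apply hz
        refine ⟨(1 - c)⁻¹ * c, -((1 - c)⁻¹ * l⁻¹), ?_⟩
        have : (1 - c) • z = c • x - l⁻¹ • y := by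
          rw [sub_smul, one_smul, sub_eq_sub_iff_add_eq_add, ← smul_add, ← hc, add_comm]
        rw [neg_smul, ← sub_eq_add_neg, mul_smul, mul_smul, ← smul_sub, ← this, smul_smul,
          inv_mul_cancel₀ hc1', one_smul]
    · exact h
  have iuv := h1'.2.1
  have huv : (1 : ℝ) • u + (1 : ℝ) • v' ≠ 0 := fun h => one_ne_zero (iuv.coef h).1
  rcases dichA hΦ hA ind with ⟨u3, h3⟩ | ⟨κ3, p, q, h3⟩
  · obtain ⟨c, hc, rfl⟩ := meet (hΦ.nz hA ind.left one_ne_zero).ne_zero huv h3.1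
      ⟨s, by rw [f1, one_smul]⟩ (by simpa using h3.lineX 1 1 0)
    have g1 := h3.lineX 1 1 (-1)
    have g2 := h.lineX 1 1 (-l⁻¹)
    have g3 : (1 : ℝ) • ((1 : ℝ) • x + (1 : ℝ) • z) + (-1 : ℝ) • (l⁻¹ • y + (1 : ℝ) • z) =
        (1 : ℝ) • x + (-l⁻¹) • y := by
      simp only [one_smul, neg_smul, smul_add]; abel
    rw [g3] at g1
    have hne : (1 : ℝ) • x + (-l⁻¹) • y ≠ 0 := fun h => one_ne_zero (hxy.coef h).1
    obtain ⟨d, hd, e⟩ := meet (hΦ.nz hA hne one_ne_zero).ne_zero h3.1 h.1 g1 g2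
    rw [smul_smul] at e
    have : (1 - d * c) • u + (- (d * c)) • v' = 0 := by
      rw [smul_add, one_smul, one_smul] at e
      rw [sub_smul, one_smul, neg_smul, sub_add_eq_add_sub, ← sub_eq_add_neg, sub_sub, sub_eq_zero]
      conv_lhs => rw [e]
      abel
    have h5 := iuv.coef this
    have : (1 : ℝ) = 0 := by linarith [h5.1, h5.2]
    exact one_ne_zero this
  · have g1 := h3.lineX 1 1 0
    have g2 := h3.lineX 1 0 1
    have k1 : κ3 • Sq p = κ3 • Sq q := by
      simp only [one_smul, zero_smul, zero_add, add_zero] at g1 g2 f1 f2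
      rw [← g1, ← g2, f1, f2]
    obtain ⟨c, hc, e⟩ := Sq_par h3.1 h3.2.1.left h3.2.1.right k1
    exact h3.2.1.not_smul _ e

end


section
variable {n m : ℕ}

theorem Sp_eq (x y : Fin n → ℝ) : Sp x y = Sq (x + y) - Sq x - Sq y := by
  ext i j; simp [Sp, Sq, vecMulVec_apply]; ring

theorem sym_ind (P : Matrix (Fin n) (Fin n) ℝ → Prop) (h0 : P 0)
    (hs : ∀ A, A.IsSymm → P A → ∀ (t : ℝ) x, P (A + t • Sq x)) : ∀ A, A.IsSymm → P A := by
  intro B hB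
  let Q : Matrix (Fin n) (Fin n) ℝ → Prop := fun B => B.IsSymm ∧ ∀ A, A.IsSymm → P A → P (A + B)
  have Qadd : ∀ B C, Q B → Q C → Q (B + C) := by
    rintro B C ⟨hB, h1⟩ ⟨hC, h2⟩
    refine ⟨hB.add hC, fun A hA h => ?_⟩
    rw [← add_assoc]
    exact h2 _ (hA.add hB) (h1 _ hA h)
  have Q0 : Q 0 := ⟨by simp, fun A hA h => by simpa using h⟩
  have Qsq : ∀ (t : ℝ) x, Q (t • Sq x) := fun t x => ⟨(Sq_symm x).smul t, fun A hA h => hs A hA h t x⟩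
  have Qsp : ∀ (t : ℝ) x y, Q (t • Sp x y) := by
    intro t x y
    have : t • Sp x y = t • Sq (x + y) + ((-t) • Sq x + (-t) • Sq y) := by
      rw [Sp_eq, smul_sub, smul_sub, neg_smul, neg_smul]; abel
    rw [this]
    exact Qadd _ _ (Qsq _ _) (Qadd _ _ (Qsq _ _) (Qsq _ _))
  have e : B = ∑ i, ∑ j, (B i j / 2) • Sp (Pi.single i 1) (Pi.single j 1) := by
    ext a b
    have hab : B b a = B a b := hB.apply a b
    simp [Matrix.sum_apply, Sp, vecMulVec_apply, Pi.single_apply, mul_add, Finset.sum_add_distrib,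
      Finset.sum_ite_eq, hab]
    try ring
  have : Q B := by
    rw [e]
    refine Finset.sum_induction _ Q Qadd Q0 fun i _ => Finset.sum_induction _ Q Qadd Q0 fun j _ => Qsp _ _ _
  simpa using this.2 0 (by simp) h0

theorem exists_ind (hn : 2 ≤ n) {x : Fin n → ℝ} (hx : x ≠ 0) : ∃ y, Ind x y := by
  by_contra hcon
  push Not at hcon
  have h : ∀ y, ∃ c : ℝ, c • x = y := fun y =>
    ((ind_or hx y).resolve_right (hcon y)).imp fun c hc => hc.symm
  have := finrank_le_one x h
  simp at this
  omega

def AllC (Φ : Matrix (Fin n) (Fin n) ℝ → Matrix (Fin m) (Fin m) ℝ) (A : Matrix (Fin n) (Fin n) ℝ)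
    (u : Fin m → ℝ) : Prop := ∀ z (t : ℝ), ∃ s : ℝ, Φ (A + t • Sq z) - Φ A = s • Sq u

theorem AllC.step (hn : 2 ≤ n) {Φ : Matrix (Fin n) (Fin n) ℝ → Matrix (Fin m) (Fin m) ℝ} (hΦ : Adj Φ)
    {A : Matrix (Fin n) (Fin n) ℝ} (hA : A.IsSymm) {u : Fin m → ℝ} (hu : u ≠ 0) (h : AllC Φ A u)
    (r : ℝ) (y : Fin n → ℝ) : AllC Φ (A + r • Sq y) u := by
  by_cases hy : y = 0
  · rw [hy]; simpa [Sq] using h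
  obtain ⟨x, hx⟩ := exists_ind hn hy
  have hc : Coll Φ A y x u := by
    rcases dichA hΦ hA hx with ⟨u', h'⟩ | ⟨κ, p, q, h'⟩
    · obtain ⟨c, hc, e⟩ := meet (hΦ.nz hA hy one_ne_zero).ne_zero h'.1 hu
        (by simpa using h'.lineX 1 1 0) (h y 1)
      refine ⟨hu, fun a b d => ?_⟩
      have : u' = c⁻¹ • u := by rw [e, inv_smul_smul₀ hc]
      apply mem_smul (c := c⁻¹)
      rw [← this]
      exact h'.2 a b d
    · exfalso
      obtain ⟨c, hc, e⟩ := meet (hΦ.nz hA hy one_ne_zero).ne_zero hu h'.2.1.left (h y 1)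
        ⟨κ, by simpa using h'.lineX 1 1 0⟩
      obtain ⟨d, hd, e'⟩ := meet (hΦ.nz hA hx.right one_ne_zero).ne_zero hu h'.2.1.right (h x 1)
        ⟨κ, by simpa using h'.lineX 1 0 1⟩
      refine h'.2.1.not_smul (d * c⁻¹) ?_
      rw [e', e, smul_smul, mul_assoc, inv_mul_cancel₀ hc, mul_one]
  have hc' : Coll Φ (A + r • Sq y) y x u := by
    refine ⟨hu, fun a b d => ?_⟩
    obtain ⟨s1, e1⟩ := hc.2 (r + a) (0 + b) (0 + d)
    obtain ⟨s2, e2⟩ := hc.2 r 0 0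
    refine ⟨s1 - s2, ?_⟩
    rw [← S3_10 y x, sub_smul, ← e1, ← e2, ← S3_add, ← add_assoc]
    abel
  exact hc'.all hΦ (hA.add ((Sq_symm y).smul r)) hx

theorem case_coll (hn : 2 ≤ n) {Φ : Matrix (Fin n) (Fin n) ℝ → Matrix (Fin m) (Fin m) ℝ} (hΦ : Adj Φ)
    (h0 : Φ 0 = 0) {A : Matrix (Fin n) (Fin n) ℝ} (hA : A.IsSymm) {x y : Fin n → ℝ} (hxy : Ind x y)
    {u : Fin m → ℝ} (h : Coll Φ A x y u) : ∀ B, B.IsSymm → ∃ s : ℝ, Φ B = s • Sq u := by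
  have key := sym_ind (fun B => AllC Φ (A + B) u ∧ ∃ s : ℝ, Φ (A + B) - Φ A = s • Sq u) (by
    refine ⟨?_, 0, by simp⟩
    rw [add_zero]
    exact h.all hΦ hA hxy) (by
    rintro B hB ⟨h1, s, h2⟩ t x
    rw [← add_assoc]
    refine ⟨h1.step hn hΦ (hA.add hB) h.1 t x, ?_⟩
    obtain ⟨s', h3⟩ := h1 x t
    refine ⟨s' + s, ?_⟩
    rw [add_smul, ← h2, ← h3]; abel)
  intro B hB
  obtain ⟨-, s, h1⟩ := key (B - A) (hB.sub hA)
  obtain ⟨-, s', h2⟩ := key (-A) (hA.neg)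
  rw [add_sub_cancel] at h1
  rw [add_neg_cancel, h0] at h2
  refine ⟨s - s', ?_⟩
  rw [sub_smul, ← h1, ← h2]; abel

theorem case_std (hn : 2 ≤ n) {Φ : Matrix (Fin n) (Fin n) ℝ → Matrix (Fin m) (Fin m) ℝ} (hΦ : Adj Φ)
    (h0 : Φ 0 = 0) (hS : ∀ A, A.IsSymm → ∀ x y, Ind x y → ∃ κ u v, Std Φ A x y κ u v) :
    ∃ (κ : ℝ) (T : (Fin n → ℝ) →ₗ[ℝ] (Fin m → ℝ)), κ ≠ 0 ∧ Function.Injective T ∧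
      ∀ B, B.IsSymm → Φ B = κ • (T.toMatrix' * B * T.toMatrix'ᵀ) := by
  have c1 : ∀ A, A.IsSymm → ∀ x (t : ℝ), Φ (A + t • Sq x) - Φ A = t • (Φ (A + Sq x) - Φ A) := by
    intro A hA x t
    by_cases hx : x = 0
    · rw [hx]; simp [Sq]
    obtain ⟨y, hy⟩ := exists_ind hn hx
    obtain ⟨κ, u, v, h⟩ := hS A hA x y hy
    have h1 := h.lineX t 1 0
    have h2 := h.lineX 1 1 0
    simp only [one_smul, zero_smul, add_zero] at h1 h2
    rw [h1, h2, smul_comm]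
  have c2 : ∀ A, A.IsSymm → ∀ x y (t s : ℝ), Φ (A + t • Sq x + s • Sq y) - Φ (A + t • Sq x) =
      Φ (A + s • Sq y) - Φ A := by
    intro A hA x y t s
    by_cases hx : x = 0
    · rw [hx]; simp [Sq]
    rcases ind_or hx y with ⟨c, rfl⟩ | hy
    · have h1 := c1 A hA x (t + s * c ^ 2)
      have h2 := c1 A hA x (s * c ^ 2)
      have h3 := c1 A hA x t
      rw [Sq_smul, smul_smul, add_assoc, ← add_smul, h2]
      rw [← sub_sub_sub_cancel_right _ _ (Φ A), h1, h3, ← sub_smul, add_sub_cancel_left]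
    · obtain ⟨κ, u, v, h⟩ := hS A hA x y hy
      have h1 := h.2.2 t s 0
      have h2 := h.2.2 t 0 0
      have h3 := h.2.2 0 s 0
      have e : A + t • Sq x + s • Sq y = A + S3 x y t s 0 := by simp [S3, add_assoc]
      rw [e, ← S3_10 x y, ← S3_01 x y, h3, ← sub_sub_sub_cancel_right _ _ (Φ A), h1, h2, ← smul_sub, S3_sub]
      simp
  have c3 : ∀ B, B.IsSymm → ∀ (s : ℝ) y, Φ (B + s • Sq y) = Φ B + Φ (s • Sq y) := by
    intro B hB s y
    refine sym_ind (fun B => Φ (B + s • Sq y) = Φ B + Φ (s • Sq y)) (by simp [h0]) ?_ B hB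
    intro A hA h t x
    have := c2 A hA x y t s
    rw [h, add_sub_cancel_left, sub_eq_iff_eq_add] at this
    rw [this, add_comm]
  have c4 : ∀ A, A.IsSymm → ∀ B, B.IsSymm → Φ (A + B) = Φ A + Φ B := by
    intro A hA
    refine sym_ind _ (by simp [h0]) ?_
    intro B hB h t x
    rw [← add_assoc, c3 _ (hA.add hB), h, c3 _ hB, add_assoc]
  have c5 : ∀ (t : ℝ) x, Φ (t • Sq x) = t • Φ (Sq x) := by
    intro t x
    have := c1 0 (by simp) x t
    simpa [h0] using this
  have c6 : ∀ (c : ℝ) B, B.IsSymm → Φ (c • B) = c • Φ B := by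
    intro c
    refine sym_ind _ (by simp [h0]) ?_
    intro B hB h t x
    rw [smul_add, c4 _ (hB.smul c) _ (((Sq_symm x).smul t).smul c), h, c3 _ hB, smul_smul, c5, c5,
      smul_add, smul_smul]
  let e : Fin n → ℝ := Pi.single ⟨0, by omega⟩ 1
  have he : e ≠ 0 := by simp [e]
  obtain ⟨κ, u, hκ, hu, eu⟩ : R1 (Φ (Sq e)) := by
    have := hΦ.nz (A := 0) (by simp) he one_ne_zero
    simpa [h0] using this
  have hw : ∀ y, ∃ w, Φ (Sp e y) = κ • Sp u w ∧ Φ (Sq y) = κ • Sq w := by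
    intro y
    rcases ind_or he y with ⟨c, rfl⟩ | hy
    · refine ⟨c • u, ?_, ?_⟩
      · have h1 : Sp e (c • e) = (2 * c) • Sq e := by
          ext i j; simp [Sp, Sq, vecMulVec_apply]; ring
        have h2 : Sp u (c • u) = (2 * c) • Sq u := by
          ext i j; simp [Sp, Sq, vecMulVec_apply]; ring
        rw [h1, h2, c5, eu, smul_comm]
      · rw [Sq_smul, Sq_smul, c5, eu, smul_comm]
    · obtain ⟨κ', u', v', h⟩ := hS 0 (by simp) e y hy
      have h1 := h.lineX 1 1 0
      simp only [one_smul, zero_smul, add_zero, zero_add, h0, sub_zero] at h1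
      obtain ⟨w, h2⟩ := h.renorm hκ hu (eu.symm.trans h1)
      refine ⟨w, ?_, ?_⟩
      · have := h2.2.2 0 0 1
        simpa [S3, h0] using this
      · have := h2.2.2 0 1 0
        simpa [S3, h0] using this
  choose T hT1 hT2 using hw
  have Sp_zero : ∀ w : Fin m → ℝ, Sp u w = 0 → w = 0 := by
    intro w h
    rcases ind_or hu w with ⟨c, rfl⟩ | ⟨p, q, h1, h2, h3, h4⟩
    · have h2 : Sp u (c • u) = (2 * c) • Sq u := by
        ext i j; simp [Sp, Sq, vecMulVec_apply]; ring
      rw [h2, smul_eq_zero] at h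
      have := h.resolve_right (Sq_ne_zero hu)
      have : c = 0 := by linarith
      rw [this, zero_smul]
    · have := congrArg (fun M => M *ᵥ p) h
      simpa [Sp_mulVec, h1, h2] using this
  have Sp_inj : ∀ w w' : Fin m → ℝ, κ • Sp u w = κ • Sp u w' → w = w' := by
    intro w w' h
    have h' := smul_right_injective _ hκ h
    rw [← sub_eq_zero]
    apply Sp_zero
    have : Sp u (w - w') = Sp u w - Sp u w' := by
      ext i j; simp [Sp, vecMulVec_apply]; ring
    rw [this, h', sub_self]
  let TL : (Fin n → ℝ) →ₗ[ℝ] (Fin m → ℝ) :=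
    { toFun := T
      map_add' := by
        intro x y
        apply Sp_inj
        have h1 : Sp e (x + y) = Sp e x + Sp e y := by
          ext i j; simp [Sp, vecMulVec_apply]; ring
        have h2 : Sp u (T x + T y) = Sp u (T x) + Sp u (T y) := by
          ext i j; simp [Sp, vecMulVec_apply]; ring
        rw [← hT1, h1, c4 _ (Sp_symm _ _) _ (Sp_symm _ _), hT1, hT1, h2, smul_add]
      map_smul' := by
        intro c x
        apply Sp_inj
        have h1 : Sp e (c • x) = c • Sp e x := by
          ext i j; simp [Sp, vecMulVec_apply]; ring
        have h2 : Sp u (c • T x) = c • Sp u (T x) := by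
          ext i j; simp [Sp, vecMulVec_apply]; ring
        rw [← hT1, h1, c6 _ _ (Sp_symm _ _), hT1, RingHom.id_apply, h2, smul_comm] }
  refine ⟨κ, TL, hκ, ?_, ?_⟩
  · rw [injective_iff_map_eq_zero]
    intro y hy
    by_contra hne
    have h1 := (hΦ.nz (A := 0) (by simp) hne one_ne_zero).ne_zero
    apply h1
    have hy' : T y = 0 := hy
    rw [one_smul, zero_add, h0, sub_zero, hT2, hy']
    simp [Sq]
  · refine sym_ind _ (by simp [h0]) ?_
    intro B hB h t x
    rw [c3 _ hB, h, c5, hT2]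
    have : TL.toMatrix' * Sq x * TL.toMatrix'ᵀ = Sq (T x) := by
      rw [Sq, mul_vecMulVec, vecMulVec_mul, vecMul_transpose, LinearMap.toMatrix'_mulVec]; rfl
    rw [Matrix.mul_add, Matrix.add_mul, smul_add, Matrix.mul_smul, Matrix.smul_mul, this, smul_comm]

theorem extend_R (κ : ℝ) (hκ : κ ≠ 0) (T : (Fin n → ℝ) →ₗ[ℝ] (Fin m → ℝ)) (hT : Function.Injective T) :
    n ≤ m ∧ ∃ c : ℝ, (c = 1 ∨ c = -1) ∧ ∃ (R : Matrix (Fin m) (Fin m) ℝ) (E : Matrix (Fin m) (Fin n) ℝ), IsUnit R ∧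
      E = (Matrix.of fun (i : Fin m) (j : Fin n) => if (i : ℕ) = j then (1 : ℝ) else 0) ∧
      ∀ B : Matrix (Fin n) (Fin n) ℝ, κ • (T.toMatrix' * B * T.toMatrix'ᵀ) = c • (R * (E * B * Eᵀ) * Rᵀ) := by
  have hnm : n ≤ m := by
    have := LinearMap.finrank_le_finrank_of_injective hT
    simpa using this
  refine ⟨hnm, ?_⟩
  let E := (Matrix.of fun (i : Fin m) (j : Fin n) => if (i : ℕ) = j then (1 : ℝ) else 0)
  have hE : Function.Injective (Matrix.toLin' E) := by
    intro x y h
    ext j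
    have := congrFun h (Fin.castLE hnm j)
    simpa [E, mulVec, dotProduct, Fin.val_inj] using this
  obtain ⟨g, hg⟩ := Submodule.exists_linearEquiv_restrict_eq
    ((LinearEquiv.ofInjective _ hE).symm.trans (LinearEquiv.ofInjective _ hT))
  have hg' : T.toMatrix' = LinearMap.toMatrix' (g : (Fin m → ℝ) →ₗ[ℝ] (Fin m → ℝ)) * E := by
    have : T = (g : (Fin m → ℝ) →ₗ[ℝ] (Fin m → ℝ)) ∘ₗ Matrix.toLin' E := by
      ext1 j
      ext1
      have := hg (LinearEquiv.ofInjective _ hE (Pi.single j 1))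
      simp at this
      simp [this]
    rw [this, LinearMap.toMatrix'_comp, LinearMap.toMatrix'_toLin']
  have hgu : IsUnit (LinearMap.toMatrix' (g : (Fin m → ℝ) →ₗ[ℝ] (Fin m → ℝ))) := by
    rw [isUnit_iff_exists]
    refine ⟨LinearMap.toMatrix' (g.symm : (Fin m → ℝ) →ₗ[ℝ] (Fin m → ℝ)), ?_, ?_⟩
    · rw [← LinearMap.toMatrix'_comp]; simp
    · rw [← LinearMap.toMatrix'_comp]; simp
  have hr : √|κ| ≠ 0 := by
    rw [Real.sqrt_ne_zero (abs_nonneg _)]; simpa using hκ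
  have hr2 : √|κ| * √|κ| = |κ| := Real.mul_self_sqrt (abs_nonneg _)
  obtain ⟨c, hc, hcκ⟩ : ∃ c : ℝ, (c = 1 ∨ c = -1) ∧ κ = c * |κ| := by
    rcases le_total 0 κ with h | h
    · exact ⟨1, Or.inl rfl, by rw [abs_of_nonneg h]; ring⟩
    · exact ⟨-1, Or.inr rfl, by rw [abs_of_nonpos h]; ring⟩
  refine ⟨c, hc, √|κ| • LinearMap.toMatrix' (g : (Fin m → ℝ) →ₗ[ℝ] (Fin m → ℝ)), E, ?_, rfl, ?_⟩
  · rw [Matrix.isUnit_iff_isUnit_det] at hgu ⊢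
    rw [det_smul]
    exact ((IsUnit.mk0 _ hr).pow _).mul hgu
  · intro B
    rw [hg']
    generalize LinearMap.toMatrix' (g : (Fin m → ℝ) →ₗ[ℝ] (Fin m → ℝ)) = G
    simp only [transpose_mul, transpose_smul, Matrix.smul_mul, Matrix.mul_smul, smul_smul, hr2, ← hcκ, Matrix.mul_assoc]

end

theorem embed_eq (n m : ℕ) (A : Matrix (Fin n) (Fin n) ℝ) (E : Matrix (Fin m) (Fin n) ℝ)
    (hE : E = (Matrix.of fun (i : Fin m) (j : Fin n) => if (i : ℕ) = j then (1 : ℝ) else 0)) :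
    embedBlock n m A = E * A * Eᵀ := by
  have h : ∀ (i : Fin m) (f : Fin n → ℝ), ∑ k : Fin n, (if (i : ℕ) = k then (1 : ℝ) else 0) * f k =
      if hi : (i : ℕ) < n then f ⟨i, hi⟩ else 0 := by
    intro i f
    split_ifs with hi
    · rw [Finset.sum_eq_single ⟨i, hi⟩]
      · simp
      · intro b _ hb
        rw [if_neg, zero_mul]
        intro h
        exact hb (Fin.ext h.symm)
      · simp
    · apply Finset.sum_eq_zero
      intro k _
      rw [if_neg, zero_mul]
      intro h
      exact hi (h ▸ k.2)
  ext i j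
  subst hE
  rw [Matrix.mul_assoc]
  simp only [embedBlock, of_apply, mul_apply, transpose_apply]
  rw [h]
  split_ifs with hi hj
  · simp_rw [mul_comm (A _ _)]
    rw [h, dif_pos hj]
  · simp_rw [mul_comm (A _ _)]
    rw [h, dif_neg hj]
  · rfl

/-- Main theorem: an adjacency preserving map `Φ : S_n → S_m` (`n ≥ 2`) with
`Φ(0) = 0` is either degenerate or standard. -/
theorem main_theorem (n m : ℕ) (hn : 2 ≤ n)
    (Φ : Matrix (Fin n) (Fin n) ℝ → Matrix (Fin m) (Fin m) ℝ)
    (hΦsym : ∀ A : Matrix (Fin n) (Fin n) ℝ, A.IsSymm → (Φ A).IsSymm)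
    (hΦadj : ∀ A B : Matrix (Fin n) (Fin n) ℝ, A.IsSymm → B.IsSymm →
      (A - B).rank = 1 → (Φ A - Φ B).rank = 1)
    (hΦ0 : Φ 0 = 0) :
    (∃ B : Matrix (Fin m) (Fin m) ℝ, B.IsSymm ∧ B.rank = 1 ∧
      ∃ f : Matrix (Fin n) (Fin n) ℝ → ℝ,
        ∀ A : Matrix (Fin n) (Fin n) ℝ, A.IsSymm → Φ A = f A • B) ∨
    (n ≤ m ∧ ∃ c : ℝ, (c = 1 ∨ c = -1) ∧ ∃ R : Matrix (Fin m) (Fin m) ℝ, IsUnit R ∧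
      ∀ A : Matrix (Fin n) (Fin n) ℝ, A.IsSymm →
        Φ A = c • (R * embedBlock n m A * Rᵀ)) := by
  have hΦ : Adj Φ := fun A B hA hB h =>
    R1_of_rank ((hΦsym A hA).sub (hΦsym B hB)) (hΦadj A B hA hB (rank_R1 h))
  by_cases hcol : ∃ A : Matrix (Fin n) (Fin n) ℝ, A.IsSymm ∧ ∃ x y u, Ind x y ∧ Coll Φ A x y u
  · left
    obtain ⟨A, hA, x, y, u, hxy, h⟩ := hcol
    have key := case_coll hn hΦ hΦ0 hA hxy h
    refine ⟨Sq u, Sq_symm u, rank_R1 ⟨1, u, one_ne_zero, h.1, by simp⟩, ?_⟩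
    have : ∀ B : Matrix (Fin n) (Fin n) ℝ, ∃ s : ℝ, B.IsSymm → Φ B = s • Sq u := by
      intro B
      by_cases hB : B.IsSymm
      · exact (key B hB).imp fun s hs _ => hs
      · exact ⟨0, fun h => (hB h).elim⟩
    choose f hf using this
    exact ⟨f, hf⟩
  · right
    obtain ⟨κ, T, hκ, hT, hΦT⟩ := case_std hn hΦ hΦ0 (by
      intro A hA x y hxy
      rcases dichA hΦ hA hxy with ⟨u, h⟩ | h
      · exact (hcol ⟨A, hA, x, y, u, hxy, h⟩).elim
      · exact h)
    obtain ⟨hnm, c, hc, R, E, hR, hE, hB⟩ := extend_R κ hκ T hT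
    refine ⟨hnm, c, hc, R, hR, fun A hA => ?_⟩
    rw [hΦT A hA, hB, embed_eq n m A E hE]
end

section
/- Let A, B, C be n×n real matrices with C = A + B. Then rank(C) = rank(A) + rank(B) if and only if the column space of C is the (internal) direct sum of the column space of A and the column space of B, i.e., Im C = Im A + Im B and Im A ∩ Im B = {0}. -/
open Matrix

/-- `rank C = rank A + rank B` iff the column space of `C = A + B` is the
internal direct sum of the column spaces of `A` and `B`. -/
theorem rank_add_iff_image_directSum (n : ℕ) (A B C : Matrix (Fin n) (Fin n) ℝ)
    (h : C = A + B) :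
    C.rank = A.rank + B.rank ↔
      (LinearMap.range C.mulVecLin =
          LinearMap.range A.mulVecLin ⊔ LinearMap.range B.mulVecLin ∧
        LinearMap.range A.mulVecLin ⊓ LinearMap.range B.mulVecLin = ⊥) := by
  have hle : LinearMap.range C.mulVecLin ≤
      LinearMap.range A.mulVecLin ⊔ LinearMap.range B.mulVecLin := by
    rintro _ ⟨x, rfl⟩
    rw [h, Matrix.mulVecLin_add, LinearMap.add_apply]
    exact Submodule.add_mem_sup (LinearMap.mem_range_self _ x) (LinearMap.mem_range_self _ x)
  have hdim := Submodule.finrank_sup_add_finrank_inf_eq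
    (LinearMap.range A.mulVecLin) (LinearMap.range B.mulVecLin)
  have hmono := Submodule.finrank_mono hle
  unfold Matrix.rank
  constructor
  · intro hr
    refine ⟨Submodule.eq_of_le_of_finrank_eq hle (by omega), ?_⟩
    exact Submodule.finrank_eq_zero.mp (by omega)
  · rintro ⟨h1, h2⟩
    rw [h2, finrank_bot] at hdim
    rw [h1]
    omega
end

section
/- Let G ∈ S_n and let A, B ∈ S_n be adjacent, so that l(A,B) = {A + λ(B − A) : λ ∈ ℝ} is a line in S_n. Then either (i) there exists a natural number k such that d(G, X) = k for all X ∈ l(A,B), or (ii) there exists a point K ∈ l(A,B) such that d(G, X) = d(G, K) + 1 for all X ∈ l(A,B) with X ≠ K. -/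
open Matrix

theorem dtl_case1 {n : ℕ} (M : Matrix (Fin n) (Fin n) ℝ) (hM : M.IsSymm) (v : Fin n → ℝ)
    (hv : v ∉ LinearMap.range M.mulVecLin) (t : ℝ) (ht : t ≠ 0) :
    (M + t • vecMulVec v v).rank = M.rank + 1 := by
  have key : ∀ y, (M + t • vecMulVec v v) *ᵥ y = M *ᵥ y + (t * (v ⬝ᵥ y)) • v := by
    intro y
    ext i
    simp [Matrix.add_mulVec, Matrix.smul_mulVec, Matrix.vecMulVec_mulVec]
    ring
  apply le_antisymm
  · have h1 : LinearMap.range (M + t • vecMulVec v v).mulVecLin ≤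
        LinearMap.range M.mulVecLin ⊔ Submodule.span ℝ {v} := by
      rintro _ ⟨y, rfl⟩
      rw [Matrix.mulVecLin_apply, key]
      exact Submodule.add_mem_sup ⟨y, rfl⟩
        (Submodule.smul_mem _ _ (Submodule.mem_span_singleton_self v))
    have h2 := Submodule.finrank_mono h1
    have h3 := Submodule.finrank_add_le_finrank_add_finrank
      (LinearMap.range M.mulVecLin) (Submodule.span ℝ {v})
    have h4 : Module.finrank ℝ (Submodule.span ℝ {v}) ≤ 1 := by
      simpa using finrank_span_le_card (R := ℝ) ({v} : Set (Fin n → ℝ))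
    unfold Matrix.rank
    omega
  · obtain ⟨f, hf, hle⟩ := Submodule.exists_le_ker_of_notMem hv
    obtain ⟨z, rfl⟩ := (dotProductEquiv ℝ (Fin n)).surjective f
    have hz : M *ᵥ z = 0 := by
      have h1 : z ᵥ* M = 0 := by
        apply dotProduct_eq_zero
        intro y
        rw [← Matrix.dotProduct_mulVec]
        exact hle ⟨y, rfl⟩
      rw [← Matrix.mulVec_transpose, hM.eq] at h1
      exact h1
    have hzv : v ⬝ᵥ z ≠ 0 := by
      rw [dotProduct_comm]; exact hf
    have hvN : v ∈ LinearMap.range (M + t • vecMulVec v v).mulVecLin := by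
      refine ⟨(t * (v ⬝ᵥ z))⁻¹ • z, ?_⟩
      rw [map_smul, Matrix.mulVecLin_apply, key, hz, zero_add, smul_smul,
        inv_mul_cancel₀ (mul_ne_zero ht hzv), one_smul]
    apply Nat.succ_le_of_lt
    apply Submodule.finrank_lt_finrank_of_lt
    refine lt_of_le_of_ne ?_ (fun h => hv (h ▸ hvN))
    rintro _ ⟨y, rfl⟩
    have : M.mulVecLin y = (M + t • vecMulVec v v).mulVecLin y - (t * (v ⬝ᵥ y)) • v := by
      simp only [Matrix.mulVecLin_apply]
      rw [key]; simp
    rw [this]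
    exact Submodule.sub_mem _ ⟨y, rfl⟩ (Submodule.smul_mem _ _ hvN)

theorem dtl_core {n : ℕ} (M : Matrix (Fin n) (Fin n) ℝ) (hM : M.IsSymm) (v : Fin n → ℝ) :
    (∃ k : ℕ, ∀ t : ℝ, (M + t • vecMulVec v v).rank = k) ∨
    (∃ t0 : ℝ, ∀ t : ℝ, t ≠ t0 →
      (M + t • vecMulVec v v).rank = (M + t0 • vecMulVec v v).rank + 1) := by
  by_cases hv : v ∈ LinearMap.range M.mulVecLin
  · obtain ⟨x, hx⟩ := hv
    rw [Matrix.mulVecLin_apply] at hx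
    by_cases h0 : v ⬝ᵥ x = 0
    · left
      refine ⟨M.rank, fun t => ?_⟩
      have h1 : M + t • vecMulVec v v = M * (1 + vecMulVec (t • x) v) := by
        rw [mul_add, mul_one, Matrix.mul_vecMulVec, Matrix.mulVec_smul, hx, Matrix.smul_vecMulVec]
      rw [h1]
      apply Matrix.rank_mul_eq_left_of_det_ne_zero
      rw [Matrix.vecMulVec_eq (Fin 1), Matrix.det_one_add_replicateCol_mul_replicateRow]
      simp [h0]
    · right
      refine ⟨-(v ⬝ᵥ x)⁻¹, fun t ht => ?_⟩
      set t0 := -(v ⬝ᵥ x)⁻¹ with ht0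
      have hs : (vecMulVec v v).IsSymm := by
        ext i j; simp [Matrix.vecMulVec_apply, mul_comm]
      have hN : (M + t0 • vecMulVec v v).IsSymm := hM.add (hs.smul t0)
      have hNx : (M + t0 • vecMulVec v v) *ᵥ x = 0 := by
        ext i
        simp [Matrix.add_mulVec, Matrix.smul_mulVec, Matrix.vecMulVec_mulVec, hx]
        rw [ht0]
        field_simp
        ring
      have hvN : v ∉ LinearMap.range (M + t0 • vecMulVec v v).mulVecLin := by
        rintro ⟨y, hy⟩
        apply h0
        rw [Matrix.mulVecLin_apply] at hy
        rw [dotProduct_comm]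
        have h5 := congrArg (fun u => x ⬝ᵥ u) hy
        rw [← h5, Matrix.dotProduct_mulVec, ← Matrix.mulVec_transpose, hN.eq, hNx, zero_dotProduct]
      rw [← dtl_case1 _ hN v hvN (t - t0) (sub_ne_zero.2 ht), add_assoc, ← add_smul]
      simp
  · right
    refine ⟨0, fun t ht => ?_⟩
    rw [dtl_case1 M hM v hv t ht]
    simp

theorem dtl_rank1 {n : ℕ} (R : Matrix (Fin n) (Fin n) ℝ) (hR : R.IsSymm) (h : R.rank = 1) :
    ∃ (c : ℝ) (v : Fin n → ℝ), R = c • vecMulVec v v := by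
  obtain ⟨⟨v, hv⟩, hv0, hspan⟩ := finrank_eq_one_iff'.1 h
  have hcol : ∀ j, ∃ w : ℝ, ∀ i, R i j = w * v i := by
    intro j
    obtain ⟨w, hw⟩ := hspan ⟨R *ᵥ Pi.single j 1, ⟨_, rfl⟩⟩
    refine ⟨w, fun i => ?_⟩
    have := congrFun (congrArg Subtype.val hw) i
    simpa using this.symm
  choose w hw using hcol
  have hv1 : v ≠ 0 := fun h => hv0 (Subtype.ext h)
  obtain ⟨k, hk⟩ := Function.ne_iff.1 hv1
  simp only [Pi.zero_apply] at hk
  refine ⟨w k / v k, v, ?_⟩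
  ext i j
  have h1 : w j * v k = w k * v j := by
    rw [← hw, ← hw]; exact hR.apply j k
  simp only [Matrix.smul_apply, Matrix.vecMulVec_apply, smul_eq_mul]
  rw [hw]
  field_simp
  linear_combination v i * h1


/-- For a point `G` and a line `l(A,B)` in `S_n`: either the distance from `G`
to every point of the line is a constant `k`, or there is a unique point `K` of
the line with `d(G, X) = d(G, K) + 1` for every other point `X` of the line. -/
theorem distance_to_line (n : ℕ) (G A B : Matrix (Fin n) (Fin n) ℝ)
    (hG : G.IsSymm) (hA : A.IsSymm) (hB : B.IsSymm)
    (hadj : (A - B).rank = 1) :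
    (∃ k : ℕ, ∀ lam : ℝ, (G - (A + lam • (B - A))).rank = k) ∨
    (∃ lam0 : ℝ, ∀ lam : ℝ, lam ≠ lam0 →
      (G - (A + lam • (B - A))).rank = (G - (A + lam0 • (B - A))).rank + 1) := by
  
  obtain ⟨c', v, hc'⟩ := dtl_rank1 (A - B) (hA.sub hB) hadj
  obtain ⟨c, rfl⟩ : ∃ c, c' = -c := ⟨-c', by simp⟩
  have hc : B - A = c • vecMulVec v v := by
    rw [← neg_sub, hc', neg_smul, neg_neg]
  have e : ∀ lam : ℝ, G - (A + lam • (B - A)) = (G - A) + (-lam * c) • vecMulVec v v := by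
    intro lam
    rw [hc, smul_smul, neg_mul, neg_smul]; abel
  have hc0 : c ≠ 0 := by
    rintro rfl
    rw [hc'] at hadj
    simp at hadj
  simp only [e]
  rcases dtl_core (G - A) (hG.sub hA) v with ⟨k, hk⟩ | ⟨t0, ht0⟩
  · exact Or.inl ⟨k, fun lam => hk _⟩
  · refine Or.inr ⟨-(t0 / c), fun lam hl => ?_⟩
    have e0 : - -(t0 / c) * c = t0 := by field_simp
    rw [e0]
    apply ht0
    intro h
    apply hl
    rw [← h]; field_simp
end

section
/- Let R ∈ S_n have rank one, let λ ∈ ℝ with λ ≠ 1, and let A ∈ S_n be adjacent to both R and λ·R. Then A = μ·R for some μ ∈ ℝ with μ ≠ 1 and μ ≠ λ. -/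
open Matrix

lemma symm_rank_one_decomp (n : ℕ) (M : Matrix (Fin n) (Fin n) ℝ)
    (hs : M.IsSymm) (h : M.rank = 1) :
    ∃ (r : ℝ) (x : Fin n → ℝ) (p : Fin n), r ≠ 0 ∧ x p ≠ 0 ∧
      ∀ i j, M i j = r * x i * x j := by
  rw [Matrix.rank] at h
  obtain ⟨v, hv0, hv⟩ := finrank_eq_one_iff'.1 h
  have hc : ∀ j, ∃ c : ℝ, ∀ i, M i j = c * v.1 i := by
    intro j
    obtain ⟨c, hc⟩ := hv ⟨M.mulVecLin (Pi.single j 1), LinearMap.mem_range_self _ _⟩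
    refine ⟨c, fun i => ?_⟩
    have := congrFun (congrArg Subtype.val hc) i
    simpa using this.symm
  choose c hc using hc
  have hp : ∃ p, v.1 p ≠ 0 := by
    by_contra! hn
    exact hv0 (Subtype.ext (funext hn))
  obtain ⟨p, hp⟩ := hp
  have hM : ∀ i j, M i j = (c p / v.1 p) * v.1 i * v.1 j := by
    intro i j
    have h1 := hs.apply p j
    rw [hc, hc] at h1
    rw [hc]
    field_simp
    linear_combination (-v.1 i) * h1
  refine ⟨c p / v.1 p, v.1, p, ?_, hp, hM⟩
  intro h0
  have : M = 0 := by
    ext i j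
    rw [hM, h0]; simp
  rw [← Matrix.rank, this, Matrix.rank_zero] at h
  exact zero_ne_one h

/-- If `A ∈ S_n` is adjacent to both `R` and `λ • R`, where `R` has rank one and
`λ ≠ 1`, then `A = μ • R` with `μ ≠ 1, λ`. -/
theorem adjacent_to_two_multiples (n : ℕ) (R A : Matrix (Fin n) (Fin n) ℝ)
    (hRs : R.IsSymm) (hAs : A.IsSymm) (hR : R.rank = 1)
    (lam : ℝ) (hlam : lam ≠ 1)
    (h1 : (A - R).rank = 1) (h2 : (A - lam • R).rank = 1) :
    ∃ mu : ℝ, mu ≠ 1 ∧ mu ≠ lam ∧ A = mu • R := by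
  obtain ⟨r, x, p, hr, hx, hRx⟩ := symm_rank_one_decomp n R hRs hR
  obtain ⟨b, y, _, hb, -, hB⟩ := symm_rank_one_decomp n _ (hAs.sub hRs) h1
  obtain ⟨s, z, _, -, -, hC⟩ := symm_rank_one_decomp n _ (hAs.sub (hRs.smul lam)) h2
  have hA : ∀ i j, A i j = b * y i * y j + r * x i * x j := by
    intro i j
    have := hB i j
    rw [Matrix.sub_apply, hRx] at this
    linarith
  have hD : ∀ i j, b * y i * y j + (1 - lam) * (r * x i * x j) = s * z i * z j := by
    intro i j
    have := hC i j
    rw [Matrix.sub_apply, Matrix.smul_apply, hRx, hA, smul_eq_mul] at this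
    linarith
  have hy : ∀ q, y q = y p / x p * x q := by
    intro q
    have e : (b * (1 - lam) * r) * (x p * y q - x q * y p) ^ 2 = 0 := by
      have e1 := hD p p
      have e2 := hD q q
      have e3 := hD p q
      have e4 : (b * y p * y p + (1 - lam) * (r * x p * x p)) *
          (b * y q * y q + (1 - lam) * (r * x q * x q)) =
          (b * y p * y q + (1 - lam) * (r * x p * x q)) ^ 2 := by
        rw [e1, e2, e3]; ring
      linear_combination e4
    have h3 : b * (1 - lam) * r ≠ 0 :=
      mul_ne_zero (mul_ne_zero hb (sub_ne_zero.2 hlam.symm)) hr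
    have h4 := pow_eq_zero_iff (two_ne_zero) |>.1 ((mul_eq_zero.1 e).resolve_left h3)
    field_simp
    linarith
  have hfin : A = (b * (y p / x p) ^ 2 / r + 1) • R := by
    ext i j
    rw [Matrix.smul_apply, hRx, hA, hy i, hy j, smul_eq_mul]
    generalize y p / x p = t
    field_simp
  refine ⟨_, ?_, ?_, hfin⟩
  · intro h
    rw [h, one_smul] at hfin
    rw [hfin, sub_self, Matrix.rank_zero] at h1
    exact zero_ne_one h1
  · intro h
    rw [h] at hfin
    rw [hfin, sub_self, Matrix.rank_zero] at h2
    exact zero_ne_one h2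
end

section
/- Let P be an n×n real idempotent matrix (P² = P) and let A, B be n×n real matrices such that P = A + B and rank(P) = rank(A) + rank(B). Then A and B are idempotents and A·B = B·A = 0. -/
open Matrix

theorem idem_aux (n : ℕ) (P A B : Matrix (Fin n) (Fin n) ℝ)
    (hP : P * P = P) (h : P = A + B) (hr : P.rank = A.rank + B.rank) :
    A * A = A ∧ B * A = 0 := by
  have hle : LinearMap.range P.mulVecLin ≤
      LinearMap.range A.mulVecLin ⊔ LinearMap.range B.mulVecLin := by
    rintro _ ⟨x, rfl⟩
    rw [h, Matrix.mulVecLin_add]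
    exact Submodule.add_mem_sup ⟨x, rfl⟩ ⟨x, rfl⟩
  have h1 := Submodule.finrank_mono hle
  have h2 := Submodule.finrank_sup_add_finrank_inf_eq
    (LinearMap.range A.mulVecLin) (LinearMap.range B.mulVecLin)
  unfold Matrix.rank at hr
  have heq := Submodule.eq_of_le_of_finrank_le hle (by omega)
  have hbot : LinearMap.range A.mulVecLin ⊓ LinearMap.range B.mulVecLin = ⊥ :=
    Submodule.finrank_eq_zero.mp (by omega)
  have hPA : P * A = A := by
    apply Matrix.ext_of_mulVec_single
    intro i
    have : A *ᵥ Pi.single i 1 ∈ LinearMap.range P.mulVecLin := by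
      rw [heq]; exact Submodule.mem_sup_left ⟨_, rfl⟩
    obtain ⟨y, hy⟩ := this
    simp only [Matrix.mulVecLin_apply] at hy
    rw [← Matrix.mulVec_mulVec, ← hy, Matrix.mulVec_mulVec, hP]
  have hBA' : B * A = A - A * A := by
    rw [eq_sub_iff_add_eq, add_comm, ← add_mul, ← h, hPA]
  have hBA : B * A = 0 := by
    apply Matrix.ext_of_mulVec_single
    intro i
    have hm : (B * A) *ᵥ Pi.single i 1 ∈
        LinearMap.range A.mulVecLin ⊓ LinearMap.range B.mulVecLin := by
      refine ⟨⟨Pi.single i 1 - A *ᵥ Pi.single i 1, ?_⟩, ⟨A *ᵥ Pi.single i 1, ?_⟩⟩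
      · rw [hBA', Matrix.mulVecLin_apply, Matrix.mulVec_sub, Matrix.sub_mulVec,
          Matrix.mulVec_mulVec]
      · rw [Matrix.mulVecLin_apply, Matrix.mulVec_mulVec]
    rw [hbot, Submodule.mem_bot] at hm
    rw [hm, Matrix.zero_mulVec]
  refine ⟨?_, hBA⟩
  rw [hBA] at hBA'
  exact (sub_eq_zero.mp hBA'.symm).symm

/-- If an idempotent `P` decomposes as `P = A + B` with
`rank P = rank A + rank B`, then `A` and `B` are idempotents with
`A * B = B * A = 0`. -/
theorem idempotent_rank_decomposition (n : ℕ) (P A B : Matrix (Fin n) (Fin n) ℝ)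
    (hP : P * P = P) (h : P = A + B) (hr : P.rank = A.rank + B.rank) :
    A * A = A ∧ B * B = B ∧ A * B = 0 ∧ B * A = 0 := by
  obtain ⟨h1, h2⟩ := idem_aux n P A B hP h hr
  obtain ⟨h3, h4⟩ := idem_aux n P B A hP (by rw [h, add_comm]) (by rw [hr, add_comm])
  exact ⟨h1, h3, h4, h2⟩
end

section
/- Let k, n be natural numbers with 3 ≤ k ≤ n. Let λ_1, …, λ_k be nonzero real numbers and let P_1, …, P_k ∈ S_n be mutually orthogonal rank-one projections (each P_i is symmetric with P_i² = P_i, rank(P_i) = 1, and P_i·P_j = 0 for i ≠ j). Set A = Σ_{j=1}^{k} λ_j·P_j. Let B ∈ S_n satisfy rank(B) = rank(A) = k, suppose B is adjacent to A − λ_i·P_i for every i = 1, …, k, and suppose d(B, λ_i·P_i) = k − 1 for every i. Then B = A. -/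
open Matrix

theorem rk1_decomp {n : ℕ} (M : Matrix (Fin n) (Fin n) ℝ) (h : M.rank = 1) :
    ∃ p q : Fin n → ℝ, M = vecMulVec p q := by
  unfold Matrix.rank at h
  obtain ⟨v, -, hv⟩ := finrank_eq_one_iff'.1 h
  have h2 : ∀ j, ∃ c : ℝ, c • (v : Fin n → ℝ) = M *ᵥ (Pi.single j 1) := by
    intro j
    obtain ⟨c, hc⟩ := hv ⟨M.mulVecLin (Pi.single j 1), LinearMap.mem_range_self _ _⟩
    exact ⟨c, by simpa using congrArg Subtype.val hc⟩
  choose q hq using h2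
  refine ⟨v, q, ?_⟩
  ext i j
  have := congrFun (hq j) i
  simp at this
  rw [vecMulVec_apply, ← this, mul_comm]

theorem vmv_bil {n : ℕ} (p q x y : Fin n → ℝ) :
    x ⬝ᵥ (vecMulVec p q *ᵥ y) = (x ⬝ᵥ p) * (q ⬝ᵥ y) := by
  rw [vecMulVec_mulVec]
  simp [mul_comm]

/-- Rigidity lemma: if `A = Σ λ_j P_j` with `P_j` mutually orthogonal rank-one
projections (`3 ≤ k ≤ n`, all `λ_j ≠ 0`), and `B ∈ S_n` has rank `k`, is
adjacent to `A - λ_i P_i` for all `i`, and `d(B, λ_i P_i) = k - 1` for all `i`,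
then `B = A`. -/
theorem rigidity_lemma (k n : ℕ) (hk : 3 ≤ k) (hkn : k ≤ n)
    (lam : Fin k → ℝ) (hlam : ∀ i, lam i ≠ 0)
    (P : Fin k → Matrix (Fin n) (Fin n) ℝ)
    (hPsym : ∀ i, (P i).IsSymm)
    (hPidem : ∀ i, P i * P i = P i)
    (hPrank : ∀ i, (P i).rank = 1)
    (hPorth : ∀ i j, i ≠ j → P i * P j = 0)
    (B : Matrix (Fin n) (Fin n) ℝ) (hBsym : B.IsSymm)
    (hArank : (∑ j, lam j • P j).rank = k) (hBrank : B.rank = k)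
    (hadj : ∀ i, (B - ((∑ j, lam j • P j) - lam i • P i)).rank = 1)
    (hd : ∀ i, (B - lam i • P i).rank = k - 1) :
    B = ∑ j, lam j • P j := by
  choose a b hab using fun i => rk1_decomp (P i) (hPrank i)
  choose p q hpq using fun i => rk1_decomp _ (hadj i)
  have hne : ∀ i, P i ≠ 0 := by
    intro i h
    have := hPrank i
    simp [h] at this
  have hba : ∀ i, b i ⬝ᵥ a i = 1 := by
    intro i
    have h := hPidem i
    have hn := hne i
    rw [hab i] at h hn
    rw [vecMulVec_mul_vecMulVec, vecMulVec_smul] at h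
    have h3 : ((b i ⬝ᵥ a i) - 1) • vecMulVec (a i) (b i) = 0 := by
      rw [sub_smul, one_smul, h, sub_self]
    rcases smul_eq_zero.1 h3 with h4 | h4
    · linarith
    · exact absurd h4 hn
  have hba0 : ∀ i j, i ≠ j → b i ⬝ᵥ a j = 0 := by
    intro i j hij
    have h := hPorth i j hij
    have hi := hne i
    have hj := hne j
    rw [hab i] at h hi
    rw [hab j] at h hj
    rw [vecMulVec_mul_vecMulVec, vecMulVec_smul] at h
    rcases smul_eq_zero.1 h with h4 | h4
    · exact h4
    · rcases vecMulVec_eq_zero.1 h4 with h5 | h5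
      · simp [h5] at hi
      · simp [h5] at hj
  obtain ⟨C, hC⟩ : ∃ C, C = B - ∑ j, lam j • P j := ⟨_, rfl⟩
  have E : ∀ i x y, x ⬝ᵥ (C *ᵥ y) + lam i * ((x ⬝ᵥ a i) * (b i ⬝ᵥ y))
      = (x ⬝ᵥ p i) * (q i ⬝ᵥ y) := by
    intro i x y
    rw [← vmv_bil, ← vmv_bil, ← hpq i, ← hab i]
    have : B - ((∑ j, lam j • P j) - lam i • P i) = C + lam i • P i := by
      rw [hC]; abel
    rw [this, add_mulVec, dotProduct_add, smul_mulVec, dotProduct_smul, smul_eq_mul]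
  have K : ∀ i j, i ≠ j → ∀ x y, x ⬝ᵥ a i = 0 → x ⬝ᵥ a j = 0 → b i ⬝ᵥ y = 0 →
      x ⬝ᵥ (C *ᵥ y) = 0 := by
    intro i j hij x y hxi hxj hy
    have e1 := E i x y
    have e2 := E i x (a i)
    have e3 := E i (b i) y
    have e4 := E i (b i) (a i)
    have f1 := E j x y
    have f2 := E j x (a i)
    have f3 := E j (b i) y
    have f4 := E j (b i) (a i)
    simp only [hxi, hxj, hy, hba, hba0 i j hij, mul_zero, zero_mul, add_zero, mul_one]
      at e1 e2 e3 e4 f1 f2 f3 f4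
    have g1 : (x ⬝ᵥ (C *ᵥ y)) * (b i ⬝ᵥ (C *ᵥ a i) + lam i)
        = (x ⬝ᵥ (C *ᵥ a i)) * (b i ⬝ᵥ (C *ᵥ y)) := by
      rw [e1, e2, e3, e4]; ring
    have g2 : (x ⬝ᵥ (C *ᵥ y)) * (b i ⬝ᵥ (C *ᵥ a i))
        = (x ⬝ᵥ (C *ᵥ a i)) * (b i ⬝ᵥ (C *ᵥ y)) := by
      rw [f1, f2, f3, f4]; ring
    have g3 : (x ⬝ᵥ (C *ᵥ y)) * lam i = 0 := by linarith
    exact (mul_eq_zero.1 g3).resolve_right (hlam i)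
  have K2 : ∀ i j, i ≠ j → ∀ x y, x ⬝ᵥ a i = 0 → x ⬝ᵥ a j = 0 →
      x ⬝ᵥ (C *ᵥ y) = 0 := by
    intro i j hij x y hxi hxj
    have h1 := K i j hij x (y - (b i ⬝ᵥ y) • a i) hxi hxj (by
      rw [dotProduct_sub, dotProduct_smul, hba]; simp)
    have h2 := K j i hij.symm x (a i) hxj hxi (hba0 j i hij.symm)
    rw [mulVec_sub, dotProduct_sub, mulVec_smul, dotProduct_smul, h2] at h1
    simpa using h1
  obtain ⟨i0, i1, i2, h01, h02, h12⟩ : ∃ i0 i1 i2 : Fin k, i0 ≠ i1 ∧ i0 ≠ i2 ∧ i1 ≠ i2 :=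
    ⟨⟨0, by omega⟩, ⟨1, by omega⟩, ⟨2, by omega⟩, by simp, by simp, by simp⟩
  have K3 : ∀ x y, x ⬝ᵥ (C *ᵥ y) = 0 := by
    intro x y
    have h1 := K2 i0 i1 h01 (x - (x ⬝ᵥ a i0) • b i0 - (x ⬝ᵥ a i1) • b i1) y
      (by simp [sub_dotProduct, smul_dotProduct, hba, hba0 _ _ h01.symm])
      (by simp [sub_dotProduct, smul_dotProduct, hba, hba0 _ _ h01])
    have h2 := K2 i1 i2 h12 (b i0) y (hba0 _ _ h01) (hba0 _ _ h02)
    have h3 := K2 i0 i2 h02 (b i1) y (hba0 _ _ h01.symm) (hba0 _ _ h12)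
    rw [sub_dotProduct, sub_dotProduct, smul_dotProduct, smul_dotProduct, h2, h3] at h1
    simpa using h1
  have hC0 : C = 0 := by
    ext i j
    have := K3 (Pi.single i 1) (Pi.single j 1)
    simpa using this
  exact sub_eq_zero.1 (hC ▸ hC0)
end

section
/- Let A, B ∈ S_n with rank(A) = 1. If rank(A + λ·B) = 1 for every λ ∈ ℝ, then B = 0. -/
open Matrix

theorem minor_aux {n : ℕ} (M : Matrix (Fin n) (Fin n) ℝ) (h : M.rank = 1) (i j k l : Fin n) :
    M i j * M k l = M i l * M k j := by
  rw [Matrix.rank_eq_finrank_span_cols] at h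
  obtain ⟨v, -, hv⟩ := finrank_eq_one_iff'.1 h
  have key : ∀ j, ∃ c : ℝ, ∀ i, M i j = c * v.1 i := by
    intro j
    obtain ⟨c, hc⟩ := hv ⟨M.col j, Submodule.subset_span ⟨j, rfl⟩⟩
    refine ⟨c, fun i => ?_⟩
    have := congrFun (congrArg Subtype.val hc) i
    simpa using this.symm
  obtain ⟨c, hc⟩ := key j
  obtain ⟨d, hd⟩ := key l
  rw [hc, hc, hd, hd]; ring

/-- If `rank A = 1` and `rank (A + λ B) = 1` for every `λ ∈ ℝ`, then `B = 0`. -/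
theorem rank_one_pencil (n : ℕ) (A B : Matrix (Fin n) (Fin n) ℝ)
    (hA : A.IsSymm) (hB : B.IsSymm) (hrA : A.rank = 1)
    (h : ∀ lam : ℝ, (A + lam • B).rank = 1) :
    B = 0 := by
  have m0 := minor_aux A hrA
  have m1 := minor_aux _ (h 1)
  have m2 := minor_aux _ (h (-1))
  simp only [Matrix.add_apply, Matrix.smul_apply, smul_eq_mul] at m1 m2
  have mB : ∀ i j k l, B i j * B k l = B i l * B k j := fun i j k l => by
    linarith [m0 i j k l, m1 i j k l, m2 i j k l]
  have mL : ∀ i j k l, A i j * B k l + B i j * A k l = A i l * B k j + B i l * A k j :=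
    fun i j k l => by linarith [m0 i j k l, m1 i j k l, m2 i j k l]
  obtain ⟨p, hp⟩ : ∃ p, A p p ≠ 0 := by
    by_contra! hc
    have : A = 0 := by
      ext i j
      have h1 := m0 i j j i
      rw [hA.apply i j, hc i, zero_mul] at h1
      simpa using h1
    simp [this] at hrA
  obtain ⟨c, hc⟩ : ∃ c, B p p = c * A p p := ⟨B p p / A p p, by field_simp⟩
  have hip : ∀ i, B i p = c * A i p := by
    intro i
    have h1 := mB i p p i
    have h2 := mL i p p i
    have h3 := m0 i p p i
    rw [hA.apply i p] at h2 h3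
    rw [hB.apply i p] at h1 h2
    rw [hc] at h1 h2
    have : (B i p - c * A i p) ^ 2 = 0 := by
      linear_combination h1 - c * h2 + c ^ 2 * h3
    have := pow_eq_zero_iff (two_ne_zero) |>.1 this
    linarith
  have hall : ∀ i j, B i j = c * A i j := by
    intro i j
    have h2 := mL p p i j
    have h3 := m0 p p i j
    have h4 : B p j = c * A p j := by
      have e := hip j
      rwa [hB.apply p j, hA.apply p j] at e
    rw [h4, hip i, hc] at h2
    apply mul_left_cancel₀ hp
    linear_combination h2 - 2 * c * h3
  by_cases hc0 : c = 0
  · ext i j; simp [hall, hc0]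
  · have h0 : A + (-c⁻¹) • B = 0 := by
      ext i j
      simp [hall, hc0]
    have := h (-c⁻¹)
    rw [h0, Matrix.rank_zero] at this
    exact absurd this zero_ne_one
end

section
/- Let n ≥ 2 and let A, B ∈ S_n both have rank n, with A ≠ B. Then there exist a natural number k and invertible matrices A_0 = A, A_1, …, A_k = B in S_n such that consecutive matrices A_j, A_{j+1} are adjacent, and for each j = 0, …, k−1 there is a matrix C_j on the line l(A_j, A_{j+1}) with rank(C_j) = n − 1. -/
open Matrix

/-- One admissible step of a chain. -/
def ChainStep (n : ℕ) (A B : Matrix (Fin n) (Fin n) ℝ) : Prop :=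
  A.IsSymm ∧ B.IsSymm ∧ IsUnit A ∧ IsUnit B ∧ (A - B).rank = 1 ∧
    ∃ lam : ℝ, (A + lam • (B - A)).rank = n - 1

lemma ChainStep.symm' {n : ℕ} {A B : Matrix (Fin n) (Fin n) ℝ} (h : ChainStep n A B) :
    ChainStep n B A := by
  obtain ⟨h1, h2, h3, h4, h5, lam, h6⟩ := h
  refine ⟨h2, h1, h4, h3, ?_, 1 - lam, ?_⟩
  · have : B - A = (A - B) * (-1) := by simp
    rw [← h5, this, rank_mul_eq_left_of_isUnit_det]
    exact (isUnit_iff_isUnit_det _).1 isUnit_one.neg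
  · rw [← h6]
    congr 1
    module

lemma ChainStep.congr' {n : ℕ} {A B : Matrix (Fin n) (Fin n) ℝ} (U : Matrix (Fin n) (Fin n) ℝ)
    (hU : IsUnit U) (h : ChainStep n A B) : ChainStep n (U * A * Uᵀ) (U * B * Uᵀ) := by
  obtain ⟨h1, h2, h3, h4, h5, lam, h6⟩ := h
  have hUt : IsUnit Uᵀ := (Matrix.isUnit_transpose U).2 hU
  have hr : ∀ M : Matrix (Fin n) (Fin n) ℝ, (U * M * Uᵀ).rank = M.rank := fun M => by
    rw [rank_mul_eq_left_of_isUnit_det _ _ ((isUnit_iff_isUnit_det _).1 hUt),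
      rank_mul_eq_right_of_isUnit_det _ _ ((isUnit_iff_isUnit_det _).1 hU)]
  have hs : ∀ M : Matrix (Fin n) (Fin n) ℝ, M.IsSymm → (U * M * Uᵀ).IsSymm := fun M hM => by
    unfold Matrix.IsSymm
    rw [transpose_mul, transpose_mul, transpose_transpose, hM.eq, Matrix.mul_assoc]
  refine ⟨hs _ h1, hs _ h2, (hU.mul h3).mul hUt, (hU.mul h4).mul hUt, ?_, lam, ?_⟩
  · rw [← h5, ← hr (A - B), Matrix.mul_sub, Matrix.sub_mul]
  · rw [← h6, ← hr (A + _)]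
    simp only [Matrix.mul_sub, Matrix.sub_mul, Matrix.mul_add, Matrix.add_mul, Matrix.mul_smul,
      Matrix.smul_mul]

lemma chainStep_diagonal {n : ℕ} (d : Fin n → ℝ) (hd : ∀ i, d i ≠ 0) (a : Fin n) (ha : d a ≠ 1) :
    ChainStep n (diagonal d) (diagonal (Function.update d a 1)) := by
  classical
  have hu : ∀ e : Fin n → ℝ, (∀ i, e i ≠ 0) → IsUnit (diagonal e) := fun e he => by
    rw [isUnit_diagonal, Pi.isUnit_iff]
    exact fun i => (he i).isUnit
  refine ⟨isSymm_diagonal _, isSymm_diagonal _, hu _ hd, hu _ ?_, ?_, d a / (d a - 1), ?_⟩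
  · intro i
    by_cases h : i = a
    · subst h; simp
    · simpa [h] using hd i
  · rw [diagonal_sub, rank_diagonal, Fintype.card_subtype]
    have : (Finset.univ.filter fun i => d i - Function.update d a 1 i ≠ 0) = {a} := by
      ext i
      by_cases h : i = a
      · subst h; simp [sub_eq_zero, ha]
      · simp [h]
    rw [this]; simp
  · rw [diagonal_sub, ← diagonal_smul, diagonal_add, rank_diagonal, Fintype.card_subtype]
    have : (Finset.univ.filter fun i => d i +
        ((d a / (d a - 1)) • fun i => Function.update d a 1 i - d i) i ≠ 0) =
        Finset.univ.erase a := by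
      ext i
      by_cases h : i = a
      · subst h
        have : d i - 1 ≠ 0 := sub_ne_zero.2 ha
        simp
        field_simp
        ring
      · simp [h, hd i]
    rw [this]; simp

lemma chain_diagonal {n : ℕ} (d : Fin n → ℝ) (hd : ∀ i, d i ≠ 0) (s : Finset (Fin n)) :
    Relation.ReflTransGen (ChainStep n) (diagonal d)
      (diagonal fun i => if i ∈ s then 1 else d i) := by
  classical
  induction s using Finset.induction_on with
  | empty => simpa using Relation.ReflTransGen.refl
  | insert a s ha ih =>
    have he : (fun i => if i ∈ insert a s then 1 else d i) =
        Function.update (fun i => if i ∈ s then 1 else d i) a 1 := by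
      ext i
      by_cases h : i = a
      · subst h; simp
      · simp [h]
    rw [he]
    by_cases h1 : d a = 1
    · have : Function.update (fun i => if i ∈ s then 1 else d i) a 1 =
          (fun i => if i ∈ s then 1 else d i) := by
        rw [Function.update_eq_self_iff]; simp [ha, h1]
      rw [this]; exact ih
    · refine ih.tail (chainStep_diagonal _ ?_ a (by simpa [ha] using h1))
      intro i
      split_ifs
      · exact one_ne_zero
      · exact hd i

lemma chain_to_one {n : ℕ} (A : Matrix (Fin n) (Fin n) ℝ) (hA : A.IsSymm) (hu : IsUnit A) :
    Relation.ReflTransGen (ChainStep n) A 1 := by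
  have hH : A.IsHermitian := by
    unfold Matrix.IsHermitian
    rw [conjTranspose_eq_transpose_of_trivial]; exact hA
  set U : Matrix (Fin n) (Fin n) ℝ := (hH.eigenvectorUnitary : Matrix (Fin n) (Fin n) ℝ) with hUdef
  have hUU : U * Uᵀ = 1 := by
    have := Unitary.coe_mul_star_self hH.eigenvectorUnitary
    rwa [Unitary.coe_star, star_eq_conjTranspose, conjTranspose_eq_transpose_of_trivial] at this
  have hUu : IsUnit U := IsUnit.of_mul_eq_one _ hUU
  have hsp : A = U * diagonal hH.eigenvalues * Uᵀ := by
    have := hH.spectral_theorem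
    rw [Unitary.conjStarAlgAut_apply, star_eq_conjTranspose,
      conjTranspose_eq_transpose_of_trivial] at this
    exact this
  have hd : ∀ i, hH.eigenvalues i ≠ 0 := by
    have h := (isUnit_iff_isUnit_det _).1 hu
    rw [hsp, det_mul, det_mul, det_diagonal] at h
    have h2 := (IsUnit.mul_iff.1 (IsUnit.mul_iff.1 h).1).2.ne_zero
    rw [Finset.prod_ne_zero_iff] at h2
    exact fun i => h2 i (Finset.mem_univ _)
  have h := chain_diagonal hH.eigenvalues hd Finset.univ
  have h' := Relation.ReflTransGen.lift (p := ChainStep n) (fun M => U * M * Uᵀ)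
    (fun _ _ hab => ChainStep.congr' U hUu hab) _ _ h
  simp only [Function.onFun, Finset.mem_univ, if_true, diagonal_one, mul_one, hUU] at h'
  rw [← hsp] at h'
  exact h'

lemma isUnit_of_rank_eq' {n : ℕ} (A : Matrix (Fin n) (Fin n) ℝ) (h : A.rank = n) : IsUnit A := by
  rw [← Matrix.mulVec_surjective_iff_isUnit]
  have : LinearMap.range A.mulVecLin = ⊤ := Submodule.eq_top_of_finrank_eq (by
    rw [Module.finrank_fin_fun]; exact h)
  exact LinearMap.range_eq_top.1 this

/-- Two distinct full-rank matrices in `S_n` (`n ≥ 2`) can be connected by a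
chain of consecutively adjacent invertible matrices such that every connecting
line contains a matrix of rank `n - 1`. -/
theorem chain_of_invertibles (n : ℕ) (hn : 2 ≤ n)
    (A B : Matrix (Fin n) (Fin n) ℝ) (hAs : A.IsSymm) (hBs : B.IsSymm)
    (hAr : A.rank = n) (hBr : B.rank = n) (hAB : A ≠ B) :
    ∃ (k : ℕ) (f : Fin (k + 1) → Matrix (Fin n) (Fin n) ℝ),
      f 0 = A ∧ f (Fin.last k) = B ∧
      (∀ j, (f j).IsSymm) ∧ (∀ j, IsUnit (f j)) ∧
      ∀ j : Fin k,
        (f j.castSucc - f j.succ).rank = 1 ∧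
        ∃ lam : ℝ,
          (f j.castSucc + lam • (f j.succ - f j.castSucc)).rank = n - 1 := by
  have hAu := isUnit_of_rank_eq' A hAr
  have hBu := isUnit_of_rank_eq' B hBr
  have : Std.Symm (ChainStep n) := ⟨fun _ _ h => h.symm'⟩
  have hch : Relation.ReflTransGen (ChainStep n) A B :=
    (chain_to_one A hAs hAu).trans
      ((Relation.ReflTransGen.stdSymm (r := ChainStep n)).symm _ _ (chain_to_one B hBs hBu))
  clear hAr hAB hAs hAu
  induction hch using Relation.ReflTransGen.head_induction_on with
  | refl => exact ⟨0, fun _ => B, rfl, rfl, fun _ => hBs, fun _ => hBu, fun j => j.elim0⟩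
  | @head a c hac _ ih =>
    obtain ⟨k, f, h0, hl, hs, hu, hst⟩ := ih
    obtain ⟨g1, g2, g3, g4, g5, g6⟩ := hac
    refine ⟨k + 1, Fin.cons a f, rfl, ?_, ?_, ?_, ?_⟩
    · rw [← Fin.succ_last, Fin.cons_succ, hl]
    · intro j
      refine Fin.cases ?_ (fun i => ?_) j
      · exact g1
      · exact hs i
    · intro j
      refine Fin.cases ?_ (fun i => ?_) j
      · exact g3
      · exact hu i
    · intro j
      refine Fin.cases ?_ (fun i => ?_) j
      · rw [Fin.castSucc_zero, Fin.cons_zero, Fin.cons_succ, h0]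
        exact ⟨g5, g6⟩
      · rw [← Fin.succ_castSucc, Fin.cons_succ, Fin.cons_succ]
        exact hst i
end

section
/- Let Φ : S_n → S_m be an adjacency preserving map and let A, B ∈ S_n be adjacent. Then Φ maps the line l(A,B) into the line l(Φ(A), Φ(B)), and the restriction of Φ to l(A,B) is injective. -/
open Matrix

lemma aux_form {m : ℕ} (M : Matrix (Fin m) (Fin m) ℝ) (h : M.rank = 1) :
    ∃ u w : Fin m → ℝ, ∀ i j, M i j = u i * w j := by
  unfold Matrix.rank at h
  obtain ⟨v, -, hv⟩ := finrank_eq_one_iff'.1 h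
  choose c hc using hv
  refine ⟨v.1, fun j => c ⟨M.mulVecLin (Pi.single j 1), LinearMap.mem_range_self _ _⟩, ?_⟩
  intro i j
  have h1 := congrArg (fun x => x.1 i) (hc ⟨M.mulVecLin (Pi.single j 1), LinearMap.mem_range_self _ _⟩)
  simp at h1
  rw [← h1]
  simp [mul_comm]

lemma aux_symm {m : ℕ} (M : Matrix (Fin m) (Fin m) ℝ) (hs : M.IsSymm) (h : M.rank = 1) :
    ∃ (a : ℝ) (u : Fin m → ℝ) (k : Fin m), a ≠ 0 ∧ u k ≠ 0 ∧ ∀ i j, M i j = a * (u i * u j) := by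
  obtain ⟨u, w, huw⟩ := aux_form M h
  have hne : M ≠ 0 := by
    rintro rfl
    simp at h
  have : ∃ k, u k ≠ 0 := by
    by_contra! hu
    exact hne (by ext i j; simp [huw, hu])
  obtain ⟨k, hk⟩ := this
  have hw : ∀ j, w j = w k / u k * u j := by
    intro j
    have h2 := hs.apply k j
    rw [huw, huw] at h2
    field_simp
    linarith
  have hM : ∀ i j, M i j = w k / u k * (u i * u j) := by
    intro i j
    rw [huw, hw j]; ring
  refine ⟨w k / u k, u, k, ?_, hk, hM⟩
  intro h0
  exact hne (by ext i j; simp [hM, h0])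

lemma aux_col {m : ℕ} (P Q : Matrix (Fin m) (Fin m) ℝ) (hP : P.IsSymm) (hQ : Q.IsSymm)
    (h1 : P.rank = 1) (h2 : Q.rank = 1) (h3 : (Q - P).rank = 1) : ∃ mu : ℝ, Q = mu • P := by
  obtain ⟨a, u, k, ha, hk, hPf⟩ := aux_symm P hP h1
  obtain ⟨b, v, -, hb, -, hQf⟩ := aux_symm Q hQ h2
  obtain ⟨x, y, hxy⟩ := aux_form _ h3
  have key : ∀ i, u i * v k = u k * v i := by
    intro i
    have e1 := hxy i i
    have e2 := hxy i k
    have e3 := hxy k i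
    have e4 := hxy k k
    simp only [Matrix.sub_apply, hPf, hQf] at e1 e2 e3 e4
    have e5 : (a * b) * (u i * v k - u k * v i) ^ 2 = 0 := by
      have : (b * (v i * v i) - a * (u i * u i)) * (b * (v k * v k) - a * (u k * u k))
        = (b * (v i * v k) - a * (u i * u k)) * (b * (v k * v i) - a * (u k * u i)) := by
        rw [e1, e2, e3, e4]; ring
      linear_combination -this
    have e6 := (mul_eq_zero.1 e5).resolve_left (mul_ne_zero ha hb)
    exact sub_eq_zero.1 (pow_eq_zero_iff (two_ne_zero) |>.1 e6)
  have hv : ∀ i, v i = v k / u k * u i := by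
    intro i
    have := key i
    field_simp
    linarith
  refine ⟨b * (v k / u k) ^ 2 / a, ?_⟩
  ext i j
  rw [Matrix.smul_apply, hQf, hPf, hv i, hv j, smul_eq_mul]
  field_simp

/-- An adjacency preserving map sends the line `l(A,B)` into the line
`l(Φ(A), Φ(B))`, injectively. -/
theorem line_to_line (n m : ℕ)
    (Φ : Matrix (Fin n) (Fin n) ℝ → Matrix (Fin m) (Fin m) ℝ)
    (hΦsym : ∀ A : Matrix (Fin n) (Fin n) ℝ, A.IsSymm → (Φ A).IsSymm)
    (hΦadj : ∀ A B : Matrix (Fin n) (Fin n) ℝ, A.IsSymm → B.IsSymm →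
      (A - B).rank = 1 → (Φ A - Φ B).rank = 1)
    (A B : Matrix (Fin n) (Fin n) ℝ) (hAs : A.IsSymm) (hBs : B.IsSymm)
    (hadj : (A - B).rank = 1) :
    (∀ lam : ℝ, ∃ mu : ℝ,
      Φ (A + lam • (B - A)) = Φ A + mu • (Φ B - Φ A)) ∧
    (∀ lam1 lam2 : ℝ,
      Φ (A + lam1 • (B - A)) = Φ (A + lam2 • (B - A)) → lam1 = lam2) := by
  have hsym : ∀ t : ℝ, (A + t • (B - A)).IsSymm := fun t => hAs.add ((hBs.sub hAs).smul t)
  have hr : ∀ s t : ℝ, s ≠ t →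
      (Φ (A + s • (B - A)) - Φ (A + t • (B - A))).rank = 1 := by
    intro s t hst
    apply hΦadj _ _ (hsym s) (hsym t)
    have e : A + s • (B - A) - (A + t • (B - A)) = (t - s) • (A - B) := by
      module
    rw [e, Matrix.rank_smul_of_mem_nonZeroDivisors _
      (mem_nonZeroDivisors_of_ne_zero (sub_ne_zero.2 hst.symm)), hadj]
  have z0 : A + (0:ℝ) • (B - A) = A := by simp
  have z1 : A + (1:ℝ) • (B - A) = B := by simp
  constructor
  · intro t
    by_cases h0 : t = 0
    · exact ⟨0, by simp [h0]⟩
    by_cases h1 : t = 1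
    · exact ⟨1, by simp [h1]⟩
    have r1 := hr 1 0 one_ne_zero
    have r2 := hr t 0 h0
    have r3 := hr t 1 h1
    rw [z0] at r1 r2
    rw [z1] at r1 r3
    obtain ⟨mu, hmu⟩ := aux_col (Φ B - Φ A) (Φ (A + t • (B - A)) - Φ A)
      ((hΦsym _ hBs).sub (hΦsym _ hAs)) ((hΦsym _ (hsym t)).sub (hΦsym _ hAs)) r1 r2
      (by rw [sub_sub_sub_cancel_right]; exact r3)
    exact ⟨mu, by rw [← hmu]; abel⟩
  · intro s t hst
    by_contra hne
    have := hr s t hne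
    rw [hst, sub_self, Matrix.rank_zero] at this
    exact zero_ne_one this
end

section
/- Let n ≥ 2 and let Φ : S_n → S_m be a map preserving adjacency with Φ(0) = 0. Let k be a natural number with k ≥ 2 such that rank(Φ(A)) ≤ k for every invertible A ∈ S_n, with equality rank(Φ(A)) = k for at least one invertible A ∈ S_n. Assume moreover that rank(Φ(A)) < k for every singular A ∈ S_n. Then rank(Φ(B)) = k for every invertible B ∈ S_n. -/
open Matrix

lemma sym_rank_one {m : ℕ} (E : Matrix (Fin m) (Fin m) ℝ) (hE : E.IsSymm) (h : E.rank = 1) :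
    ∃ (a : ℝ) (u : Fin m → ℝ), a ≠ 0 ∧ u ≠ 0 ∧ ∀ i j, E i j = a * u i * u j := by
  rw [Matrix.rank, finrank_eq_one_iff'] at h
  obtain ⟨⟨u, hu⟩, hne, hs⟩ := h
  have hu0 : u ≠ 0 := fun h0 => hne (by simpa using h0)
  have hcol : ∀ j, ∃ c : ℝ, ∀ i, E i j = c * u i := by
    intro j
    obtain ⟨c, hc⟩ := hs ⟨E *ᵥ Pi.single j 1, ⟨_, rfl⟩⟩
    refine ⟨c, fun i => ?_⟩
    have h1 := congrFun (congrArg Subtype.val hc) i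
    simp at h1
    exact h1.symm
  choose v hv using hcol
  obtain ⟨j, hj⟩ := Function.ne_iff.mp hu0
  simp only [Pi.zero_apply] at hj
  have hv' : ∀ i, v i = (v j / u j) * u i := by
    intro i
    have h1 := hE.apply i j
    rw [hv i j, hv j i] at h1
    field_simp
    linarith
  refine ⟨v j / u j, u, ?_, hu0, fun i l => ?_⟩
  · intro h0
    obtain ⟨w, hw⟩ := hu
    have hz : E = 0 := by
      ext i l
      rw [hv l i, hv' l, h0]; simp
    rw [hz] at hw
    exact hu0 (by rw [← hw]; simp)
  · rw [hv l i, hv' l]; ring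

lemma core_s10 {m : ℕ} (X Y D : Matrix (Fin m) (Fin m) ℝ) (hX : X.IsSymm) (hY : Y.IsSymm)
    (hD : D.IsSymm) (h1 : (X - D).rank = 1) (h2 : (Y - D).rank = 1) (h3 : (X - Y).rank = 1)
    (hlt : D.rank < X.rank) : X.rank ≤ Y.rank := by
  obtain ⟨a, u, ha, hu, hE⟩ := sym_rank_one _ (hX.sub hD) h1
  obtain ⟨b, w, hb, hw, hF⟩ := sym_rank_one _ (hY.sub hD) h2
  obtain ⟨c, z, hc, hz, hG⟩ := sym_rank_one _ (hX.sub hY) h3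
  simp only [Matrix.sub_apply] at hE hF hG
  have hrel : ∀ i j, a * u i * u j - b * w i * w j = c * z i * z j := by
    intro i j; rw [← hE, ← hF, ← hG]; ring
  have hpar : ∀ i j, u i * w j = u j * w i := by
    intro i j
    have e : a * b * (u i * w j - u j * w i) ^ 2 = 0 := by
      have e1 := hrel i i
      have e2 := hrel j j
      have e3 := hrel i j
      have : -(a * b * (u i * w j - u j * w i) ^ 2) =
        (a * u i * u i - b * w i * w i) * (a * u j * u j - b * w j * w j)
          - (a * u i * u j - b * w i * w j) ^ 2 := by ring
      rw [e1, e2, e3] at this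
      linear_combination -this
    have := (mul_eq_zero.mp e).resolve_left (mul_ne_zero ha hb)
    exact sub_eq_zero.mp (pow_eq_zero_iff (two_ne_zero) |>.mp this)
  obtain ⟨j, hj⟩ := Function.ne_iff.mp hu
  simp only [Pi.zero_apply] at hj
  set l := w j / u j with hl
  have hwl : ∀ i, w i = l * u i := by
    intro i
    have := hpar i j
    rw [hl]; field_simp; linarith
  have hl0 : l ≠ 0 := by
    intro h0
    apply hw
    ext i
    rw [hwl, h0]; simp
  have hXv : ∀ v, X *ᵥ v = D *ᵥ v + (a * (u ⬝ᵥ v)) • u := by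
    intro v; ext i
    simp only [mulVec, dotProduct, Pi.add_apply, Pi.smul_apply, smul_eq_mul, Finset.mul_sum,
      Finset.sum_mul, ← Finset.sum_add_distrib]
    refine Finset.sum_congr rfl fun x _ => ?_
    linear_combination v x * hE i x
  have hYv : ∀ v, Y *ᵥ v = D *ᵥ v + (b * l ^ 2 * (u ⬝ᵥ v)) • u := by
    intro v; ext i
    simp only [mulVec, dotProduct, Pi.add_apply, Pi.smul_apply, smul_eq_mul, Finset.mul_sum,
      Finset.sum_mul, ← Finset.sum_add_distrib]
    refine Finset.sum_congr rfl fun x _ => ?_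
    have := hF i x
    rw [hwl i, hwl x] at this
    linear_combination v x * this
  have hex : ∃ p, D *ᵥ p = 0 ∧ u ⬝ᵥ p ≠ 0 := by
    by_contra! hcon
    have hker : LinearMap.ker D.mulVecLin ≤ LinearMap.ker X.mulVecLin := by
      intro p hp
      simp only [LinearMap.mem_ker, mulVecLin_apply] at hp ⊢
      rw [hXv, hp, hcon p hp]; simp
    have i1 := Submodule.finrank_mono hker
    have i2 := LinearMap.finrank_range_add_finrank_ker D.mulVecLin
    have i3 := LinearMap.finrank_range_add_finrank_ker X.mulVecLin
    unfold Matrix.rank at hlt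
    omega
  obtain ⟨p, hp, hup⟩ := hex
  apply Submodule.finrank_mono
  rintro _ ⟨q, rfl⟩
  refine ⟨q + ((a - b * l ^ 2) * (u ⬝ᵥ q) / (b * l ^ 2 * (u ⬝ᵥ p))) • p, ?_⟩
  simp only [mulVecLin_apply]
  rw [hXv, hYv, mulVec_add, mulVec_smul, hp, dotProduct_add, dotProduct_smul]
  simp only [smul_zero, add_zero, smul_eq_mul]
  congr 2
  field_simp
  ring

lemma conj_isUnit {n : ℕ} (U V : Matrix (Fin n) (Fin n) ℝ) (hU : IsUnit U.det)
    (hV : IsUnit V.det) (d : Fin n → ℝ) : IsUnit (U * diagonal d * V) ↔ ∀ i, d i ≠ 0 := by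
  rw [Matrix.isUnit_iff_isUnit_det, det_mul, det_mul, IsUnit.mul_iff, IsUnit.mul_iff]
  simp [hU.ne_zero, hV.ne_zero, det_diagonal, Finset.prod_ne_zero_iff]

lemma conj_rank {n : ℕ} (U V : Matrix (Fin n) (Fin n) ℝ) (hU : IsUnit U.det)
    (hV : IsUnit V.det) (d : Fin n → ℝ) (i : Fin n) (x y : ℝ) (hxy : x ≠ y) :
    (U * diagonal (Function.update d i x) * V
      - U * diagonal (Function.update d i y) * V).rank = 1 := by
  rw [← sub_mul, ← mul_sub, rank_mul_eq_left_of_isUnit_det _ _ hV,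
    rank_mul_eq_right_of_isUnit_det _ _ hU, diagonal_sub, rank_diagonal, Fintype.card_eq_one_iff]
  refine ⟨⟨i, by simpa [sub_eq_zero] using hxy⟩, ?_⟩
  rintro ⟨j, hj⟩
  by_contra hne
  have : j ≠ i := fun h => hne (by simp [h])
  simp [this] at hj

/-- If `k ≥ 2` is the maximal value of `rank (Φ A)` over invertible `A ∈ S_n`
and `rank (Φ A) < k` for every singular `A ∈ S_n`, then `rank (Φ B) = k` for
every invertible `B ∈ S_n`. -/
theorem constant_rank_on_invertibles (n m : ℕ) (hn : 2 ≤ n)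
    (Φ : Matrix (Fin n) (Fin n) ℝ → Matrix (Fin m) (Fin m) ℝ)
    (hΦsym : ∀ A : Matrix (Fin n) (Fin n) ℝ, A.IsSymm → (Φ A).IsSymm)
    (hΦadj : ∀ A B : Matrix (Fin n) (Fin n) ℝ, A.IsSymm → B.IsSymm →
      (A - B).rank = 1 → (Φ A - Φ B).rank = 1)
    (hΦ0 : Φ 0 = 0)
    (k : ℕ) (hk : 2 ≤ k)
    (hle : ∀ A : Matrix (Fin n) (Fin n) ℝ, A.IsSymm → IsUnit A → (Φ A).rank ≤ k)
    (hex : ∃ A : Matrix (Fin n) (Fin n) ℝ, A.IsSymm ∧ IsUnit A ∧ (Φ A).rank = k)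
    (hsing : ∀ A : Matrix (Fin n) (Fin n) ℝ, A.IsSymm → ¬IsUnit A → (Φ A).rank < k) :
    ∀ B : Matrix (Fin n) (Fin n) ℝ, B.IsSymm → IsUnit B → (Φ B).rank = k := by
  have sym : ∀ (U : Matrix (Fin n) (Fin n) ℝ) d, (U * diagonal d * Uᵀ).IsSymm := by
    intro U d
    simp [Matrix.IsSymm, transpose_mul, Matrix.mul_assoc]
  have step : ∀ (U : Matrix (Fin n) (Fin n) ℝ), IsUnit U.det → ∀ (d : Fin n → ℝ) (i : Fin n)
      (x y : ℝ), (∀ j, Function.update d i x j ≠ 0) → (∀ j, Function.update d i y j ≠ 0) →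
      (Φ (U * diagonal (Function.update d i x) * Uᵀ)).rank = k →
      (Φ (U * diagonal (Function.update d i y) * Uᵀ)).rank = k := by
    intro U hU d i x y hx hy h
    by_cases hxy : x = y
    · rw [← hxy]; exact h
    have hV : IsUnit (Uᵀ).det := by rwa [det_transpose]
    have hx0 : x ≠ 0 := by simpa using hx i
    have hy0 : y ≠ 0 := by simpa using hy i
    have hS := hsing (U * diagonal (Function.update d i 0) * Uᵀ) (sym _ _) (by
      rw [conj_isUnit U _ hU hV]
      intro hh
      exact hh i (by simp))
    refine le_antisymm (hle _ (sym _ _) ((conj_isUnit U _ hU hV _).2 hy)) ?_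
    rw [← h]
    refine core_s10 _ _ _ (hΦsym _ (sym _ _)) (hΦsym _ (sym _ _)) (hΦsym _ (sym _ _))
      (hΦadj _ _ (sym _ _) (sym _ _) (conj_rank U _ hU hV d i x 0 hx0))
      (hΦadj _ _ (sym _ _) (sym _ _) (conj_rank U _ hU hV d i y 0 hy0))
      (hΦadj _ _ (sym _ _) (sym _ _) (conj_rank U _ hU hV d i x y hxy)) ?_
    rw [h]; exact hS
  have step' : ∀ (U : Matrix (Fin n) (Fin n) ℝ), IsUnit U.det → ∀ (d : Fin n → ℝ),
      (∀ j, d j ≠ 0) → ∀ s : Finset (Fin n), ((Φ (U * diagonal d * Uᵀ)).rank = k ↔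
      (Φ (U * diagonal (fun i => if i ∈ s then 1 else d i) * Uᵀ)).rank = k) := by
    intro U hU d hd s
    induction s using Finset.induction_on with
    | empty => simp
    | insert i s hi ih =>
      rw [ih]
      set e : Fin n → ℝ := fun j => if j ∈ s then 1 else d j with he
      have he0 : ∀ j, e j ≠ 0 := by
        intro j; simp only [he]; split_ifs
        · exact one_ne_zero
        · exact hd j
      have e1 : (fun j => if j ∈ insert i s then (1:ℝ) else d j) = Function.update e i 1 := by
        ext j
        by_cases hj : j = i
        · subst hj; simp
        · simp [hj, he]
      have e2 : e = Function.update e i (e i) := by simp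
      have n1 : ∀ j, Function.update e i 1 j ≠ 0 := by
        intro j
        by_cases hj : j = i
        · subst hj; simp
        · simpa [hj] using he0 j
      have n2 : ∀ j, Function.update e i (e i) j ≠ 0 := by
        rw [← e2]; exact he0
      rw [e1]
      constructor
      · intro h
        exact step U hU e i (e i) 1 n2 n1 (by rw [← e2]; exact h)
      · intro h
        have := step U hU e i 1 (e i) n1 n2 h
        rwa [← e2] at this
  have key : ∀ A : Matrix (Fin n) (Fin n) ℝ, A.IsSymm → IsUnit A →
      ((Φ A).rank = k ↔ (Φ 1).rank = k) := by
    intro A hA hu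
    have hH : A.IsHermitian := by
      rw [Matrix.IsHermitian, conjTranspose_eq_transpose_of_trivial]; exact hA
    have hs := hH.spectral_theorem
    rw [Unitary.conjStarAlgAut_apply] at hs
    set U : Matrix (Fin n) (Fin n) ℝ := (hH.eigenvectorUnitary).1 with hUdef
    have hUU : U * Uᵀ = 1 := by
      have := Unitary.mul_star_self_of_mem hH.eigenvectorUnitary.2
      rwa [star_eq_conjTranspose, conjTranspose_eq_transpose_of_trivial] at this
    have hst : star (hH.eigenvectorUnitary).1 = Uᵀ := by
      rw [star_eq_conjTranspose, conjTranspose_eq_transpose_of_trivial]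
    have hs' : A = U * diagonal hH.eigenvalues * Uᵀ := by
      rw [← hst]
      exact hs
    have hU : IsUnit U.det := by
      have := congrArg det hUU
      rw [det_mul, det_one] at this
      exact IsUnit.of_mul_eq_one _ this
    have hV : IsUnit (Uᵀ).det := by rwa [det_transpose]
    generalize hH.eigenvalues = d at hs'
    have hd : ∀ i, d i ≠ 0 := by
      rw [hs'] at hu
      exact (conj_isUnit U _ hU hV d).1 hu
    have := step' U hU d hd Finset.univ
    simpa [← hs', hUU] using this
  obtain ⟨A, hA, hAu, hAk⟩ := hex
  intro B hB hBu
  exact (key B hB hBu).2 ((key A hA hAu).1 hAk)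
end

section
/- Let n ≥ 2 and let Φ : S_n → S_m be a map preserving adjacency. If there exist A, B ∈ S_n with d(Φ(A), Φ(B)) = n, then d(Φ(X), Φ(Y)) = d(X, Y) for all X, Y ∈ S_n, and Φ is injective. -/
open Matrix

theorem aux_rank_add_le {m : ℕ} (A B : Matrix (Fin m) (Fin m) ℝ) :
    (A + B).rank ≤ A.rank + B.rank := by
  unfold Matrix.rank
  rw [Matrix.mulVecLin_add]
  refine (Submodule.finrank_mono ?_).trans (Submodule.finrank_add_le_finrank_add_finrank _ _)
  rintro _ ⟨x, rfl⟩
  exact Submodule.add_mem_sup ⟨x, rfl⟩ ⟨x, rfl⟩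

theorem aux_rank_neg {m : ℕ} (A : Matrix (Fin m) (Fin m) ℝ) : (-A).rank = A.rank := by
  have h := Matrix.rank_smul_of_mem_nonZeroDivisors (c := (-1 : ℝ)) A (by simp)
  simpa using h

theorem aux_rank_comm {m : ℕ} (A B : Matrix (Fin m) (Fin m) ℝ) :
    (A - B).rank = (B - A).rank := by
  rw [← aux_rank_neg, neg_sub]

theorem aux_rank_tri {m : ℕ} (A B C : Matrix (Fin m) (Fin m) ℝ) :
    (A - C).rank ≤ (A - B).rank + (B - C).rank := by
  have := aux_rank_add_le (A - B) (B - C)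
  simpa using this

theorem aux_rank_le_one {m : ℕ} (A : Matrix (Fin m) (Fin m) ℝ) (h : A.rank ≤ 1) :
    ∃ u v : Fin m → ℝ, A = vecMulVec u v := by
  unfold Matrix.rank at h
  rw [finrank_le_one_iff] at h
  obtain ⟨⟨u, hu⟩, h⟩ := h
  have h' : ∀ j, ∃ c : ℝ, c • u = A.col j := by
    intro j
    obtain ⟨c, hc⟩ := h ⟨A.mulVecLin (Pi.single j 1), ⟨_, rfl⟩⟩
    refine ⟨c, ?_⟩
    have := congrArg Subtype.val hc
    simpa using this
  choose v hv using h'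
  refine ⟨u, v, ?_⟩
  ext i j
  have := congrFun (hv j) i
  simp at this
  simp [vecMulVec_apply, ← this, mul_comm]

theorem aux_symm_rank_one {m : ℕ} (A : Matrix (Fin m) (Fin m) ℝ) (hs : A.IsSymm)
    (h : A.rank = 1) :
    ∃ (a : ℝ) (v : Fin m → ℝ), a ≠ 0 ∧ v ≠ 0 ∧ A = a • vecMulVec v v := by
  obtain ⟨u, v, rfl⟩ := aux_rank_le_one A h.le
  have hv : v ≠ 0 := by
    rintro rfl
    simp at h
  have hvv : v ⬝ᵥ v ≠ 0 := by simpa using hv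
  have key : u = ((u ⬝ᵥ v) / (v ⬝ᵥ v)) • v := by
    have h1 : vecMulVec u v *ᵥ v = (vecMulVec u v)ᵀ *ᵥ v := by rw [hs]
    rw [transpose_vecMulVec, vecMulVec_mulVec, vecMulVec_mulVec] at h1
    ext i
    have h2 := congrFun h1 i
    simp at h2 ⊢
    field_simp
    linarith
  have hA : vecMulVec u v = ((u ⬝ᵥ v) / (v ⬝ᵥ v)) • vecMulVec v v := by
    conv_lhs => rw [key]
    rw [smul_vecMulVec]
  refine ⟨(u ⬝ᵥ v) / (v ⬝ᵥ v), v, ?_, hv, hA⟩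
  intro h0
  rw [hA, h0] at h
  simp at h

theorem aux_parallel {m : ℕ} (E F : Matrix (Fin m) (Fin m) ℝ) (hE : E.IsSymm) (hF : F.IsSymm)
    (hE1 : E.rank = 1) (hF1 : F.rank = 1) (hEF : (E - F).rank ≤ 1) :
    ∃ c : ℝ, c ≠ 0 ∧ E = c • F := by
  obtain ⟨a, y, ha, hy, rfl⟩ := aux_symm_rank_one E hE hE1
  obtain ⟨b, w, hb, hw, rfl⟩ := aux_symm_rank_one F hF hF1
  obtain ⟨u, v, huv⟩ := aux_rank_le_one _ hEF
  have hyy : y ⬝ᵥ y ≠ 0 := by simpa using hy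
  have hww : w ⬝ᵥ w ≠ 0 := by simpa using hw
  have mv : ∀ p i, a * (y ⬝ᵥ p) * y i - b * (w ⬝ᵥ p) * w i = (v ⬝ᵥ p) * u i := by
    intro p i
    have := congrFun (congrArg (fun M => M *ᵥ p) huv) i
    simp [sub_mulVec, smul_mulVec, vecMulVec_mulVec] at this
    linarith
  have key : ∃ k : ℝ, y = k • w := by
    by_contra hk
    push Not at hk
    set q : Fin m → ℝ := w - ((w ⬝ᵥ y) / (y ⬝ᵥ y)) • y with hq
    have hyq : y ⬝ᵥ q = 0 := by
      simp [hq, dotProduct_sub, dotProduct_comm y w]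
      field_simp
      simp
    have hwy : w ⬝ᵥ q = q ⬝ᵥ q := by
      have : w = q + ((w ⬝ᵥ y) / (y ⬝ᵥ y)) • y := by simp [hq]
      conv_lhs => rw [this]
      simp [add_dotProduct, hyq]
    have hq0 : q ≠ 0 := by
      intro h0
      have hw' : w = ((w ⬝ᵥ y) / (y ⬝ᵥ y)) • y := by
        rw [hq, sub_eq_zero] at h0; exact h0
      have hc : (w ⬝ᵥ y) / (y ⬝ᵥ y) ≠ 0 := by
        intro hc; rw [hc] at hw'; simp at hw'; exact hw hw'
      apply hk ((w ⬝ᵥ y) / (y ⬝ᵥ y))⁻¹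
      rw [eq_inv_smul_iff₀ hc]
      exact hw'.symm
    have hqq : q ⬝ᵥ q ≠ 0 := by simpa using hq0
    have h1 : ∀ i, - b * (q ⬝ᵥ q) * w i = (v ⬝ᵥ q) * u i := by
      intro i
      have := mv q i
      rw [hyq, hwy] at this
      linarith
    have hvq : v ⬝ᵥ q ≠ 0 := by
      intro h0
      apply hw
      ext i
      have := h1 i
      simp [h0, hb] at this
      rcases this with h | h
      · exact absurd h hq0
      · exact h
    have h2 : ∀ i, u i = (- b * (q ⬝ᵥ q) / (v ⬝ᵥ q)) * w i := by
      intro i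
      have := h1 i
      field_simp
      linarith
    apply hk ((b * (w ⬝ᵥ y) + (v ⬝ᵥ y) * (- b * (q ⬝ᵥ q) / (v ⬝ᵥ q))) / (a * (y ⬝ᵥ y)))
    ext i
    have h3 := mv y i
    rw [h2 i] at h3
    simp only [Pi.smul_apply, smul_eq_mul]
    rw [div_mul_eq_mul_div, eq_div_iff (mul_ne_zero ha hyy)]
    linarith
  obtain ⟨k, rfl⟩ := key
  have hk : k ≠ 0 := by rintro rfl; simp at hy
  refine ⟨a * k * k / b, by positivity, ?_⟩
  rw [smul_vecMulVec, vecMulVec_smul]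
  ext i j
  simp
  field_simp

theorem aux_rank_step {m : ℕ} (D E F : Matrix (Fin m) (Fin m) ℝ) (hE : E.IsSymm) (hF : F.IsSymm)
    (hE1 : E.rank = 1) (hF1 : F.rank = 1) (hEF : (E - F).rank ≤ 1)
    (hD : D.rank < (D + E).rank) : (D + E).rank ≤ (D + F).rank := by
  obtain ⟨c, hc, rfl⟩ := aux_parallel E F hE hF hE1 hF1 hEF
  obtain ⟨u, v, rfl⟩ := aux_rank_le_one F hF1.le
  have hz : ∃ z, D *ᵥ z = 0 ∧ v ⬝ᵥ z ≠ 0 := by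
    by_contra hcon
    push Not at hcon
    have h1 : LinearMap.ker D.mulVecLin ≤
        LinearMap.ker (D + c • vecMulVec u v).mulVecLin := by
      intro z hz
      simp only [LinearMap.mem_ker, mulVecLin_apply] at hz ⊢
      simp [add_mulVec, hz, smul_mulVec, vecMulVec_mulVec, hcon z hz]
    have h2 := Submodule.finrank_mono h1
    have h3 := LinearMap.finrank_range_add_finrank_ker D.mulVecLin
    have h4 := LinearMap.finrank_range_add_finrank_ker (D + c • vecMulVec u v).mulVecLin
    unfold Matrix.rank at hD
    omega
  obtain ⟨z, hz, hvz⟩ := hz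
  unfold Matrix.rank
  apply Submodule.finrank_mono
  rintro _ ⟨x, rfl⟩
  refine ⟨x + ((c - 1) * (v ⬝ᵥ x) / (v ⬝ᵥ z)) • z, ?_⟩
  simp only [mulVecLin_apply]
  ext i
  simp [add_mulVec, mulVec_add, mulVec_smul, hz, smul_mulVec, vecMulVec_mulVec]
  field_simp
  ring

/-- congruence of a diagonal matrix -/
def auxCg {n : ℕ} (U : Matrix (Fin n) (Fin n) ℝ) (w : Fin n → ℝ) : Matrix (Fin n) (Fin n) ℝ :=
  U * diagonal w * Uᵀ

theorem auxCg_symm {n : ℕ} (U : Matrix (Fin n) (Fin n) ℝ) (w : Fin n → ℝ) :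
    (auxCg U w).IsSymm := by
  simp [auxCg, Matrix.IsSymm, transpose_mul, Matrix.mul_assoc]

theorem auxCg_sub {n : ℕ} (U : Matrix (Fin n) (Fin n) ℝ) (w w' : Fin n → ℝ) :
    auxCg U w - auxCg U w' = auxCg U (w - w') := by
  simp only [auxCg]
  rw [← Matrix.sub_mul, ← Matrix.mul_sub, diagonal_sub]
  rfl

open Classical in
theorem auxCg_rank {n : ℕ} (U : Matrix (Fin n) (Fin n) ℝ) (hU : U.det ≠ 0) (w : Fin n → ℝ) :
    (auxCg U w).rank = (Finset.univ.filter (fun i => w i ≠ 0)).card := by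
  unfold auxCg
  rw [rank_mul_eq_left_of_det_ne_zero Uᵀ _ (by simpa using hU),
    rank_mul_eq_right_of_det_ne_zero U _ hU, rank_diagonal, Fintype.card_subtype]

theorem aux_spec {n : ℕ} (A : Matrix (Fin n) (Fin n) ℝ) (hA : A.IsSymm) :
    ∃ (U : Matrix (Fin n) (Fin n) ℝ) (w : Fin n → ℝ), U * Uᵀ = 1 ∧ U.det ≠ 0 ∧
      A = auxCg U w := by
  have hH : A.IsHermitian := by
    rw [Matrix.IsHermitian, conjTranspose_eq_transpose_of_trivial]; exact hA
  have h1 : (hH.eigenvectorUnitary : Matrix (Fin n) (Fin n) ℝ) *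
      (hH.eigenvectorUnitary : Matrix (Fin n) (Fin n) ℝ)ᵀ = 1 := by
    have := Unitary.mul_star_self_of_mem hH.eigenvectorUnitary.2
    rwa [star_eq_conjTranspose, conjTranspose_eq_transpose_of_trivial] at this
  refine ⟨hH.eigenvectorUnitary, hH.eigenvalues, h1, ?_, ?_⟩
  · intro h0
    have := congrArg det h1
    simp [h0] at this
  · have := hH.spectral_theorem
    rw [Unitary.conjStarAlgAut_apply, star_eq_conjTranspose,
      conjTranspose_eq_transpose_of_trivial] at this
    exact this

theorem aux_exists_t {n : ℕ} (A B : Matrix (Fin n) (Fin n) ℝ) :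
    ∃ t : ℝ, (scalar (Fin n) t - A).det ≠ 0 ∧ (scalar (Fin n) t - B).det ≠ 0 := by
  have h0 : A.charpoly * B.charpoly ≠ 0 :=
    mul_ne_zero A.charpoly_monic.ne_zero B.charpoly_monic.ne_zero
  by_contra hcon
  push Not at hcon
  apply h0
  apply Polynomial.funext
  intro t
  rw [Polynomial.eval_mul, eval_charpoly, eval_charpoly, Polynomial.eval_zero]
  by_cases h : (scalar (Fin n) t - A).det = 0
  · rw [h, zero_mul]
  · rw [hcon t h, mul_zero]

section main
variable {n m : ℕ} {Φ : Matrix (Fin n) (Fin n) ℝ → Matrix (Fin m) (Fin m) ℝ}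

theorem aux_contr
    (hΦadj : ∀ A B : Matrix (Fin n) (Fin n) ℝ, A.IsSymm → B.IsSymm →
      (A - B).rank = 1 → (Φ A - Φ B).rank = 1)
    (X Y : Matrix (Fin n) (Fin n) ℝ) (hX : X.IsSymm) (hY : Y.IsSymm) :
    (Φ X - Φ Y).rank ≤ (X - Y).rank := by
  classical
  obtain ⟨U, w, -, hU, hw⟩ := aux_spec (X - Y) (hX.sub hY)
  have key : ∀ S : Finset (Fin n),
      (Φ (Y + auxCg U (fun i => if i ∈ S then w i else 0)) - Φ Y).rank
        ≤ (S.filter (fun i => w i ≠ 0)).card := by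
    intro S
    induction S using Finset.induction_on with
    | empty =>
      have : auxCg U (fun _ => 0) = 0 := by simp [auxCg]
      simp [this]
    | insert a S ha ih =>
      by_cases hwa : w a = 0
      · have h1 : (fun i => if i ∈ insert a S then w i else 0)
            = fun i => if i ∈ S then w i else 0 := by
          ext i
          by_cases hi : i = a
          · subst hi; simp [hwa]
          · simp [hi]
        rw [h1, Finset.filter_insert, if_neg (by simpa using hwa)]
        exact ih
      · rw [Finset.filter_insert, if_pos hwa, Finset.card_insert_of_notMem (by simp [ha])]
        refine (aux_rank_tri _ (Φ (Y + auxCg U (fun i => if i ∈ S then w i else 0))) _).trans ?_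
        rw [add_comm]
        refine add_le_add ih (le_of_eq ?_)
        apply hΦadj _ _ (hY.add (auxCg_symm _ _)) (hY.add (auxCg_symm _ _))
        rw [add_sub_add_left_eq_sub, auxCg_sub, auxCg_rank U hU]
        rw [Finset.card_eq_one]
        refine ⟨a, ?_⟩
        ext i
        by_cases hi : i = a
        · subst hi; simp [ha, hwa]
        · simp [hi]
  have h := key Finset.univ
  rw [hw, auxCg_rank U hU]
  simp only [Finset.mem_univ, if_true] at h
  rwa [← hw, add_sub_cancel] at h

theorem aux_step
    (hΦsym : ∀ A : Matrix (Fin n) (Fin n) ℝ, A.IsSymm → (Φ A).IsSymm)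
    (hΦadj : ∀ A B : Matrix (Fin n) (Fin n) ℝ, A.IsSymm → B.IsSymm →
      (A - B).rank = 1 → (Φ A - Φ B).rank = 1)
    (A C P Q : Matrix (Fin n) (Fin n) ℝ) (hA : A.IsSymm) (hC : C.IsSymm) (hP : P.IsSymm)
    (hQ : Q.IsSymm) (hPC : (P - C).rank = 1) (hQC : (Q - C).rank = 1) (hPQ : (P - Q).rank = 1)
    (hCA : (C - A).rank < n) (h : (Φ P - Φ A).rank = n) : (Φ Q - Φ A).rank = n := by
  have h1 := aux_rank_step (Φ C - Φ A) (Φ P - Φ C) (Φ Q - Φ C)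
    ((hΦsym _ hP).sub (hΦsym _ hC)) ((hΦsym _ hQ).sub (hΦsym _ hC))
    (hΦadj _ _ hP hC hPC) (hΦadj _ _ hQ hC hQC)
    (by rw [sub_sub_sub_cancel_right]; exact (hΦadj _ _ hP hQ hPQ).le)
  have e : ∀ R, Φ C - Φ A + (Φ R - Φ C) = Φ R - Φ A := by intro R; abel
  rw [e, e, h] at h1
  have h2 := h1 ((aux_contr hΦadj C A hC hA).trans_lt hCA)
  have h3 := (aux_contr hΦadj Q A hQ hA).trans (rank_le_width _)
  omega

theorem aux_diag
    (hΦsym : ∀ A : Matrix (Fin n) (Fin n) ℝ, A.IsSymm → (Φ A).IsSymm)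
    (hΦadj : ∀ A B : Matrix (Fin n) (Fin n) ℝ, A.IsSymm → B.IsSymm →
      (A - B).rank = 1 → (Φ A - Φ B).rank = 1)
    (A U : Matrix (Fin n) (Fin n) ℝ) (hA : A.IsSymm) (hU : U.det ≠ 0)
    (w w' : Fin n → ℝ) (hw : ∀ i, w i ≠ 0) (hw' : ∀ i, w' i ≠ 0)
    (h : (Φ (A + auxCg U w) - Φ A).rank = n) :
    (Φ (A + auxCg U w') - Φ A).rank = n := by
  classical
  have key : ∀ S : Finset (Fin n),
      (Φ (A + auxCg U (fun i => if i ∈ S then w' i else w i)) - Φ A).rank = n := by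
    intro S
    induction S using Finset.induction_on with
    | empty => simpa using h
    | insert a S ha ih =>
      by_cases hwa : w a = w' a
      · have h1 : (fun i => if i ∈ insert a S then w' i else w i)
            = fun i => if i ∈ S then w' i else w i := by
          ext i
          by_cases hi : i = a
          · subst hi; simp [hwa]
          · simp [hi]
        rw [h1]
        exact ih
      · have one : ∀ z : Fin n → ℝ, z a ≠ 0 → (∀ i, i ≠ a → z i = 0) →
            (auxCg U z).rank = 1 := by
          intro z hz hz'
          rw [auxCg_rank U hU, Finset.card_eq_one]
          refine ⟨a, ?_⟩
          ext i
          by_cases hi : i = a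
          · subst hi; simp [hz]
          · simp [hi, hz' i hi]
        refine aux_step hΦsym hΦadj A
          (A + auxCg U (Function.update (fun i => if i ∈ S then w' i else w i) a 0)) _ _ hA
          (hA.add (auxCg_symm _ _)) (hA.add (auxCg_symm _ _)) (hA.add (auxCg_symm _ _))
          ?_ ?_ ?_ ?_ ih
        · rw [add_sub_add_left_eq_sub, auxCg_sub]
          apply one
          · simp [ha, hw]
          · intro i hi; simp [hi]
        · rw [add_sub_add_left_eq_sub, auxCg_sub]
          apply one
          · simp [hw']
          · intro i hi; simp [hi]
        · rw [add_sub_add_left_eq_sub, auxCg_sub]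
          apply one
          · simp [ha, sub_eq_zero, hwa]
          · intro i hi; simp [hi]
        · rw [add_sub_cancel_left, auxCg_rank U hU]
          calc _ < (Finset.univ : Finset (Fin n)).card := by
                apply Finset.card_lt_card
                rw [Finset.filter_ssubset]
                exact ⟨a, Finset.mem_univ _, by simp⟩
            _ = n := by simp
  simpa using key Finset.univ

theorem aux_one {n : ℕ} (U : Matrix (Fin n) (Fin n) ℝ) (w : Fin n → ℝ) (hU : U.det ≠ 0)
    (h : (auxCg U w).rank = n) (i : Fin n) : w i ≠ 0 := by
  classical
  rw [auxCg_rank U hU] at h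
  have h2 : (Finset.univ.filter (fun i => w i ≠ 0)) = Finset.univ := by
    apply Finset.eq_univ_of_card
    simpa using h
  have := Finset.mem_univ i
  rw [← h2] at this
  simpa using this

theorem aux_fix
    (hΦsym : ∀ A : Matrix (Fin n) (Fin n) ℝ, A.IsSymm → (Φ A).IsSymm)
    (hΦadj : ∀ A B : Matrix (Fin n) (Fin n) ℝ, A.IsSymm → B.IsSymm →
      (A - B).rank = 1 → (Φ A - Φ B).rank = 1)
    (A B C : Matrix (Fin n) (Fin n) ℝ) (hA : A.IsSymm) (hB : B.IsSymm) (hC : C.IsSymm)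
    (hCA : (C - A).rank = n)
    (h : (Φ B - Φ A).rank = n) : (Φ C - Φ A).rank = n := by
  have hBA : (B - A).rank = n := by
    have h1 := aux_contr hΦadj B A hB hA
    have h2 := rank_le_width (B - A)
    omega
  have e : ∀ U : Matrix (Fin n) (Fin n) ℝ, U * Uᵀ = 1 → auxCg U (fun _ => 1) = 1 := by
    intro U hU; simp [auxCg, hU]
  obtain ⟨U, w, hU1, hU, hw⟩ := aux_spec (B - A) (hB.sub hA)
  obtain ⟨V, z, hV1, hV, hz⟩ := aux_spec (C - A) (hC.sub hA)
  have h1 := aux_diag hΦsym hΦadj A U hA hU w (fun _ => 1)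
    (aux_one U w hU (hw ▸ hBA)) (by simp) (by rwa [← hw, add_sub_cancel])
  rw [e U hU1, ← e V hV1] at h1
  have h2 := aux_diag hΦsym hΦadj A V hA hV (fun _ => 1) z (by simp)
    (aux_one V z hV (hz ▸ hCA)) h1
  rwa [← hz, add_sub_cancel] at h2

theorem aux_all
    (hΦsym : ∀ A : Matrix (Fin n) (Fin n) ℝ, A.IsSymm → (Φ A).IsSymm)
    (hΦadj : ∀ A B : Matrix (Fin n) (Fin n) ℝ, A.IsSymm → B.IsSymm →
      (A - B).rank = 1 → (Φ A - Φ B).rank = 1)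
    (A B X Z : Matrix (Fin n) (Fin n) ℝ) (hA : A.IsSymm) (hB : B.IsSymm) (hX : X.IsSymm)
    (hZ : Z.IsSymm) (hXZ : (X - Z).rank = n)
    (h : (Φ A - Φ B).rank = n) : (Φ X - Φ Z).rank = n := by
  obtain ⟨t, ht1, ht2⟩ := aux_exists_t B Z
  have hT : (scalar (Fin n) t).IsSymm := by simp [Matrix.IsSymm]
  have r : ∀ M : Matrix (Fin n) (Fin n) ℝ, M.det ≠ 0 → M.rank = n := by
    intro M hM
    simpa using rank_of_det_ne_zero hM
  have h1 := aux_fix hΦsym hΦadj B A _ hB hA hT (r _ ht1) h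
  rw [aux_rank_comm] at h1
  have h2 := aux_fix hΦsym hΦadj _ B Z hT hB hZ (by rw [aux_rank_comm]; exact r _ ht2) h1
  rw [aux_rank_comm] at h2
  exact aux_fix hΦsym hΦadj Z _ X hZ hT hX hXZ h2

theorem aux_ext (X Y : Matrix (Fin n) (Fin n) ℝ) (hX : X.IsSymm) (hY : Y.IsSymm) :
    ∃ Z : Matrix (Fin n) (Fin n) ℝ, Z.IsSymm ∧ (X - Z).rank = n ∧
      (Y - Z).rank + (X - Y).rank = n := by
  classical
  obtain ⟨U, w, -, hU, hw⟩ := aux_spec (X - Y) (hX.sub hY)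
  refine ⟨Y - auxCg U (fun i => if w i = 0 then 1 else 0), hY.sub (auxCg_symm _ _), ?_, ?_⟩
  · have : X - (Y - auxCg U (fun i => if w i = 0 then 1 else 0))
        = auxCg U (fun i => if w i = 0 then 1 else w i) := by
      have h1 : (fun i => if w i = 0 then 1 else w i) - w =
          fun i => if w i = 0 then (1:ℝ) else 0 := by
        ext i; by_cases hi : w i = 0 <;> simp [hi]
      rw [← h1, ← auxCg_sub, ← hw]
      abel
    rw [this, auxCg_rank U hU, Finset.filter_true_of_mem]
    · simp
    · intro i _; by_cases hi : w i = 0 <;> simp [hi]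
  · rw [sub_sub_cancel, hw, auxCg_rank U hU, auxCg_rank U hU]
    have := Finset.card_filter_add_card_filter_not (s := (Finset.univ : Finset (Fin n)))
      (fun i => w i = 0)
    simpa using this

end main


/-- If an adjacency preserving map `Φ : S_n → S_m` (`n ≥ 2`) attains
`d(Φ(A), Φ(B)) = n` somewhere, then `Φ` preserves the arithmetic distance
everywhere and is injective. -/
theorem distance_preserving_of_max_distance (n m : ℕ) (hn : 2 ≤ n)
    (Φ : Matrix (Fin n) (Fin n) ℝ → Matrix (Fin m) (Fin m) ℝ)
    (hΦsym : ∀ A : Matrix (Fin n) (Fin n) ℝ, A.IsSymm → (Φ A).IsSymm)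
    (hΦadj : ∀ A B : Matrix (Fin n) (Fin n) ℝ, A.IsSymm → B.IsSymm →
      (A - B).rank = 1 → (Φ A - Φ B).rank = 1)
    (h : ∃ A B : Matrix (Fin n) (Fin n) ℝ, A.IsSymm ∧ B.IsSymm ∧
      (Φ A - Φ B).rank = n) :
    (∀ X Y : Matrix (Fin n) (Fin n) ℝ, X.IsSymm → Y.IsSymm →
      (Φ X - Φ Y).rank = (X - Y).rank) ∧
    (∀ X Y : Matrix (Fin n) (Fin n) ℝ, X.IsSymm → Y.IsSymm →
      Φ X = Φ Y → X = Y) := by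
  classical
  obtain ⟨A, B, hA, hB, hAB⟩ := h
  have main : ∀ X Y : Matrix (Fin n) (Fin n) ℝ, X.IsSymm → Y.IsSymm →
      (Φ X - Φ Y).rank = (X - Y).rank := by
    intro X Y hX hY
    obtain ⟨Z, hZ, h1, h2⟩ := aux_ext X Y hX hY
    have h3 := aux_all hΦsym hΦadj A B X Z hA hB hX hZ h1 hAB
    have h4 := aux_contr hΦadj X Y hX hY
    have h5 := aux_contr hΦadj Y Z hY hZ
    have h6 := aux_rank_tri (Φ X) (Φ Y) (Φ Z)
    omega
  refine ⟨main, ?_⟩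
  intro X Y hX hY hXY
  have h1 := main X Y hX hY
  rw [hXY, sub_self, rank_zero] at h1
  obtain ⟨U, w, -, hU, hw⟩ := aux_spec (X - Y) (hX.sub hY)
  rw [hw, auxCg_rank U hU] at h1
  have h2 := Finset.card_eq_zero.mp h1.symm
  rw [Finset.filter_eq_empty_iff] at h2
  have h3 : w = fun _ => 0 := by
    ext i; simpa using h2 (Finset.mem_univ i)
  rw [h3] at hw
  rw [← sub_eq_zero, hw]
  simp [auxCg]
end
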